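/- Let D ⊂ ℂ be a domain and let ρ : D → [-∞,∞) be a subharmonic function that is bounded from below and not constant. Then ρ = ρ̃* on D. -/

import Mathlib

open MeasureTheory Filter Metric Set

/-- `elog x` is `log x` with value `-∞` for `x ≤ 0`, as an extended real. -/
noncomputable def elog (x : ℝ) : EReal := if x ≤ 0 then ⊥ else ((Real.log x : ℝ) : EReal)

/-- The sub-mean value inequality over circles of closed discs contained in `Ω`, phrased via
continuous real-valued majorants of the (extended-real-valued) function on the circle. -/
def SubmeanOn (u : ℂ → EReal) (Ω : Set ℂ) : Prop :=
  ∀ c : ℂ, ∀ r : ℝ, 0 < r → Metric.closedBall c r ⊆ Ω →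
    ∀ φ : ℝ → ℝ, Continuous φ →
      (∀ θ : ℝ, u (c + r * Complex.exp (θ * Complex.I)) ≤ ((φ θ : ℝ) : EReal)) →
      u c ≤ (((2 * Real.pi)⁻¹ * ∫ θ in (0:ℝ)..(2 * Real.pi), φ θ : ℝ) : EReal)

/-- `u : Ω → [-∞, ∞)` is subharmonic on the open set `Ω ⊆ ℂ`: upper semicontinuous,
nowhere `+∞`, not identically `-∞` on any connected component, sub-mean value inequality. -/
def SubharmonicOn (u : ℂ → EReal) (Ω : Set ℂ) : Prop :=
  IsOpen Ω ∧ UpperSemicontinuousOn u Ω ∧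
  (∀ z ∈ Ω, u z ≠ ⊤) ∧
  (∀ z ∈ Ω, ∃ w ∈ connectedComponentIn Ω z, u w ≠ ⊥) ∧
  SubmeanOn u Ω

/-- A set `E ⊆ ℂ` is polar if some subharmonic function on an open set containing `E`
equals `-∞` on `E`. -/
def PolarSet (E : Set ℂ) : Prop :=
  ∃ Ω : Set ℂ, E ⊆ Ω ∧ ∃ u : ℂ → EReal, SubharmonicOn u Ω ∧ ∀ z ∈ E, u z = ⊥

/-- The space of square-integrable holomorphic functions on `D`. -/
def L2h {E : Type*} [NormedAddCommGroup E] [NormedSpace ℂ E] [MeasureSpace E]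
    (D : Set E) : Set (E → ℂ) :=
  {f | DifferentiableOn ℂ f D ∧ IntegrableOn (fun z => ‖f z‖ ^ 2) D volume}

/-- `D` is an `L²ₕ`-domain of holomorphy. -/
def IsL2hDomainOfHolomorphy {E : Type*} [NormedAddCommGroup E] [NormedSpace ℂ E]
    [MeasureSpace E] (D : Set E) : Prop :=
  ¬ ∃ D₀ D₁ : Set E, IsOpen D₀ ∧ IsConnected D₀ ∧ IsOpen D₁ ∧ IsConnected D₁ ∧
      D₀ ⊆ D₁ ∩ D ∧ ¬ (D₁ ⊆ D) ∧
      ∀ f ∈ L2h D, ∃ g : E → ℂ, DifferentiableOn ℂ g D₁ ∧ Set.EqOn g f D₀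

/-- The Hartogs domain `G_{D,ρ} = {(z₁,z₂) : z₁ ∈ D, |z₂| < e^{-ρ(z₁)}}`. -/
def hartogs (D : Set ℂ) (ρ : ℂ → EReal) : Set (ℂ × ℂ) :=
  {p | p.1 ∈ D ∧ elog ‖p.2‖ < - ρ p.1}

/-- `S(D)`: boundary points near which the complement of `D` is polar. -/
def polarS (D : Set ℂ) : Set ℂ :=
  {z ∈ frontier D | ∃ U : Set ℂ, IsOpen U ∧ z ∈ U ∧ PolarSet (U \ D)}

/-- `fj` is the family of coefficients of a Hartogs expansion of `f` on `G_{D,ρ}`. -/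
def HartogsExpansion (D : Set ℂ) (ρ : ℂ → EReal) (f : ℂ × ℂ → ℂ) (fj : ℕ → ℂ → ℂ) : Prop :=
  (∀ j, DifferentiableOn ℂ (fj j) D) ∧
  ∀ p ∈ hartogs D ρ, HasSum (fun j => fj j p.1 * p.2 ^ j) (f p)

/-- `ρ_f(z) = limsup_j (1/j) log |f_j(z)|` for coefficients `fj`. -/
noncomputable def coeffGrowth (fj : ℕ → ℂ → ℂ) (z : ℂ) : EReal :=
  Filter.limsup (fun (j : ℕ) => ((((j : ℝ)⁻¹ : ℝ)) : EReal) * elog ‖fj j z‖) Filter.atTop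

/-- The upper semicontinuous regularization `g*`. -/
noncomputable def uscReg (g : ℂ → EReal) (z : ℂ) : EReal := Filter.limsup g (nhds z)

/-- `ρ̃ = sup_{f ∈ L²ₕ(G_{D,ρ})} (ρ_f)*`. -/
noncomputable def rhoTilde (D : Set ℂ) (ρ : ℂ → EReal) (z : ℂ) : EReal :=
  ⨆ fj ∈ {fj : ℕ → ℂ → ℂ | ∃ f ∈ L2h (hartogs D ρ), HartogsExpansion D ρ f fj},
    uscReg (coeffGrowth fj) z

/-- `D̂ = D ∪ {z ∈ S(D) : limsup_{D ∋ w → z} ρ(w) < ∞}`. -/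
def DHat (D : Set ℂ) (ρ : ℂ → EReal) : Set ℂ :=
  D ∪ {z ∈ polarS D | Filter.limsup ρ (nhdsWithin z D) < ⊤}

open Classical in
/-- `ρ̂`, extending `ρ` to `D̂` by boundary limsups. -/
noncomputable def rhoHat (D : Set ℂ) (ρ : ℂ → EReal) (z : ℂ) : EReal :=
  if z ∈ D then ρ z else Filter.limsup ρ (nhdsWithin z D)

/-- `u` is plurisubharmonic on an open `Ω ⊆ ℂⁿ`. -/
def PlurisubharmonicOn {n : ℕ} (u : (Fin n → ℂ) → EReal) (Ω : Set (Fin n → ℂ)) : Prop :=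
  IsOpen Ω ∧ UpperSemicontinuousOn u Ω ∧
  (∀ z ∈ Ω, u z ≠ ⊤) ∧
  (∀ z ∈ Ω, ∃ w ∈ connectedComponentIn Ω z, u w ≠ ⊥) ∧
  ∀ a b : Fin n → ℂ, SubmeanOn (fun lam => u (a + lam • b)) {lam : ℂ | a + lam • b ∈ Ω}

/-- A set `E ⊆ ℂⁿ` is pluripolar. -/
def PluripolarSet {n : ℕ} (E : Set (Fin n → ℂ)) : Prop :=
  ∃ Ω : Set (Fin n → ℂ), E ⊆ Ω ∧
    ∃ u : (Fin n → ℂ) → EReal, PlurisubharmonicOn u Ω ∧ ∀ z ∈ E, u z = ⊥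

/-- `D ⊆ ℂⁿ` is pseudoconvex: it admits a plurisubharmonic exhaustion function. -/
def IsPseudoconvex {n : ℕ} (D : Set (Fin n → ℂ)) : Prop :=
  ∃ u : (Fin n → ℂ) → EReal, PlurisubharmonicOn u D ∧
    ∀ c : ℝ, IsCompact {z | z ∈ D ∧ u z ≤ (c : EReal)}

/-- `L²ₕ(D)` is infinite dimensional: arbitrarily many elements that are
linearly independent as functions on `D`. -/
def L2hInfiniteDim {E : Type*} [NormedAddCommGroup E] [NormedSpace ℂ E] [MeasureSpace E]
    (D : Set E) : Prop :=
  ∀ N : ℕ, ∃ fs : Fin N → E → ℂ, (∀ i, fs i ∈ L2h D) ∧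
    ∀ c : Fin N → ℂ, (∀ z ∈ D, ∑ i, c i * fs i z = 0) → c = 0

/-! ### Plane differential calculus -/

/-- Partial derivative in the real direction. -/
noncomputable def dX (f : ℂ → ℝ) (z : ℂ) : ℝ := fderiv ℝ f z 1

/-- Partial derivative in the imaginary direction. -/
noncomputable def dY (f : ℂ → ℝ) (z : ℂ) : ℝ := fderiv ℝ f z Complex.I

/-- The Laplacian on the plane. -/
noncomputable def lap (f : ℂ → ℝ) (z : ℂ) : ℝ := dX (dX f) z + dY (dY f) z

lemma ContDiff.dX {f : ℂ → ℝ} {n m : ℕ∞} (hf : ContDiff ℝ n f) (h : m + 1 ≤ n) :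
    ContDiff ℝ m (dX f) :=
  (hf.fderiv_right (m := m) (by exact_mod_cast h)).clm_apply contDiff_const

lemma ContDiff.dY {f : ℂ → ℝ} {n m : ℕ∞} (hf : ContDiff ℝ n f) (h : m + 1 ≤ n) :
    ContDiff ℝ m (dY f) :=
  (hf.fderiv_right (m := m) (by exact_mod_cast h)).clm_apply contDiff_const

lemma ContDiff.continuous_lap {f : ℂ → ℝ} (hf : ContDiff ℝ 2 f) : Continuous (lap f) := by
  have h1 := ((hf.dX (n := 2) (m := 1) (by norm_num)).dX (m := 0) (by norm_num)).continuous
  have h2 := ((hf.dY (n := 2) (m := 1) (by norm_num)).dY (m := 0) (by norm_num)).continuous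
  exact h1.add h2

lemma HasCompactSupport.dX {f : ℂ → ℝ} (hf : HasCompactSupport f) : HasCompactSupport (dX f) :=
  hf.fderiv_apply ℝ 1

lemma HasCompactSupport.dY {f : ℂ → ℝ} (hf : HasCompactSupport f) : HasCompactSupport (dY f) :=
  hf.fderiv_apply ℝ Complex.I

lemma HasCompactSupport.lap {f : ℂ → ℝ} (hf : HasCompactSupport f) : HasCompactSupport (lap f) :=
  hf.dX.dX.add hf.dY.dY

section rules
variable {f g : ℂ → ℝ} {z : ℂ}

lemma dX_add (hf : DifferentiableAt ℝ f z) (hg : DifferentiableAt ℝ g z) :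
    dX (fun x => f x + g x) z = dX f z + dX g z := by
  simp [dX, fderiv_fun_add hf hg]

lemma dY_add (hf : DifferentiableAt ℝ f z) (hg : DifferentiableAt ℝ g z) :
    dY (fun x => f x + g x) z = dY f z + dY g z := by
  simp [dY, fderiv_fun_add hf hg]

lemma dX_sub (hf : DifferentiableAt ℝ f z) (hg : DifferentiableAt ℝ g z) :
    dX (fun x => f x - g x) z = dX f z - dX g z := by
  simp [dX, fderiv_fun_sub hf hg]

lemma dY_sub (hf : DifferentiableAt ℝ f z) (hg : DifferentiableAt ℝ g z) :
    dY (fun x => f x - g x) z = dY f z - dY g z := by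
  simp [dY, fderiv_fun_sub hf hg]

lemma dX_mul (hf : DifferentiableAt ℝ f z) (hg : DifferentiableAt ℝ g z) :
    dX (fun x => f x * g x) z = f z * dX g z + dX f z * g z := by
  simp [dX, fderiv_fun_mul hf hg, mul_comm]

lemma dY_mul (hf : DifferentiableAt ℝ f z) (hg : DifferentiableAt ℝ g z) :
    dY (fun x => f x * g x) z = f z * dY g z + dY f z * g z := by
  simp [dY, fderiv_fun_mul hf hg, mul_comm]

lemma dX_const_mul (c : ℝ) (f : ℂ → ℝ) (z : ℂ) : dX (fun x => c * f x) z = c * dX f z := by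
  have : (fun x => c * f x) = c • f := rfl
  simp [dX, this, fderiv_const_smul_field]

lemma dY_const_mul (c : ℝ) (f : ℂ → ℝ) (z : ℂ) : dY (fun x => c * f x) z = c * dY f z := by
  have : (fun x => c * f x) = c • f := rfl
  simp [dY, this, fderiv_const_smul_field]

lemma dX_const (c : ℝ) (z : ℂ) : dX (fun _ => c) z = 0 := by simp [dX]

lemma dY_const (c : ℝ) (z : ℂ) : dY (fun _ => c) z = 0 := by simp [dY]

lemma dX_comp {F : ℝ → ℝ} {F' : ℝ} (hf : DifferentiableAt ℝ f z) (hF : HasDerivAt F F' (f z)) :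
    dX (fun x => F (f x)) z = F' * dX f z := by
  have h := (hF.hasFDerivAt.comp z hf.hasFDerivAt).fderiv
  simp only [Function.comp_def] at h
  simp [dX, h, mul_comm]

lemma dY_comp {F : ℝ → ℝ} {F' : ℝ} (hf : DifferentiableAt ℝ f z) (hF : HasDerivAt F F' (f z)) :
    dY (fun x => F (f x)) z = F' * dY f z := by
  have h := (hF.hasFDerivAt.comp z hf.hasFDerivAt).fderiv
  simp only [Function.comp_def] at h
  simp [dY, h, mul_comm]

end rules

lemma dX_dY_comm {f : ℂ → ℝ} (hf : ContDiff ℝ 2 f) (z : ℂ) : dX (dY f) z = dY (dX f) z := by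
  have hs : IsSymmSndFDerivAt ℝ f z := hf.contDiffAt.isSymmSndFDerivAt (by simp)
  have hd : DifferentiableAt ℝ (fderiv ℝ f) z :=
    ((hf.fderiv_right (m := 1) (by norm_num)).differentiable (by norm_num)) z
  have h1 : ∀ v w : ℂ, fderiv ℝ (fun x => fderiv ℝ f x v) z w = fderiv ℝ (fderiv ℝ f) z w v := by
    intro v w
    rw [fderiv_clm_apply hd (differentiableAt_const v)]
    simp
  simp only [dX, dY]
  change fderiv ℝ (fun x => fderiv ℝ f x Complex.I) z 1 = fderiv ℝ (fun x => fderiv ℝ f x 1) z Complex.I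
  rw [h1, h1]
  exact hs.eq 1 Complex.I

lemma lap_add {f g : ℂ → ℝ} (hf : ContDiff ℝ 2 f) (hg : ContDiff ℝ 2 g) (z : ℂ) :
    lap (fun x => f x + g x) z = lap f z + lap g z := by
  have hf1 := hf.differentiable (by norm_num)
  have hg1 := hg.differentiable (by norm_num)
  have e1 : dX (fun x => f x + g x) = fun x => dX f x + dX g x :=
    funext fun x => dX_add (hf1 x) (hg1 x)
  have e2 : dY (fun x => f x + g x) = fun x => dY f x + dY g x :=
    funext fun x => dY_add (hf1 x) (hg1 x)
  have a := (hf.dX (n := 2) (m := 1) (by norm_num)).differentiable (by norm_num)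
  have b := (hg.dX (n := 2) (m := 1) (by norm_num)).differentiable (by norm_num)
  have c := (hf.dY (n := 2) (m := 1) (by norm_num)).differentiable (by norm_num)
  have d := (hg.dY (n := 2) (m := 1) (by norm_num)).differentiable (by norm_num)
  simp only [lap, e1, e2, dX_add (a z) (b z), dY_add (c z) (d z)]
  ring

lemma lap_const_mul (c : ℝ) (f : ℂ → ℝ) (z : ℂ) : lap (fun x => c * f x) z = c * lap f z := by
  have e1 : dX (fun x => c * f x) = fun x => c * dX f x := funext fun x => dX_const_mul c f x
  have e2 : dY (fun x => c * f x) = fun x => c * dY f x := funext fun x => dY_const_mul c f x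
  simp only [lap, e1, e2, dX_const_mul, dY_const_mul]
  ring

lemma lap_const (c : ℝ) (z : ℂ) : lap (fun _ => c) z = 0 := by
  have e1 : dX (fun _ => c) = fun _ => 0 := funext fun x => dX_const c x
  have e2 : dY (fun _ => c) = fun _ => 0 := funext fun x => dY_const c x
  simp only [lap, e1, e2, dX_const, dY_const, add_zero]

/-- Laplacian of a composition with a function of one real variable. -/
lemma lap_comp {F F1 F2 : ℝ → ℝ} {f : ℂ → ℝ} {S : Set ℝ} (hS : ∀ z, f z ∈ S)
    (hf : ContDiff ℝ 2 f) (h1 : ∀ s ∈ S, HasDerivAt F (F1 s) s)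
    (h2 : ∀ s ∈ S, HasDerivAt F1 (F2 s) s) (z : ℂ) :
    lap (fun x => F (f x)) z = F1 (f z) * lap f z + F2 (f z) * (dX f z ^ 2 + dY f z ^ 2) := by
  have hf1 := hf.differentiable (by norm_num)
  have a := (hf.dX (n := 2) (m := 1) (by norm_num)).differentiable (by norm_num)
  have c := (hf.dY (n := 2) (m := 1) (by norm_num)).differentiable (by norm_num)
  have e1 : dX (fun x => F (f x)) = fun x => F1 (f x) * dX f x :=
    funext fun x => dX_comp (hf1 x) (h1 _ (hS x))
  have e2 : dY (fun x => F (f x)) = fun x => F1 (f x) * dY f x :=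
    funext fun x => dY_comp (hf1 x) (h1 _ (hS x))
  have hF1 : DifferentiableAt ℝ (fun x => F1 (f x)) z :=
    (h2 _ (hS z)).differentiableAt.comp z (hf1 z)
  simp only [lap, e1, e2, dX_mul hF1 (a z), dY_mul hF1 (c z), dX_comp (hf1 z) (h2 _ (hS z)),
    dY_comp (hf1 z) (h2 _ (hS z))]
  ring

lemma hasFDerivAt_normSq_sub (c z : ℂ) : HasFDerivAt (fun z => Complex.normSq (z - c))
    ((2 * (z - c).re) • Complex.reCLM + (2 * (z - c).im) • Complex.imCLM) z := by
  have h1 : HasFDerivAt (fun z : ℂ => (z - c).re) Complex.reCLM z := by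
    have := Complex.reCLM.hasFDerivAt (x := z) |>.sub_const c.re
    simpa using this
  have h2 : HasFDerivAt (fun z : ℂ => (z - c).im) Complex.imCLM z := by
    have := Complex.imCLM.hasFDerivAt (x := z) |>.sub_const c.im
    simpa using this
  have h := (h1.mul h1).add (h2.mul h2)
  simp only [Complex.normSq_apply]
  refine h.congr_fderiv (ContinuousLinearMap.ext fun v => ?_)
  simp
  ring

lemma contDiff_normSq_sub (c : ℂ) {n : WithTop ℕ∞} :
    ContDiff ℝ n (fun z => Complex.normSq (z - c)) := by
  simp only [Complex.normSq_apply]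
  have h1 : ContDiff ℝ n (fun z : ℂ => (z - c).re) :=
    Complex.reCLM.contDiff.comp (contDiff_id.sub contDiff_const)
  have h2 : ContDiff ℝ n (fun z : ℂ => (z - c).im) :=
    Complex.imCLM.contDiff.comp (contDiff_id.sub contDiff_const)
  exact (h1.mul h1).add (h2.mul h2)

lemma dX_normSq_sub (c z : ℂ) : dX (fun z => Complex.normSq (z - c)) z = 2 * (z - c).re := by
  simp [dX, (hasFDerivAt_normSq_sub c z).fderiv]

lemma dY_normSq_sub (c z : ℂ) : dY (fun z => Complex.normSq (z - c)) z = 2 * (z - c).im := by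
  simp [dY, (hasFDerivAt_normSq_sub c z).fderiv]

lemma lap_normSq_sub (c z : ℂ) : lap (fun z => Complex.normSq (z - c)) z = 4 := by
  have e1 : dX (fun z => Complex.normSq (z - c)) = fun z => 2 * (z - c).re :=
    funext fun x => dX_normSq_sub c x
  have e2 : dY (fun z => Complex.normSq (z - c)) = fun z => 2 * (z - c).im :=
    funext fun x => dY_normSq_sub c x
  have h1 : HasFDerivAt (fun z : ℂ => (z - c).re) Complex.reCLM z := by
    have := Complex.reCLM.hasFDerivAt (x := z) |>.sub_const c.re
    simpa using this
  have h2 : HasFDerivAt (fun z : ℂ => (z - c).im) Complex.imCLM z := by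
    have := Complex.imCLM.hasFDerivAt (x := z) |>.sub_const c.im
    simpa using this
  rw [lap, e1, e2, dX_const_mul, dY_const_mul]
  simp only [dX, dY, h1.fderiv, h2.fderiv]
  simp
  norm_num

/-- Laplacian of a radial function, in terms of the squared modulus. -/
lemma lap_radial {F F1 F2 : ℝ → ℝ} (h1 : ∀ s, 0 ≤ s → HasDerivAt F (F1 s) s)
    (h2 : ∀ s, 0 ≤ s → HasDerivAt F1 (F2 s) s) (c z : ℂ) :
    lap (fun z => F (Complex.normSq (z - c))) z =
      4 * (F1 (Complex.normSq (z - c)) + Complex.normSq (z - c) * F2 (Complex.normSq (z - c))) := by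
  rw [lap_comp (S := Ici 0) (fun z => Complex.normSq_nonneg (z - c)) (contDiff_normSq_sub c) h1 h2,
    lap_normSq_sub, dX_normSq_sub, dY_normSq_sub]
  have : (2 * (z - c).re) ^ 2 + (2 * (z - c).im) ^ 2 = 4 * Complex.normSq (z - c) := by
    rw [Complex.normSq_apply]; ring
  rw [this]; ring

lemma integral_dX_eq_zero {f : ℂ → ℝ} (hf : ContDiff ℝ 1 f) (hc : HasCompactSupport f) :
    ∫ z, dX f z = 0 := by
  have hi := (((hf.dX (n := 1) (m := 0) (by norm_num)).continuous).integrable_of_hasCompactSupport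
    hc.dX (μ := volume))
  have := integral_mul_fderiv_eq_neg_fderiv_mul_of_integrable (μ := (volume : Measure ℂ))
    (f := fun _ : ℂ => (1 : ℝ)) (g := f) (v := (1 : ℂ)) (by simp) (by simpa using! hi)
    (by simpa using hf.continuous.integrable_of_hasCompactSupport hc) (by simp)
    (fun x _ => hf.differentiable (by norm_num) x)
  simpa [dX] using this

lemma integral_dY_eq_zero {f : ℂ → ℝ} (hf : ContDiff ℝ 1 f) (hc : HasCompactSupport f) :
    ∫ z, dY f z = 0 := by
  have hi := (((hf.dY (n := 1) (m := 0) (by norm_num)).continuous).integrable_of_hasCompactSupport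
    hc.dY (μ := volume))
  have := integral_mul_fderiv_eq_neg_fderiv_mul_of_integrable (μ := (volume : Measure ℂ))
    (f := fun _ : ℂ => (1 : ℝ)) (g := f) (v := Complex.I) (by simp) (by simpa using! hi)
    (by simpa using hf.continuous.integrable_of_hasCompactSupport hc) (by simp)
    (fun x _ => hf.differentiable (by norm_num) x)
  simpa [dY] using this

/-- Green's second identity for a compactly supported function. -/
lemma integral_mul_lap {f g : ℂ → ℝ} (hf : ContDiff ℝ 2 f) (hg : ContDiff ℝ 2 g)
    (hc : HasCompactSupport g) : ∫ z, f z * lap g z = ∫ z, lap f z * g z := by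
  have hf1 := hf.differentiable (by norm_num)
  have hg1 := hg.differentiable (by norm_num)
  have fx := hf.dX (n := 2) (m := 1) (by norm_num)
  have gx := hg.dX (n := 2) (m := 1) (by norm_num)
  have fy := hf.dY (n := 2) (m := 1) (by norm_num)
  have gy := hg.dY (n := 2) (m := 1) (by norm_num)
  have f1 : ContDiff ℝ 1 f := hf.of_le (by norm_num)
  have g1 : ContDiff ℝ 1 g := hg.of_le (by norm_num)
  have cU : ContDiff ℝ 1 (fun z => f z * dX g z - dX f z * g z) :=
    (f1.mul gx).sub (fx.mul g1)
  have cV : ContDiff ℝ 1 (fun z => f z * dY g z - dY f z * g z) :=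
    (f1.mul gy).sub (fy.mul g1)
  have sU : HasCompactSupport (fun z => f z * dX g z - dX f z * g z) :=
    hc.dX.mul_left.sub hc.mul_left
  have sV : HasCompactSupport (fun z => f z * dY g z - dY f z * g z) :=
    hc.dY.mul_left.sub hc.mul_left
  have i1 : Integrable (fun z => f z * lap g z) :=
    (hf.continuous.mul hg.continuous_lap).integrable_of_hasCompactSupport hc.lap.mul_left
  have i2 : Integrable (fun z => lap f z * g z) :=
    (hf.continuous_lap.mul hg.continuous).integrable_of_hasCompactSupport hc.mul_left
  have iU : Integrable (dX (fun z => f z * dX g z - dX f z * g z)) :=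
    ((cU.dX (n := 1) (m := 0) (by norm_num)).continuous).integrable_of_hasCompactSupport sU.dX
  have iV : Integrable (dY (fun z => f z * dY g z - dY f z * g z)) :=
    ((cV.dY (n := 1) (m := 0) (by norm_num)).continuous).integrable_of_hasCompactSupport sV.dY
  have key : ∀ z, f z * lap g z - lap f z * g z =
      dX (fun z => f z * dX g z - dX f z * g z) z + dY (fun z => f z * dY g z - dY f z * g z) z := by
    intro z
    have a1 := (gx.differentiable (by norm_num)) z
    have a2 := (fx.differentiable (by norm_num)) z
    have a3 := (gy.differentiable (by norm_num)) z
    have a4 := (fy.differentiable (by norm_num)) z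
    rw [dX_sub ((hf1 z).fun_mul a1) (a2.fun_mul (hg1 z)), dX_mul (hf1 z) a1, dX_mul a2 (hg1 z),
      dY_sub ((hf1 z).fun_mul a3) (a4.fun_mul (hg1 z)), dY_mul (hf1 z) a3, dY_mul a4 (hg1 z)]
    simp only [lap]; ring
  rw [← sub_eq_zero, ← integral_sub i1 i2]
  simp_rw [key]
  rw [integral_add iU iV, integral_dX_eq_zero cU sU, integral_dY_eq_zero cV sV, add_zero]

/-! ### Radial kernels -/

lemma hasDerivAt_max_zero_pow (n : ℕ) (x : ℝ) :
    HasDerivAt (fun x : ℝ => max x 0 ^ (n + 2)) ((n + 2) * max x 0 ^ (n + 1)) x := by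
  rcases lt_trichotomy x 0 with h | h | h
  · have e : (fun x : ℝ => max x 0 ^ (n + 2)) =ᶠ[nhds x] fun _ => (0 : ℝ) := by
      filter_upwards [Iio_mem_nhds h] with y hy
      rw [max_eq_right (le_of_lt hy)]; simp
    rw [max_eq_right h.le]
    simpa using (hasDerivAt_const x (0 : ℝ)).congr_of_eventuallyEq e
  · subst h
    have : HasDerivAt (fun x : ℝ => max x 0 ^ (n + 2)) 0 0 := by
      rw [hasDerivAt_iff_isLittleO]
      simp only [sub_zero, max_self, smul_zero]
      have h2 : (fun x : ℝ => max x 0 ^ (n + 2)) =O[nhds 0] fun x : ℝ => x ^ (n + 2) := by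
        refine Asymptotics.isBigO_of_le _ fun x => ?_
        simp only [norm_pow]
        gcongr
        rcases le_total x 0 with h | h <;> simp [h]
      have h3 : (fun x : ℝ => x ^ (n + 2)) =o[nhds 0] fun x : ℝ => x := by
        have := Asymptotics.isLittleO_pow_pow (𝕜 := ℝ) (show 1 < n + 2 by omega)
        simpa using this
      simpa using h2.trans_isLittleO h3
    simpa using this
  · have e : (fun x : ℝ => max x 0 ^ (n + 2)) =ᶠ[nhds x] fun x => x ^ (n + 2) := by
      filter_upwards [Ioi_mem_nhds h] with y hy
      rw [max_eq_left (le_of_lt hy)]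
    rw [max_eq_left h.le]
    have := (hasDerivAt_pow (n + 2) x).congr_of_eventuallyEq e
    simpa using this

/-- Truncated linear cutoff in the squared radius. -/
noncomputable def radCut (R s : ℝ) : ℝ := max (1 - s / R ^ 2) 0

/-- The density whose negative derivative is `radBump`. -/
noncomputable def radTail (R s : ℝ) : ℝ := radCut R s ^ 4

/-- A nonnegative bump supported in `s ≤ R²`. -/
noncomputable def radBump (R s : ℝ) : ℝ := 4 / R ^ 2 * radCut R s ^ 3

/-- A truncated, regularised logarithmic kernel. -/
noncomputable def logKer (R δ s : ℝ) : ℝ := ∫ t in s..R ^ 2, radTail R t / (t + δ ^ 2)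

/-- Positive part of the Laplacian of `logKer`. -/
noncomputable def posKer (R δ s : ℝ) : ℝ := s / (s + δ ^ 2) * radBump R s

/-- Negative part of the Laplacian of `logKer`: an approximate identity. -/
noncomputable def negKer (R δ s : ℝ) : ℝ := δ ^ 2 / (s + δ ^ 2) ^ 2 * radTail R s

lemma radCut_nonneg (R s : ℝ) : 0 ≤ radCut R s := le_max_right _ _

lemma radCut_le_one (R : ℝ) {s : ℝ} (hs : 0 ≤ s) : radCut R s ≤ 1 := by
  have : 0 ≤ s / R ^ 2 := by positivity
  simp [radCut, this]

lemma radTail_nonneg (R s : ℝ) : 0 ≤ radTail R s := pow_nonneg (radCut_nonneg R s) _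

lemma radBump_nonneg (R s : ℝ) : 0 ≤ radBump R s :=
  mul_nonneg (by positivity) (pow_nonneg (radCut_nonneg R s) _)

lemma radTail_le_one (R : ℝ) {s : ℝ} (hs : 0 ≤ s) : radTail R s ≤ 1 :=
  pow_le_one₀ (radCut_nonneg R s) (radCut_le_one R hs)

lemma radBump_le (R : ℝ) {s : ℝ} (hs : 0 ≤ s) : radBump R s ≤ 4 / R ^ 2 :=
  mul_le_of_le_one_right (by positivity) (pow_le_one₀ (radCut_nonneg R s) (radCut_le_one R hs))

lemma radCut_eq_zero {R s : ℝ} (hR : 0 < R) (hs : R ^ 2 ≤ s) : radCut R s = 0 := by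
  have : 1 ≤ s / R ^ 2 := by rw [one_le_div (by positivity)]; exact hs
  simp [radCut, this]

lemma radTail_eq_zero {R s : ℝ} (hR : 0 < R) (hs : R ^ 2 ≤ s) : radTail R s = 0 := by
  simp [radTail, radCut_eq_zero hR hs]

lemma radBump_eq_zero {R s : ℝ} (hR : 0 < R) (hs : R ^ 2 ≤ s) : radBump R s = 0 := by
  simp [radBump, radCut_eq_zero hR hs]

lemma radCut_pos {R s : ℝ} (hR : 0 < R) (hs : s < R ^ 2) : 0 < radCut R s := by
  have : s / R ^ 2 < 1 := by rw [div_lt_one (by positivity)]; exact hs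
  simp [radCut, this]

lemma radBump_pos {R s : ℝ} (hR : 0 < R) (hs : s < R ^ 2) : 0 < radBump R s :=
  mul_pos (by positivity) (pow_pos (radCut_pos hR hs) _)

lemma radCut_anti (R : ℝ) {s t : ℝ} (h : s ≤ t) : radCut R t ≤ radCut R s := by
  unfold radCut; gcongr

lemma radBump_anti (R : ℝ) {s t : ℝ} (h : s ≤ t) : radBump R t ≤ radBump R s := by
  unfold radBump
  have := radCut_nonneg R t
  have := radCut_anti R h
  gcongr

lemma continuous_radCut (R : ℝ) : Continuous (radCut R) := by
  unfold radCut; fun_prop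

lemma continuous_radTail (R : ℝ) : Continuous (radTail R) := (continuous_radCut R).pow 4

lemma continuous_radBump (R : ℝ) : Continuous (radBump R) :=
  continuous_const.mul ((continuous_radCut R).pow 3)

lemma hasDerivAt_radCut_pow (R : ℝ) (n : ℕ) (s : ℝ) :
    HasDerivAt (fun s => radCut R s ^ (n + 2))
      (-((n + 2) / R ^ 2 * radCut R s ^ (n + 1))) s := by
  have h1 : HasDerivAt (fun s : ℝ => 1 - s / R ^ 2) (-(1 / R ^ 2)) s :=
    ((hasDerivAt_id s).div_const _).const_sub 1
  have h2 := (hasDerivAt_max_zero_pow n (1 - s / R ^ 2)).comp s h1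
  refine h2.congr_deriv ?_
  simp only [radCut]; ring

lemma hasDerivAt_radTail (R s : ℝ) : HasDerivAt (radTail R) (-(radBump R s)) s := by
  refine (hasDerivAt_radCut_pow R 2 s).congr_deriv ?_
  simp only [radBump]; norm_num

lemma hasDerivAt_logKer {R δ s : ℝ} (hR0 : 0 < R) (hs : -δ ^ 2 < s) :
    HasDerivAt (logKer R δ) (-(radTail R s / (s + δ ^ 2))) s := by
  have hR : -δ ^ 2 < R ^ 2 := by nlinarith [sq_nonneg δ, sq_pos_of_pos hR0]
  have hc : ContinuousOn (fun t => radTail R t / (t + δ ^ 2)) (Ioi (-δ ^ 2)) := by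
    refine (continuous_radTail R).continuousOn.div (by fun_prop) fun t ht => ?_
    have : -δ ^ 2 < t := ht
    linarith
  have hsub : uIcc s (R ^ 2) ⊆ Ioi (-δ ^ 2) := by
    intro t ht
    rw [mem_uIcc] at ht
    simp only [mem_Ioi]
    rcases ht with h | h <;> linarith [h.1, h.2]
  refine intervalIntegral.integral_hasDerivAt_left (hc.mono hsub).intervalIntegrable ?_ ?_
  · exact hc.stronglyMeasurableAtFilter isOpen_Ioi s hs
  · exact hc.continuousAt (Ioi_mem_nhds hs)

lemma hasDerivAt_logKer_deriv {R δ s : ℝ} (hs : -δ ^ 2 < s) :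
    HasDerivAt (fun s => -(radTail R s / (s + δ ^ 2)))
      (radBump R s / (s + δ ^ 2) + radTail R s / (s + δ ^ 2) ^ 2) s := by
  have h : s + δ ^ 2 ≠ 0 := by linarith
  refine ((hasDerivAt_radTail R s).div ((hasDerivAt_id s).add_const (δ ^ 2)) h).neg.congr_deriv ?_
  simp only [id]
  field_simp
  ring

lemma logKer_eq_zero {R δ s : ℝ} (hR : 0 < R) (hs : R ^ 2 ≤ s) : logKer R δ s = 0 := by
  unfold logKer
  rw [intervalIntegral.integral_symm, intervalIntegral.integral_congr (g := fun _ => (0 : ℝ))]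
  · simp
  · intro t ht
    rw [uIcc_of_le hs] at ht
    simp [radTail_eq_zero hR ht.1]

lemma logKer_nonneg {R δ s : ℝ} (hR : 0 < R) (hs : 0 ≤ s) : 0 ≤ logKer R δ s := by
  rcases le_total (R ^ 2) s with h | h
  · rw [logKer_eq_zero hR h]
  · refine intervalIntegral.integral_nonneg h fun t ht => ?_
    have := radTail_nonneg R t
    have : 0 ≤ t := hs.trans ht.1
    positivity

lemma posKer_nonneg (R δ : ℝ) {s : ℝ} (hs : 0 ≤ s) : 0 ≤ posKer R δ s :=
  mul_nonneg (by positivity) (radBump_nonneg R s)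

lemma negKer_nonneg (R δ : ℝ) (s : ℝ) : 0 ≤ negKer R δ s :=
  mul_nonneg (by positivity) (radTail_nonneg R s)

lemma posKer_le (R δ : ℝ) {s : ℝ} (hs : 0 ≤ s) : posKer R δ s ≤ radBump R s := by
  refine mul_le_of_le_one_left (radBump_nonneg R s) (div_le_one_of_le₀ ?_ (by positivity))
  nlinarith [sq_nonneg δ]

lemma posKer_eq_zero {R δ s : ℝ} (hR : 0 < R) (hs : R ^ 2 ≤ s) : posKer R δ s = 0 := by
  simp [posKer, radBump_eq_zero hR hs]

lemma negKer_eq_zero {R δ s : ℝ} (hR : 0 < R) (hs : R ^ 2 ≤ s) : negKer R δ s = 0 := by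
  simp [negKer, radTail_eq_zero hR hs]

lemma lap_logKer {R δ : ℝ} (hR : 0 < R) (hδ : 0 < δ) (c z : ℂ) :
    lap (fun z => logKer R δ (Complex.normSq (z - c))) z =
      4 * (posKer R δ (Complex.normSq (z - c)) - negKer R δ (Complex.normSq (z - c))) := by
  have hp : ∀ s : ℝ, 0 ≤ s → -δ ^ 2 < s := fun s hs => by nlinarith [sq_pos_of_pos hδ]
  rw [lap_radial (fun s hs => hasDerivAt_logKer hR (hp s hs))
    (fun s hs => hasDerivAt_logKer_deriv (hp s hs))]
  have := Complex.normSq_nonneg (z - c)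
  have : Complex.normSq (z - c) + δ ^ 2 ≠ 0 := by positivity
  simp only [posKer, negKer]
  field_simp
  ring

lemma dX_logKer {R δ : ℝ} (hR : 0 < R) (hδ : 0 < δ) (c z : ℂ) :
    dX (fun z => logKer R δ (Complex.normSq (z - c))) z =
      -(radTail R (Complex.normSq (z - c)) / (Complex.normSq (z - c) + δ ^ 2)) *
        (2 * (z - c).re) := by
  rw [dX_comp ((contDiff_normSq_sub c (n := 1)).differentiable (by norm_num) z)
    (hasDerivAt_logKer hR (by nlinarith [sq_pos_of_pos hδ, Complex.normSq_nonneg (z - c)])),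
    dX_normSq_sub]

lemma dY_logKer {R δ : ℝ} (hR : 0 < R) (hδ : 0 < δ) (c z : ℂ) :
    dY (fun z => logKer R δ (Complex.normSq (z - c))) z =
      -(radTail R (Complex.normSq (z - c)) / (Complex.normSq (z - c) + δ ^ 2)) *
        (2 * (z - c).im) := by
  rw [dY_comp ((contDiff_normSq_sub c (n := 1)).differentiable (by norm_num) z)
    (hasDerivAt_logKer hR (by nlinarith [sq_pos_of_pos hδ, Complex.normSq_nonneg (z - c)])),
    dY_normSq_sub]

lemma grad_logKer_sq_le {R δ : ℝ} (hR : 0 < R) (hδ : 0 < δ) (c z : ℂ) :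
    dX (fun z => logKer R δ (Complex.normSq (z - c))) z ^ 2 +
      dY (fun z => logKer R δ (Complex.normSq (z - c))) z ^ 2 ≤ 4 / Complex.normSq (z - c) := by
  rw [dX_logKer hR hδ, dY_logKer hR hδ]
  rcases eq_or_ne z c with h | h
  · subst h; simp
  have hs : 0 < Complex.normSq (z - c) := Complex.normSq_pos.2 (sub_ne_zero.2 h)
  have e : (z - c).re ^ 2 + (z - c).im ^ 2 = Complex.normSq (z - c) := by
    rw [Complex.normSq_apply]; ring
  set s := Complex.normSq (z - c)
  have h1 := radTail_le_one R hs.le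
  have h0 := radTail_nonneg R s
  have e2 : (-(radTail R s / (s + δ ^ 2)) * (2 * (z - c).re)) ^ 2 +
      (-(radTail R s / (s + δ ^ 2)) * (2 * (z - c).im)) ^ 2 =
      4 * s * (radTail R s / (s + δ ^ 2)) ^ 2 := by rw [← e]; ring
  rw [e2]
  have h3 : radTail R s / (s + δ ^ 2) ≤ 1 / s := by
    gcongr
    nlinarith [sq_nonneg δ]
  have h4 : 0 ≤ radTail R s / (s + δ ^ 2) := by positivity
  calc 4 * s * (radTail R s / (s + δ ^ 2)) ^ 2 ≤ 4 * s * (1 / s) ^ 2 := by gcongr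
    _ = 4 / s := by field_simp

lemma contDiff_logKer {R δ : ℝ} (hR : 0 < R) (hδ : 0 < δ) (c : ℂ) :
    ContDiff ℝ 2 (fun z => logKer R δ (Complex.normSq (z - c))) := by
  have hO : IsOpen (Ioi (-δ ^ 2)) := isOpen_Ioi
  have hd : ∀ s ∈ Ioi (-δ ^ 2), deriv (logKer R δ) s = -(radTail R s / (s + δ ^ 2)) :=
    fun s hs => (hasDerivAt_logKer hR hs).deriv
  have hd2 : ∀ s ∈ Ioi (-δ ^ 2), deriv (fun s => -(radTail R s / (s + δ ^ 2))) s =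
      radBump R s / (s + δ ^ 2) + radTail R s / (s + δ ^ 2) ^ 2 :=
    fun s hs => (hasDerivAt_logKer_deriv hs).deriv
  have hpos : ∀ s ∈ Ioi (-δ ^ 2), s + δ ^ 2 ≠ 0 := fun s hs => by
    have : -δ ^ 2 < s := hs
    linarith
  have h0 : ContinuousOn (fun s => radBump R s / (s + δ ^ 2) + radTail R s / (s + δ ^ 2) ^ 2)
      (Ioi (-δ ^ 2)) :=
    ((continuous_radBump R).continuousOn.div (by fun_prop) hpos).add
      ((continuous_radTail R).continuousOn.div (by fun_prop) fun s hs => pow_ne_zero _ (hpos s hs))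
  have h1 : ContDiffOn ℝ 1 (fun s => -(radTail R s / (s + δ ^ 2))) (Ioi (-δ ^ 2)) := by
    rw [show (1 : WithTop ℕ∞) = 0 + 1 by norm_num, contDiffOn_succ_iff_deriv_of_isOpen hO]
    refine ⟨fun s hs => (hasDerivAt_logKer_deriv hs).differentiableAt.differentiableWithinAt,
      by simp, ?_⟩
    exact contDiffOn_zero.2 (h0.congr hd2)
  have h2 : ContDiffOn ℝ 2 (logKer R δ) (Ioi (-δ ^ 2)) := by
    rw [show (2 : WithTop ℕ∞) = 1 + 1 by norm_num, contDiffOn_succ_iff_deriv_of_isOpen hO]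
    refine ⟨fun s hs => (hasDerivAt_logKer hR hs).differentiableAt.differentiableWithinAt,
      by simp, ?_⟩
    exact h1.congr hd
  refine contDiff_iff_contDiffAt.2 fun z => ?_
  have hz : -δ ^ 2 < Complex.normSq (z - c) := by
    nlinarith [sq_pos_of_pos hδ, Complex.normSq_nonneg (z - c)]
  exact ContDiffAt.comp z (h2.contDiffAt (Ioi_mem_nhds hz)) (contDiff_normSq_sub c).contDiffAt

lemma normSq_sub_lt_iff {R : ℝ} (hR : 0 < R) {c z : ℂ} :
    Complex.normSq (z - c) < R ^ 2 ↔ dist z c < R := by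
  rw [Complex.normSq_eq_norm_sq, dist_eq_norm, sq_lt_sq₀ (norm_nonneg _) hR.le]

lemma le_normSq_sub_iff {R : ℝ} (hR : 0 < R) {c z : ℂ} :
    R ^ 2 ≤ Complex.normSq (z - c) ↔ R ≤ dist z c := by
  rw [← not_lt, normSq_sub_lt_iff hR, not_lt]

lemma hasCompactSupport_radial {F : ℝ → ℝ} {R : ℝ} (hR : 0 < R) (hF : ∀ s, R ^ 2 ≤ s → F s = 0)
    (c : ℂ) : HasCompactSupport (fun z : ℂ => F (Complex.normSq (z - c))) := by
  refine HasCompactSupport.intro (isCompact_closedBall c R) fun z hz => hF _ ?_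
  rw [le_normSq_sub_iff hR]
  exact (not_le.1 hz).le

lemma hasCompactSupport_logKer {R δ : ℝ} (hR : 0 < R) (c : ℂ) :
    HasCompactSupport (fun z => logKer R δ (Complex.normSq (z - c))) :=
  hasCompactSupport_radial hR (fun _ hs => logKer_eq_zero hR hs) c

/-- The mass of the limit of `negKer`. -/
noncomputable def kerMass : ℝ := ∫ x : ℂ, 1 / (1 + Complex.normSq x) ^ 2

lemma integrable_kerMass : Integrable (fun x : ℂ => 1 / (1 + Complex.normSq x) ^ 2) := by
  have h := integrable_rpow_neg_one_add_norm_sq (E := ℂ) (μ := volume) (r := 4)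
    (by simp; norm_num)
  refine h.congr (Eventually.of_forall fun x => ?_)
  have : (0:ℝ) < 1 + ‖x‖ ^ 2 := by positivity
  simp only [Complex.normSq_eq_norm_sq]
  rw [show (-4 / 2 : ℝ) = ((-2 : ℤ) : ℝ) by norm_num, Real.rpow_intCast, zpow_neg]
  norm_num

lemma kerMass_pos : 0 < kerMass := by
  unfold kerMass
  rw [integral_pos_iff_support_of_nonneg (fun x => by positivity) integrable_kerMass]
  have : (Function.support fun x : ℂ => 1 / (1 + Complex.normSq x) ^ 2) = univ := by
    ext x
    have := Complex.normSq_nonneg x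
    simp only [Function.mem_support, mem_univ, iff_true]
    positivity
  rw [this]
  simp

lemma continuous_negKer {R δ : ℝ} (hδ : 0 < δ) :
    Continuous (fun y : ℂ => negKer R δ (Complex.normSq y)) := by
  unfold negKer
  refine (continuous_const.div (by fun_prop) fun y => ?_).mul
    ((continuous_radTail R).comp Complex.continuous_normSq)
  have := Complex.normSq_nonneg y
  positivity

lemma continuous_posKer {R δ : ℝ} (hδ : 0 < δ) :
    Continuous (fun y : ℂ => posKer R δ (Complex.normSq y)) := by
  unfold posKer
  refine (Complex.continuous_normSq.div (by fun_prop) fun y => ?_).mul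
    ((continuous_radBump R).comp Complex.continuous_normSq)
  have := Complex.normSq_nonneg y
  positivity

lemma tendsto_integral_negKer {R C : ℝ} {F : ℂ → ℝ}
    (hF : Measurable F) (hC : ∀ x, |F x| ≤ C) (h0 : ContinuousAt F 0) :
    Tendsto (fun δ => ∫ y, negKer R δ (Complex.normSq y) * F y) (nhdsWithin 0 (Ioi 0))
      (nhds (kerMass * F 0)) := by
  have e : ∀ δ ∈ Ioi (0:ℝ), ∫ x : ℂ, 1 / (1 + Complex.normSq x) ^ 2 *
      (radTail R (δ ^ 2 * Complex.normSq x) * F (δ • x)) =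
      ∫ y, negKer R δ (Complex.normSq y) * F y := by
    intro δ hδ
    have hδ : 0 < δ := hδ
    have := Measure.integral_comp_smul (volume : Measure ℂ)
      (fun y => negKer R δ (Complex.normSq y) * F y) δ
    have h2 : (∫ y, negKer R δ (Complex.normSq y) * F y) =
        δ ^ 2 * ∫ x : ℂ, negKer R δ (Complex.normSq (δ • x)) * F (δ • x) := by
      rw [this]
      simp only [Complex.finrank_real_complex, smul_eq_mul]
      rw [abs_of_pos (by positivity)]
      field_simp
    rw [h2, ← integral_const_mul]
    refine integral_congr_ae (Eventually.of_forall fun x => ?_)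
    have hn : Complex.normSq (δ • x) = δ ^ 2 * Complex.normSq x := by
      simp [Complex.normSq_apply]; ring
    have := Complex.normSq_nonneg x
    simp only [negKer, hn]
    field_simp
    ring
  refine Tendsto.congr' (eventually_mem_nhdsWithin.mono e) ?_
  rw [kerMass, ← integral_mul_const]
  refine tendsto_integral_filter_of_dominated_convergence
    (fun x => 1 / (1 + Complex.normSq x) ^ 2 * C) ?_ ?_ (integrable_kerMass.mul_const C) ?_
  · refine Eventually.of_forall fun δ => Measurable.aestronglyMeasurable ?_
    have h1 : Measurable fun x : ℂ => Complex.normSq x := Complex.continuous_normSq.measurable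
    have h2 : Measurable fun x : ℂ => F (δ • x) := hF.comp (measurable_const_smul δ)
    have h3 : Measurable fun x : ℂ => radTail R (δ ^ 2 * Complex.normSq x) :=
      (continuous_radTail R).measurable.comp (h1.const_mul _)
    fun_prop
  · refine Eventually.of_forall fun δ => Eventually.of_forall fun x => ?_
    have hx := Complex.normSq_nonneg x
    rw [norm_mul, norm_mul, Real.norm_of_nonneg (by positivity),
      Real.norm_of_nonneg (radTail_nonneg R _), Real.norm_eq_abs]
    have h1 := radTail_le_one R (s := δ ^ 2 * Complex.normSq x) (by positivity)
    have h2 := hC (δ • x)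
    have h3 := radTail_nonneg R (δ ^ 2 * Complex.normSq x)
    gcongr
    calc _ ≤ 1 * |F (δ • x)| := by gcongr
      _ ≤ C := by simpa using h2
  · refine Eventually.of_forall fun x => ?_
    refine Tendsto.const_mul _ ?_
    have t1 : Tendsto (fun δ : ℝ => radTail R (δ ^ 2 * Complex.normSq x))
        (nhdsWithin 0 (Ioi 0)) (nhds 1) := by
      have : Continuous fun δ : ℝ => radTail R (δ ^ 2 * Complex.normSq x) :=
        (continuous_radTail R).comp (by fun_prop)
      have h := (this.tendsto 0).mono_left (nhdsWithin_le_nhds (s := Ioi 0))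
      simpa [radTail, radCut] using h
    have t2 : Tendsto (fun δ : ℝ => F (δ • x)) (nhdsWithin 0 (Ioi 0)) (nhds (F 0)) := by
      have : Continuous fun δ : ℝ => δ • x := by fun_prop
      have h := (this.tendsto 0).mono_left (nhdsWithin_le_nhds (s := Ioi 0))
      simp only [zero_smul] at h
      exact h0.tendsto.comp h
    simpa using t1.mul t2

lemma integrable_radBump_mul {R C : ℝ} (hR : 0 < R) {F : ℂ → ℝ}
    (hF : Measurable F) (hC : ∀ x, |F x| ≤ C) :
    Integrable (fun y : ℂ => radBump R (Complex.normSq y) * F y) := by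
  have h : Integrable (fun y : ℂ => radBump R (Complex.normSq (y - 0))) :=
    (Continuous.integrable_of_hasCompactSupport
      ((continuous_radBump R).comp (by fun_prop))
      (hasCompactSupport_radial hR (fun s hs => radBump_eq_zero hR hs) 0))
  simp only [sub_zero] at h
  refine h.mul_bdd (c := C) hF.aestronglyMeasurable (Eventually.of_forall hC)

lemma tendsto_integral_posKer {R C : ℝ} (hR : 0 < R) {F : ℂ → ℝ}
    (hF : Measurable F) (hC : ∀ x, |F x| ≤ C) :
    Tendsto (fun δ => ∫ y, posKer R δ (Complex.normSq y) * F y) (nhdsWithin 0 (Ioi 0))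
      (nhds (∫ y, radBump R (Complex.normSq y) * F y)) := by
  refine tendsto_integral_filter_of_dominated_convergence
    (fun y => ‖radBump R (Complex.normSq y) * F y‖) ?_ ?_
    (integrable_radBump_mul hR hF hC).norm ?_
  · filter_upwards [self_mem_nhdsWithin] with δ hδ
    exact ((continuous_posKer hδ).measurable.mul hF).aestronglyMeasurable
  · refine Eventually.of_forall fun δ => Eventually.of_forall fun x => ?_
    rw [norm_mul, norm_mul]
    gcongr
    rw [Real.norm_of_nonneg (posKer_nonneg R δ (Complex.normSq_nonneg x)),
      Real.norm_of_nonneg (radBump_nonneg R _)]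
    exact posKer_le R δ (Complex.normSq_nonneg x)
  · have : ∀ᵐ x : ℂ, x ≠ 0 := by simp [ae_iff]
    filter_upwards [this] with x hx
    refine Tendsto.mul_const _ ?_
    unfold posKer
    have hs : Complex.normSq x ≠ 0 := (Complex.normSq_pos.2 hx).ne'
    have : ContinuousAt (fun δ : ℝ => Complex.normSq x / (Complex.normSq x + δ ^ 2) *
        radBump R (Complex.normSq x)) 0 := by
      refine (ContinuousAt.div (by fun_prop) (by fun_prop) (by simpa using hs)).mul (by fun_prop)
    have h := this.tendsto.mono_left (nhdsWithin_le_nhds (s := Ioi 0))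
    simpa [hs] using h

lemma integral_sub_right_mul_normSq (G : ℝ → ℝ) (F : ℂ → ℝ) (c : ℂ) :
    ∫ z, G (Complex.normSq (z - c)) * F z = ∫ y, G (Complex.normSq y) * F (c + y) := by
  rw [← integral_add_left_eq_self _ c]
  simp

/-- The bump and the approximate identity have the same mass. -/
lemma integral_radBump {R : ℝ} (hR : 0 < R) :
    ∫ y : ℂ, radBump R (Complex.normSq y) = kerMass := by
  have h1 := tendsto_integral_posKer hR (F := fun _ => (1:ℝ)) (C := 1) measurable_const (by simp)
  have h2 := tendsto_integral_negKer (R := R) (F := fun _ => (1:ℝ)) (C := 1) measurable_const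
    (by simp) continuousAt_const
  have e : ∀ δ ∈ Ioi (0:ℝ), ∫ y, posKer R δ (Complex.normSq y) * (1:ℝ) =
      ∫ y, negKer R δ (Complex.normSq y) * (1:ℝ) := by
    intro δ hδ
    have hδ : 0 < δ := hδ
    have h3 := integral_mul_lap (f := fun _ => (1:ℝ)) contDiff_const
      (contDiff_logKer hR hδ 0) (hasCompactSupport_logKer hR 0)
    simp only [lap_const, lap_logKer hR hδ, zero_mul, integral_zero, one_mul] at h3
    simp only [sub_zero] at h3
    rw [integral_const_mul] at h3
    have i1 : Integrable fun y : ℂ => posKer R δ (Complex.normSq y) :=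
      (continuous_posKer hδ).integrable_of_hasCompactSupport
        (by simpa using hasCompactSupport_radial hR (fun s hs => posKer_eq_zero (δ := δ) hR hs) 0)
    have i2 : Integrable fun y : ℂ => negKer R δ (Complex.normSq y) :=
      (continuous_negKer hδ).integrable_of_hasCompactSupport
        (by simpa using hasCompactSupport_radial hR (fun s hs => negKer_eq_zero (δ := δ) hR hs) 0)
    rw [integral_sub i1 i2] at h3
    simp only [mul_one]
    linarith
  have := tendsto_nhds_unique (h1.congr' (eventually_mem_nhdsWithin.mono e)) h2
  simpa using this

lemma logKer_le {R δ s : ℝ} (hR : 0 < R) (hs : 0 < s) : logKer R δ s ≤ 2 * R / √s := by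
  rcases le_total (R ^ 2) s with h | h
  · rw [logKer_eq_zero hR h]; positivity
  have hpos : ∀ t ∈ Icc s (R ^ 2), 0 < t := fun t ht => hs.trans_le ht.1
  have i1 : IntervalIntegrable (fun t => radTail R t / (t + δ ^ 2)) volume s (R ^ 2) := by
    refine ContinuousOn.intervalIntegrable ?_
    rw [uIcc_of_le h]
    refine (continuous_radTail R).continuousOn.div (by fun_prop) fun t ht => ?_
    have := hpos t ht
    positivity
  have hd : ∀ t ∈ uIcc s (R ^ 2), HasDerivAt (fun t => -(2 * R) * (√t)⁻¹) (R / (t * √t)) t := by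
    intro t ht
    rw [uIcc_of_le h] at ht
    have ht0 := hpos t ht
    have := ((Real.hasDerivAt_sqrt ht0.ne').inv (Real.sqrt_pos.2 ht0).ne').const_mul (-(2 * R))
    refine this.congr_deriv ?_
    have h2 : √t ^ 2 = t := Real.sq_sqrt ht0.le
    have h3 := (Real.sqrt_pos.2 ht0).ne'
    field_simp
    rw [h2]
  have i2 : IntervalIntegrable (fun t => R / (t * √t)) volume s (R ^ 2) := by
    refine ContinuousOn.intervalIntegrable ?_
    rw [uIcc_of_le h]
    refine continuousOn_const.div (by fun_prop) fun t ht => ?_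
    have := hpos t ht
    positivity
  calc logKer R δ s ≤ ∫ t in s..R ^ 2, R / (t * √t) := by
        refine intervalIntegral.integral_mono_on h i1 i2 fun t ht => ?_
        have ht0 := hpos t ht
        have h1 := radTail_le_one R ht0.le
        have h2 : √t ≤ R := Real.sqrt_le_iff.2 ⟨hR.le, ht.2⟩
        calc radTail R t / (t + δ ^ 2) ≤ 1 / t := by
              gcongr
              nlinarith [sq_nonneg δ]
          _ ≤ R / (t * √t) := by
              rw [div_le_div_iff₀ ht0 (by positivity)]
              nlinarith
    _ = -(2 * R) * (√(R ^ 2))⁻¹ - -(2 * R) * (√s)⁻¹ :=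
        intervalIntegral.integral_eq_sub_of_hasDerivAt hd i2
    _ ≤ 2 * R / √s := by
        have : 0 ≤ 2 * R * (√(R ^ 2))⁻¹ := by positivity
        rw [div_eq_mul_inv]
        linarith

lemma tendsto_logKer {R s : ℝ} (hR : 0 < R) (hs : 0 < s) :
    Tendsto (fun δ => logKer R δ s) (nhdsWithin 0 (Ioi 0)) (nhds (logKer R 0 s)) := by
  rcases le_total (R ^ 2) s with h | h
  · simp only [logKer_eq_zero hR h]
    exact tendsto_const_nhds
  · unfold logKer
    refine intervalIntegral.tendsto_integral_filter_of_dominated_convergence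
      (fun t => |radTail R t / t|) ?_ ?_ ?_ ?_
    · refine Eventually.of_forall fun δ => Measurable.aestronglyMeasurable ?_
      exact (continuous_radTail R).measurable.div (by fun_prop)
    · refine Eventually.of_forall fun δ => Eventually.of_forall fun t ht => ?_
      rw [uIoc_of_le h] at ht
      rw [Real.norm_eq_abs, abs_div, abs_div]
      have : 0 < t := hs.trans ht.1
      rw [abs_of_pos this, abs_of_pos (by positivity : 0 < t + δ ^ 2)]
      gcongr
      nlinarith [sq_nonneg δ]
    · refine ContinuousOn.intervalIntegrable (ContinuousOn.abs ?_)
      rw [uIcc_of_le h]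
      refine (continuous_radTail R).continuousOn.div (by fun_prop) fun t ht => ?_
      exact (hs.trans_le ht.1).ne'
    · refine Eventually.of_forall fun t ht => ?_
      rw [uIoc_of_le h] at ht
      have : 0 < t := hs.trans ht.1
      have : ContinuousAt (fun δ : ℝ => radTail R t / (t + δ ^ 2)) 0 :=
        ContinuousAt.div (by fun_prop) (by fun_prop) (by simpa using this.ne')
      exact this.tendsto.mono_left nhdsWithin_le_nhds

/-- An integrable majorant of all the logarithmic kernels. -/
noncomputable def kerMajorant (R : ℝ) (y : ℂ) : ℝ := (ball 0 R).indicator (fun y => 2 * R * ‖y‖⁻¹) y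

lemma integrable_kerMajorant (R : ℝ) : Integrable (kerMajorant R) := by
  have h : IntegrableOn (fun x : ℂ => ‖x‖⁻¹) (ball 0 R) := by
    rw [integrableOn_fun_norm_addHaar volume (f := fun t : ℝ => t⁻¹)]
    have : IntegrableOn (fun _ : ℝ => (1:ℝ)) (Ioo 0 R) := by simp
    refine this.congr_fun (fun t ht => ?_) measurableSet_Ioo
    simp [ht.1.ne']
  exact (integrable_indicator_iff measurableSet_ball).2 (h.const_mul _)

lemma abs_logKer_normSq_le {R : ℝ} (hR : 0 < R) (δ : ℝ) {y : ℂ} (hy : y ≠ 0) :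
    |logKer R δ (Complex.normSq y)| ≤ kerMajorant R y := by
  rw [abs_of_nonneg (logKer_nonneg hR (Complex.normSq_nonneg y)), kerMajorant]
  by_cases h : y ∈ ball (0:ℂ) R
  · rw [indicator_of_mem h]
    have := logKer_le (R := R) (δ := δ) hR (Complex.normSq_pos.2 hy)
    rwa [Complex.normSq_eq_norm_sq, Real.sqrt_sq (norm_nonneg y), div_eq_mul_inv,
      ← Complex.normSq_eq_norm_sq] at this
  · rw [indicator_of_notMem h, logKer_eq_zero hR]
    have := (le_normSq_sub_iff hR (c := 0) (z := y)).2 (not_lt.1 h)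
    simpa using this

lemma ae_ne_zero_complex : ∀ᵐ x : ℂ, x ≠ 0 := by simp [ae_iff]

lemma aestronglyMeasurable_logKer_zero {R : ℝ} (hR : 0 < R) :
    AEStronglyMeasurable (fun y : ℂ => logKer R 0 (Complex.normSq y)) volume := by
  have hu : Tendsto (fun n : ℕ => 1 / ((n:ℝ) + 1)) atTop (nhdsWithin 0 (Ioi 0)) :=
    tendsto_nhdsWithin_iff.2 ⟨tendsto_one_div_add_atTop_nhds_zero_nat,
      Eventually.of_forall fun n => by simp only [mem_Ioi]; positivity⟩
  refine aestronglyMeasurable_of_tendsto_ae atTop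
    (f := fun n : ℕ => fun y : ℂ => logKer R (1 / ((n:ℝ) + 1)) (Complex.normSq y)) (fun n => ?_) ?_
  · have := (contDiff_logKer hR (δ := 1 / ((n:ℝ) + 1)) (by positivity) 0).continuous
    simp only [sub_zero] at this
    exact this.aestronglyMeasurable
  · filter_upwards [ae_ne_zero_complex] with y hy
    exact (tendsto_logKer hR (Complex.normSq_pos.2 hy)).comp hu

lemma integrable_logKer_zero {R : ℝ} (hR : 0 < R) :
    Integrable (fun y : ℂ => logKer R 0 (Complex.normSq y)) := by
  refine (integrable_kerMajorant R).mono' (aestronglyMeasurable_logKer_zero hR) ?_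
  filter_upwards [ae_ne_zero_complex] with y hy using abs_logKer_normSq_le hR 0 hy

lemma tendsto_integral_logKer {R C : ℝ} (hR : 0 < R) {F : ℂ → ℝ}
    (hF : Measurable F) (hC : ∀ x, |F x| ≤ C) :
    Tendsto (fun δ => ∫ y, logKer R δ (Complex.normSq y) * F y) (nhdsWithin 0 (Ioi 0))
      (nhds (∫ y, logKer R 0 (Complex.normSq y) * F y)) := by
  refine tendsto_integral_filter_of_dominated_convergence
    (fun y => kerMajorant R y * C) ?_ ?_ ((integrable_kerMajorant R).mul_const C) ?_
  · filter_upwards [self_mem_nhdsWithin] with δ hδ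
    have := (contDiff_logKer hR hδ 0).continuous
    simp only [sub_zero] at this
    exact (this.measurable.mul hF).aestronglyMeasurable
  · refine Eventually.of_forall fun δ => ?_
    filter_upwards [ae_ne_zero_complex] with x hx
    rw [norm_mul, Real.norm_eq_abs, Real.norm_eq_abs]
    exact mul_le_mul (abs_logKer_normSq_le hR δ hx) (hC x) (abs_nonneg _)
      ((abs_nonneg _).trans (abs_logKer_normSq_le hR δ hx))
  · filter_upwards [ae_ne_zero_complex] with x hx
    exact (tendsto_logKer hR (Complex.normSq_pos.2 hx)).mul_const _

/-- The regularised potential identity. -/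
lemma integral_logKer_mul_lap {R δ : ℝ} (hR : 0 < R) (hδ : 0 < δ) {τ : ℂ → ℝ}
    (hτ : ContDiff ℝ 2 τ) (c : ℂ) :
    ∫ y, logKer R δ (Complex.normSq (y - c)) * lap τ y =
      4 * ((∫ y, posKer R δ (Complex.normSq (y - c)) * τ y) -
        ∫ y, negKer R δ (Complex.normSq (y - c)) * τ y) := by
  have h := integral_mul_lap hτ (contDiff_logKer hR hδ c) (hasCompactSupport_logKer hR c)
  simp only [mul_comm (lap τ _)] at h
  rw [← h]
  simp only [lap_logKer hR hδ]
  have i1 : Integrable fun y : ℂ => posKer R δ (Complex.normSq (y - c)) * τ y :=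
    (((continuous_posKer hδ).comp (continuous_id.sub continuous_const)).mul
      hτ.continuous).integrable_of_hasCompactSupport
      (hasCompactSupport_radial hR (fun s hs => posKer_eq_zero hR hs) c).mul_right
  have i2 : Integrable fun y : ℂ => negKer R δ (Complex.normSq (y - c)) * τ y :=
    (((continuous_negKer hδ).comp (continuous_id.sub continuous_const)).mul
      hτ.continuous).integrable_of_hasCompactSupport
      (hasCompactSupport_radial hR (fun s hs => negKer_eq_zero hR hs) c).mul_right
  rw [← integral_sub i1 i2, ← integral_const_mul]
  congr 1; ext y; ring

/-- The potential identity for the singular kernel. -/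
lemma integral_logKer_zero_mul_lap {R : ℝ} (hR : 0 < R) {τ : ℂ → ℝ}
    (hτ : ContDiff ℝ 2 τ) (hc : HasCompactSupport τ) (c : ℂ) :
    ∫ y, logKer R 0 (Complex.normSq y) * lap τ (c + y) =
      4 * ((∫ y, radBump R (Complex.normSq y) * τ (c + y)) - kerMass * τ c) := by
  obtain ⟨C1, hC1⟩ := hc.exists_bound_of_continuous hτ.continuous
  obtain ⟨C2, hC2⟩ := hc.lap.exists_bound_of_continuous hτ.continuous_lap
  have ht : Continuous fun y : ℂ => c + y := by fun_prop
  have l1 := tendsto_integral_logKer hR (F := fun y => lap τ (c + y))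
    (hτ.continuous_lap.comp ht).measurable (fun x => hC2 _)
  have l2 := tendsto_integral_posKer hR (F := fun y => τ (c + y))
    (hτ.continuous.comp ht).measurable (fun x => hC1 _)
  have l3 := tendsto_integral_negKer (R := R) (F := fun y => τ (c + y))
    (hτ.continuous.comp ht).measurable (fun x => hC1 _) (hτ.continuous.comp ht).continuousAt
  have e : ∀ δ ∈ Ioi (0:ℝ), ∫ y, logKer R δ (Complex.normSq y) * lap τ (c + y) =
      4 * ((∫ y, posKer R δ (Complex.normSq y) * τ (c + y)) -
        ∫ y, negKer R δ (Complex.normSq y) * τ (c + y)) := by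
    intro δ hδ
    have := integral_logKer_mul_lap hR hδ hτ c
    rwa [integral_sub_right_mul_normSq, integral_sub_right_mul_normSq (posKer R δ),
      integral_sub_right_mul_normSq (negKer R δ)] at this
  have := tendsto_nhds_unique (l1.congr' (eventually_mem_nhdsWithin.mono e))
    ((l2.sub l3).const_mul 4)
  simpa using this

/-! ### Nonnegative subharmonic weights -/

/-- A bounded upper semicontinuous function is the pointwise limit of continuous majorants. -/
lemma exists_continuous_majorants {g : ℝ → ℝ} {A B : ℝ} (hg : UpperSemicontinuous g)
    (hA : ∀ t, A ≤ g t) (hB : ∀ t, g t ≤ B) :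
    ∃ φ : ℕ → ℝ → ℝ, (∀ n, Continuous (φ n)) ∧ (∀ n t, g t ≤ φ n t) ∧ (∀ n t, φ n t ≤ B) ∧
      ∀ t, Tendsto (fun n => φ n t) atTop (nhds (g t)) := by
  have hbd : ∀ (n : ℕ) θ, BddAbove (range fun t => g t - n * |t - θ|) := by
    intro n θ
    refine ⟨B, ?_⟩
    rintro _ ⟨t, rfl⟩
    have : 0 ≤ (n:ℝ) * |t - θ| := by positivity
    simp only
    linarith [hB t]
  have hge : ∀ (n : ℕ) t, g t ≤ ⨆ s, (g s - n * |s - t|) := by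
    intro n t
    have := le_ciSup (hbd n t) t
    simpa using this
  have hle : ∀ (n : ℕ) t, ⨆ s, (g s - n * |s - t|) ≤ B := by
    intro n t
    refine ciSup_le fun s => ?_
    have : 0 ≤ (n:ℝ) * |s - t| := by positivity
    linarith [hB s]
  refine ⟨fun n θ => ⨆ t, (g t - n * |t - θ|), fun n => ?_, hge, hle, fun t => ?_⟩
  · refine (LipschitzWith.of_le_add_mul (n : NNReal) fun x y => ?_).continuous
    refine ciSup_le fun t => ?_
    have h1 := le_ciSup (hbd n y) t
    have h2 : |t - y| ≤ |t - x| + |x - y| := abs_sub_le _ _ _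
    rw [Real.dist_eq]
    have h3 : (n:ℝ) * |t - y| ≤ n * |t - x| + n * |x - y| := by
      rw [← mul_add]; gcongr
    simp only [NNReal.coe_natCast]
    linarith
  · rw [Metric.tendsto_atTop]
    intro ε hε
    have h1 := hg t (g t + ε / 2) (by linarith)
    obtain ⟨δ, hδ, h2⟩ := Metric.eventually_nhds_iff.1 h1
    obtain ⟨N, hN⟩ := exists_nat_ge ((B - A) / δ)
    refine ⟨N, fun n hn => ?_⟩
    have hnN : (N:ℝ) ≤ n := by exact_mod_cast hn
    rw [Real.dist_eq, abs_of_nonneg (by linarith [hge n t])]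
    have : ⨆ s, (g s - n * |s - t|) ≤ g t + ε / 2 := by
      refine ciSup_le fun s => ?_
      rcases lt_or_ge (dist s t) δ with h | h
      · have h3 := h2 h
        have : 0 ≤ (n:ℝ) * |s - t| := by positivity
        linarith
      · rw [Real.dist_eq] at h
        have h4 : B - A ≤ N * δ := (div_le_iff₀ hδ).1 hN
        have h5 : (N:ℝ) * δ ≤ n * |s - t| := by gcongr
        linarith [hB s, hA t]
    linarith

/-- A nonnegative real-valued subharmonic function on a domain, extended by zero. -/
structure SubharmonicWeight (D : Set ℂ) (r : ℂ → ℝ) : Prop where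
  isOpen : IsOpen D
  isConnected : IsConnected D
  usc : UpperSemicontinuousOn r D
  nonneg : ∀ z, 0 ≤ r z
  zero_of_notMem : ∀ z ∉ D, r z = 0
  submean : ∀ c s, 0 < s → closedBall c s ⊆ D →
    ENNReal.ofReal (2 * Real.pi) * ENNReal.ofReal (r c) ≤
      ∫⁻ θ in Ioo (-Real.pi) Real.pi, ENNReal.ofReal (r (c + s * Complex.exp (θ * Complex.I)))

namespace SubharmonicWeight

variable {D : Set ℂ} {r : ℂ → ℝ}

lemma measurable (h : SubharmonicWeight D r) : Measurable r := by
  refine measurable_of_Iio fun t => ?_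
  have h1 : IsOpen {z | z ∈ D ∧ r z < t} := by
    rw [isOpen_iff_mem_nhds]
    rintro z ⟨hz, hzt⟩
    have h2 := h.usc z hz t hzt
    rw [h.isOpen.nhdsWithin_eq hz] at h2
    filter_upwards [h2, h.isOpen.mem_nhds hz] with w hw hw2 using ⟨hw2, hw⟩
  by_cases ht : 0 < t
  · have : r ⁻¹' Iio t = {z | z ∈ D ∧ r z < t} ∪ Dᶜ := by
      ext z
      by_cases hz : z ∈ D
      · simp [hz]
      · simp [hz, h.zero_of_notMem z hz, ht]
    rw [this]
    exact h1.measurableSet.union h.isOpen.measurableSet.compl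
  · have : r ⁻¹' Iio t = {z | z ∈ D ∧ r z < t} := by
      ext z
      by_cases hz : z ∈ D
      · simp [hz]
      · simp [hz, h.zero_of_notMem z hz, not_lt.1 ht]
    rw [this]
    exact h1.measurableSet

lemma exists_bound (h : SubharmonicWeight D r) {L : Set ℂ} (hL : IsCompact L) (hLD : L ⊆ D) :
    ∃ B, 0 ≤ B ∧ ∀ z ∈ L, r z ≤ B := by
  rcases L.eq_empty_or_nonempty with rfl | hne
  · exact ⟨0, le_rfl, by simp⟩
  · obtain ⟨a, ha, hmax⟩ := (h.usc.mono hLD).exists_isMaxOn hne hL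
    exact ⟨r a, h.nonneg a, fun z hz => hmax hz⟩

lemma eventually_lt (h : SubharmonicWeight D r) {z : ℂ} (hz : z ∈ D) {t : ℝ} (ht : r z < t) :
    ∀ᶠ w in nhds z, r w < t := by
  have h2 := h.usc z hz t ht
  rwa [h.isOpen.nhdsWithin_eq hz] at h2

/-- Radial averages dominate the value at the centre. -/
lemma radial_submean (h : SubharmonicWeight D r) {q : ℝ → ℝ} {c : ℂ} {R : ℝ} (hR : 0 < R)
    (hD : closedBall c R ⊆ D) (hq : Continuous q) (hq0 : ∀ s, 0 ≤ s → 0 ≤ q s)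
    (hqR : ∀ s, R ^ 2 ≤ s → q s = 0) :
    r c * ∫ y, q (Complex.normSq y) ≤ ∫ y, q (Complex.normSq y) * r (c + y) := by
  have hqm := hq.measurable
  have hrm := h.measurable
  have hnm : Measurable (fun y : ℂ => Complex.normSq y) := Complex.continuous_normSq.measurable
  obtain ⟨B, hB0, hB⟩ := h.exists_bound (isCompact_closedBall c R) hD
  have qi : Integrable fun y : ℂ => q (Complex.normSq y) :=
    Continuous.integrable_of_hasCompactSupport (by fun_prop)
      (by simpa using hasCompactSupport_radial hR hqR 0)
  have e : ∀ y, q (Complex.normSq y) * r (c + y) =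
      q (Complex.normSq y) * (closedBall c R).indicator r (c + y) := by
    intro y
    by_cases hy : c + y ∈ closedBall c R
    · rw [indicator_of_mem hy]
    · rw [hqR, zero_mul, zero_mul]
      have := (le_normSq_sub_iff hR (c := c) (z := c + y)).2 (not_le.1 hy).le
      simpa using this
  have qri : Integrable fun y : ℂ => q (Complex.normSq y) * r (c + y) := by
    simp only [e]
    refine qi.mul_bdd (c := B) ?_ (Eventually.of_forall fun y => ?_)
    · exact ((hrm.indicator measurableSet_closedBall).comp
        (measurable_const_add c)).aestronglyMeasurable
    · rw [Real.norm_eq_abs]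
      by_cases hy : c + y ∈ closedBall c R
      · rw [indicator_of_mem hy, abs_of_nonneg (h.nonneg _)]; exact hB _ hy
      · rw [indicator_of_notMem hy]; simpa using hB0
  have q0 : ∀ y : ℂ, 0 ≤ q (Complex.normSq y) := fun y => hq0 _ (Complex.normSq_nonneg y)
  have L1 : ENNReal.ofReal (r c * ∫ y : ℂ, q (Complex.normSq y)) =
      ENNReal.ofReal (r c) * ∫⁻ y : ℂ, ENNReal.ofReal (q (Complex.normSq y)) := by
    rw [ENNReal.ofReal_mul (h.nonneg c), ofReal_integral_eq_lintegral_ofReal qi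
      (Eventually.of_forall q0)]
  have L2 : ENNReal.ofReal (∫ y : ℂ, q (Complex.normSq y) * r (c + y)) =
      ∫⁻ y : ℂ, ENNReal.ofReal (q (Complex.normSq y) * r (c + y)) :=
    ofReal_integral_eq_lintegral_ofReal qri
      (Eventually.of_forall fun y => mul_nonneg (q0 y) (h.nonneg _))
  have hn : 0 ≤ ∫ y : ℂ, q (Complex.normSq y) * r (c + y) :=
    integral_nonneg fun y => mul_nonneg (q0 y) (h.nonneg _)
  rw [← ENNReal.ofReal_le_ofReal_iff hn, L1, L2, ← Complex.lintegral_comp_polarCoord_symm,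
    ← Complex.lintegral_comp_polarCoord_symm, polarCoord_target]
  have nsq : ∀ p : ℝ × ℝ, Complex.normSq (Complex.polarCoord.symm p) = p.1 ^ 2 := by
    intro p
    rw [Complex.normSq_eq_norm_sq, Complex.norm_polarCoord_symm, sq_abs]
  have pc : ∀ p : ℝ × ℝ, Complex.polarCoord.symm p = p.1 * Complex.exp (p.2 * Complex.I) := by
    intro p
    rw [Complex.polarCoord_symm_apply, Complex.exp_mul_I]
    push_cast
    ring
  simp only [nsq, smul_eq_mul]
  have hpm : Measurable fun p : ℝ × ℝ => Complex.polarCoord.symm p := by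
    have : (fun p : ℝ × ℝ => Complex.polarCoord.symm p) =
      fun p => p.1 * Complex.exp (p.2 * Complex.I) := funext pc
    rw [this]
    fun_prop
  rw [Measure.volume_eq_prod, ← Measure.prod_restrict]
  have m1 : Measurable fun p : ℝ × ℝ => ENNReal.ofReal p.1 * ENNReal.ofReal (q (p.1 ^ 2)) := by
    fun_prop
  have m2 : Measurable fun p : ℝ × ℝ => ENNReal.ofReal p.1 *
      ENNReal.ofReal (q (p.1 ^ 2) * r (c + Complex.polarCoord.symm p)) := by
    have : Measurable fun p : ℝ × ℝ => r (c + Complex.polarCoord.symm p) :=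
      hrm.comp (hpm.const_add c)
    fun_prop
  rw [lintegral_prod _ m1.aemeasurable, lintegral_prod _ m2.aemeasurable,
    ← lintegral_const_mul _ m1.lintegral_prod_right']
  refine lintegral_mono_ae ?_
  refine (ae_restrict_iff' measurableSet_Ioi).2 (Eventually.of_forall fun s hs => ?_)
  have hs : 0 < s := hs
  simp only [pc]
  rcases le_total R s with hRs | hsR
  · rw [hqR (s ^ 2) (by gcongr)]; simp
  · have key := h.submean c s hs ((closedBall_subset_closedBall hsR).trans hD)
    have m3 : Measurable fun θ : ℝ => ENNReal.ofReal (r (c + s * Complex.exp (θ * Complex.I))) := by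
      fun_prop
    simp only [ENNReal.ofReal_mul (hq0 (s ^ 2) (by positivity)), ← mul_assoc]
    rw [lintegral_const_mul _ m3, lintegral_const]
    simp only [Measure.restrict_apply MeasurableSet.univ, univ_inter, Real.volume_Ioo]
    calc _ = ENNReal.ofReal s * ENNReal.ofReal (q (s ^ 2)) *
          (ENNReal.ofReal (2 * Real.pi) * ENNReal.ofReal (r c)) := by
          rw [show Real.pi - -Real.pi = 2 * Real.pi by ring]; ring
      _ ≤ _ := by gcongr

end SubharmonicWeight

/-- Subtracting a lower bound from a subharmonic function gives a subharmonic weight. -/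
lemma SubharmonicOn.subharmonicWeight {D : Set ℂ} {ρ : ℂ → EReal} (hρ : SubharmonicOn ρ D)
    (hD : IsConnected D) {M : ℝ} (hM : ∀ z ∈ D, (M : EReal) ≤ ρ z) :
    SubharmonicWeight D (D.indicator fun z => (ρ z).toReal - M) := by
  obtain ⟨hO, husc, htop, -, hsub⟩ := hρ
  set r : ℂ → ℝ := D.indicator fun z => (ρ z).toReal - M with hr
  have hbot : ∀ z ∈ D, ρ z ≠ ⊥ := fun z hz h => by
    have := hM z hz
    rw [h] at this
    simp at this
  have hcoe : ∀ z ∈ D, ((r z + M : ℝ) : EReal) = ρ z := by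
    intro z hz
    rw [hr, indicator_of_mem hz, sub_add_cancel, EReal.coe_toReal (htop z hz) (hbot z hz)]
  have hnn : ∀ z, 0 ≤ r z := by
    intro z
    by_cases hz : z ∈ D
    · have := hM z hz
      rw [← hcoe z hz, EReal.coe_le_coe_iff] at this
      linarith
    · rw [hr, indicator_of_notMem hz]
  have husc' : UpperSemicontinuousOn r D := by
    intro z hz t ht
    have h1 : ρ z < ((t + M : ℝ) : EReal) := by
      rw [← hcoe z hz, EReal.coe_lt_coe_iff]; linarith
    filter_upwards [husc z hz _ h1, self_mem_nhdsWithin] with w hw hwD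
    rw [← hcoe w hwD, EReal.coe_lt_coe_iff] at hw
    linarith
  refine ⟨hO, hD, husc', hnn, fun z hz => indicator_of_notMem hz _, fun c s hs hcs => ?_⟩
  set g : ℝ → ℝ := fun θ => r (c + s * Complex.exp (θ * Complex.I)) with hg
  have hmem : ∀ θ : ℝ, c + s * Complex.exp (θ * Complex.I) ∈ closedBall c s := by
    intro θ
    simp [mem_closedBall, dist_eq_norm, Complex.norm_exp_ofReal_mul_I, abs_of_pos hs]
  have hgusc : UpperSemicontinuous g := by
    intro θ t ht
    have h1 := husc' _ (hcs (hmem θ)) t ht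
    rw [hO.nhdsWithin_eq (hcs (hmem θ))] at h1
    have hc : Continuous fun θ : ℝ => c + s * Complex.exp (θ * Complex.I) := by fun_prop
    exact (hc.tendsto θ).eventually h1
  obtain ⟨B, hB⟩ : ∃ B, ∀ θ, g θ ≤ B := by
    obtain ⟨a, ha, hmax⟩ := (husc'.mono hcs).exists_isMaxOn ⟨c, mem_closedBall_self hs.le⟩
      (isCompact_closedBall c s)
    exact ⟨r a, fun θ => hmax (hmem θ)⟩
  have hg0 : ∀ θ, 0 ≤ g θ := fun θ => hnn _
  obtain ⟨φ, hφc, hφg, hφB, hφl⟩ := exists_continuous_majorants hgusc hg0 hB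
  have hgm : Measurable g := hgusc.measurable
  have hle : ∀ n, 2 * Real.pi * r c ≤ ∫ θ in (0:ℝ)..(2 * Real.pi), φ n θ := by
    intro n
    have h1 := hsub c s hs hcs (fun θ => φ n θ + M) ((hφc n).add continuous_const) (fun θ => by
      rw [← hcoe _ (hcs (hmem θ)), EReal.coe_le_coe_iff]
      have := hφg n θ
      simp only [hg] at this
      linarith)
    rw [← hcoe c (hcs (mem_closedBall_self hs.le)), EReal.coe_le_coe_iff,
      intervalIntegral.integral_add ((hφc n).intervalIntegrable _ _) (by simp)] at h1
    simp only [intervalIntegral.integral_const, sub_zero, smul_eq_mul] at h1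
    have hpi := Real.pi_pos
    have e : (2 * Real.pi)⁻¹ * ((∫ θ in (0:ℝ)..(2 * Real.pi), φ n θ) + 2 * Real.pi * M) =
      (2 * Real.pi)⁻¹ * (∫ θ in (0:ℝ)..(2 * Real.pi), φ n θ) + M := by
      field_simp
    rw [e] at h1
    have h2 : r c ≤ (2 * Real.pi)⁻¹ * (∫ θ in (0:ℝ)..(2 * Real.pi), φ n θ) := by linarith
    calc _ ≤ 2 * Real.pi * ((2 * Real.pi)⁻¹ * (∫ θ in (0:ℝ)..(2 * Real.pi), φ n θ)) := by gcongr
      _ = _ := by field_simp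
  have hlim : Tendsto (fun n => ∫ θ in (0:ℝ)..(2 * Real.pi), φ n θ) atTop
      (nhds (∫ θ in (0:ℝ)..(2 * Real.pi), g θ)) := by
    refine intervalIntegral.tendsto_integral_filter_of_dominated_convergence (fun _ => B)
      (Eventually.of_forall fun n => (hφc n).aestronglyMeasurable) ?_ (by simp)
      (Eventually.of_forall fun θ _ => hφl θ)
    refine Eventually.of_forall fun n => Eventually.of_forall fun θ _ => ?_
    rw [Real.norm_eq_abs, abs_of_nonneg ((hg0 θ).trans (hφg n θ))]
    exact hφB n θ
  have hle2 : 2 * Real.pi * r c ≤ ∫ θ in (0:ℝ)..(2 * Real.pi), g θ :=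
    ge_of_tendsto hlim (Eventually.of_forall hle)
  have hper : Function.Periodic g (2 * Real.pi) := by
    intro θ
    simp only [hg]
    congr 3
    push_cast
    rw [add_mul, Complex.exp_add, Complex.exp_two_pi_mul_I, mul_one]
  have hshift : ∫ θ in (0:ℝ)..(2 * Real.pi), g θ = ∫ θ in (-Real.pi)..Real.pi, g θ := by
    have := hper.intervalIntegral_add_eq 0 (-Real.pi)
    rw [zero_add, show -Real.pi + 2 * Real.pi = Real.pi by ring] at this
    exact this
  have hgi : IntegrableOn g (Ioo (-Real.pi) Real.pi) := by
    refine Measure.integrableOn_of_bounded (M := B) (by simp) hgm.aestronglyMeasurable ?_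
    refine Eventually.of_forall fun θ => ?_
    rw [Real.norm_eq_abs, abs_of_nonneg (hg0 θ)]
    exact hB θ
  rw [hshift, intervalIntegral.integral_of_le (by linarith [Real.pi_pos]),
    integral_Ioc_eq_integral_Ioo] at hle2
  rw [← ENNReal.ofReal_mul (by positivity), ← ofReal_integral_eq_lintegral_ofReal hgi
    (Eventually.of_forall hg0)]
  exact ENNReal.ofReal_le_ofReal hle2

/-! ### Smooth subharmonic approximants -/

lemma logKer_pos {R δ s : ℝ} (hR : 0 < R) (hs : 0 < s) (hsR : s < R ^ 2) : 0 < logKer R δ s := by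
  unfold logKer
  refine intervalIntegral.intervalIntegral_pos_of_pos_on ?_ (fun t ht => ?_) hsR
  · refine ContinuousOn.intervalIntegrable ?_
    rw [uIcc_of_le hsR.le]
    refine (continuous_radTail R).continuousOn.div (by fun_prop) fun t ht => ?_
    have : 0 < t := hs.trans_le ht.1
    positivity
  · have h1 : 0 < t := hs.trans ht.1
    have h2 : 0 < radTail R t := pow_pos (radCut_pos hR ht.2) 4
    positivity

lemma integral_logKer_zero_pos {R : ℝ} (hR : 0 < R) :
    0 < ∫ y : ℂ, logKer R 0 (Complex.normSq y) := by
  rw [integral_pos_iff_support_of_nonneg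
    (fun y => logKer_nonneg hR (Complex.normSq_nonneg y)) (integrable_logKer_zero hR)]
  have hsub : ball (0:ℂ) R \ {0} ⊆
      Function.support fun y : ℂ => logKer R 0 (Complex.normSq y) := by
    rintro y ⟨hy, hy0⟩
    have h1 := (normSq_sub_lt_iff hR (c := 0) (z := y)).2 hy
    rw [sub_zero] at h1
    exact (logKer_pos hR (Complex.normSq_pos.2 hy0) h1).ne'
  refine lt_of_lt_of_le ?_ (measure_mono hsub)
  rw [measure_sdiff_null (by simp)]
  exact measure_ball_pos _ _ hR

/-- A continuous Laplacian is nonnegative where small radial averages dominate the value. -/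
lemma lap_nonneg_of_submean {a : ℂ → ℝ} (ha : ContDiff ℝ 2 a) (hc : HasCompactSupport a) {z : ℂ}
    {η : ℝ} (hη : 0 < η) (hs : ∀ R, 0 < R → R < η →
      kerMass * a z ≤ ∫ y, radBump R (Complex.normSq y) * a (z + y)) : 0 ≤ lap a z := by
  by_contra hneg
  push Not at hneg
  have h1 : ∀ᶠ w in nhds z, lap a w < lap a z / 2 :=
    ha.continuous_lap.continuousAt.eventually_lt continuousAt_const (by linarith)
  obtain ⟨d, hd, h2⟩ := Metric.eventually_nhds_iff.1 h1
  set R := min (d / 2) (η / 2)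
  have hR : 0 < R := by positivity
  have hRη : R < η := lt_of_le_of_lt (min_le_right _ _) (by linarith)
  have hRd : R < d := lt_of_le_of_lt (min_le_left _ _) (by linarith)
  have key := integral_logKer_zero_mul_lap hR ha hc z
  have h3 : ∫ y, logKer R 0 (Complex.normSq y) * lap a (z + y) ≤
      ∫ y, logKer R 0 (Complex.normSq y) * (lap a z / 2) := by
    refine integral_mono ?_ ((integrable_logKer_zero hR).mul_const _) fun y => ?_
    · obtain ⟨C, hC⟩ := hc.lap.exists_bound_of_continuous ha.continuous_lap
      refine (integrable_logKer_zero hR).mul_bdd (c := C) ?_ (Eventually.of_forall fun y => hC _)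
      exact (ha.continuous_lap.comp (continuous_const_add z)).aestronglyMeasurable
    · by_cases hy : dist (z + y) z < d
      · exact mul_le_mul_of_nonneg_left (h2 hy).le (logKer_nonneg hR (Complex.normSq_nonneg y))
      · have := (le_normSq_sub_iff hR (c := z) (z := z + y)).2 (hRd.le.trans (not_lt.1 hy))
        rw [add_sub_cancel_left] at this
        simp [logKer_eq_zero hR this]
  rw [integral_mul_const, key] at h3
  have h4 := hs R hR hRη
  have h5 := integral_logKer_zero_pos hR
  nlinarith

/-- `a` is a smooth approximant from above of the weight `r` on `L`, at scale `ε`. -/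
structure IsApprox (D : Set ℂ) (r : ℂ → ℝ) (L : Set ℂ) (ε : ℝ) (a : ℂ → ℝ) : Prop where
  contDiff : ContDiff ℝ 4 a
  compact : HasCompactSupport a
  lap_nonneg : ∀ z ∈ L, 0 ≤ lap a z
  le : ∀ z ∈ L, r z ≤ a z
  le_of_forall : ∀ z ∈ L, ∀ t, (∀ y ∈ closedBall z ε, r y ≤ t) → a z ≤ t

/-- The profile of the mollifier at scale `ε`. -/
noncomputable def mollProfile (ε s : ℝ) : ℝ := expNegInvGlue (1 - s / ε ^ 2)

lemma mollProfile_nonneg (ε s : ℝ) : 0 ≤ mollProfile ε s := expNegInvGlue.nonneg _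

lemma mollProfile_eq_zero {ε s : ℝ} (hε : 0 < ε) (hs : ε ^ 2 ≤ s) : mollProfile ε s = 0 := by
  have : 1 ≤ s / ε ^ 2 := by rw [one_le_div (by positivity)]; exact hs
  exact expNegInvGlue.zero_of_nonpos (by linarith)

lemma contDiff_mollProfile (ε : ℝ) {n : ℕ∞} : ContDiff ℝ n (mollProfile ε) :=
  expNegInvGlue.contDiff.comp (by fun_prop)

lemma contDiff_mollProfile_normSq (ε : ℝ) {n : ℕ∞} :
    ContDiff ℝ n (fun y : ℂ => mollProfile ε (Complex.normSq y)) := by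
  have := (contDiff_mollProfile ε (n := n)).comp (contDiff_normSq_sub 0)
  simpa [Function.comp_def] using this

lemma hasCompactSupport_mollProfile {ε : ℝ} (hε : 0 < ε) :
    HasCompactSupport (fun y : ℂ => mollProfile ε (Complex.normSq y)) := by
  simpa using hasCompactSupport_radial hε (fun s hs => mollProfile_eq_zero hε hs) 0

lemma integrable_mollProfile {ε : ℝ} (hε : 0 < ε) :
    Integrable (fun y : ℂ => mollProfile ε (Complex.normSq y)) :=
  (contDiff_mollProfile_normSq ε (n := 0)).continuous.integrable_of_hasCompactSupport
    (hasCompactSupport_mollProfile hε)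

lemma integral_mollProfile_pos {ε : ℝ} (hε : 0 < ε) :
    0 < ∫ y : ℂ, mollProfile ε (Complex.normSq y) := by
  refine Continuous.integral_pos_of_hasCompactSupport_nonneg_nonzero (x := (0:ℂ))
    (contDiff_mollProfile_normSq ε (n := 0)).continuous (hasCompactSupport_mollProfile hε)
    (fun y => mollProfile_nonneg _ _) ?_
  simp only [mollProfile, map_zero, zero_div, sub_zero]
  exact (expNegInvGlue.pos_of_pos one_pos).ne'

open scoped Convolution in
/-- The mollification of `F` at scale `ε`. -/
noncomputable def mollify (ε : ℝ) (F : ℂ → ℝ) : ℂ → ℝ :=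
  (F ⋆[ContinuousLinearMap.lsmul ℝ ℝ, volume] fun y => mollProfile ε (Complex.normSq y) /
    ∫ y : ℂ, mollProfile ε (Complex.normSq y))

lemma mollify_apply (ε : ℝ) (F : ℂ → ℝ) (z : ℂ) :
    mollify ε F z = (∫ y : ℂ, mollProfile ε (Complex.normSq y) * F (z + y)) /
      ∫ y : ℂ, mollProfile ε (Complex.normSq y) := by
  rw [mollify, convolution_def, ← integral_sub_right_mul_normSq, ← integral_div]
  congr 1; ext t
  have : Complex.normSq (z - t) = Complex.normSq (t - z) := by
    rw [← neg_sub, Complex.normSq_neg]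
  simp only [ContinuousLinearMap.lsmul_apply, smul_eq_mul, this]
  ring

lemma contDiff_mollify {ε : ℝ} (hε : 0 < ε) {F : ℂ → ℝ} (hF : Integrable F) {n : ℕ∞} :
    ContDiff ℝ n (mollify ε F) := by
  refine HasCompactSupport.contDiff_convolution_right _ ?_ hF.locallyIntegrable ?_
  · simp only [div_eq_mul_inv]
    exact (hasCompactSupport_mollProfile hε).mul_right
  · exact (contDiff_mollProfile_normSq ε).div_const _

lemma hasCompactSupport_mollify {ε : ℝ} (hε : 0 < ε) {F : ℂ → ℝ} (hF : HasCompactSupport F) :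
    HasCompactSupport (mollify ε F) := by
  refine HasCompactSupport.convolution _ hF ?_
  simp only [div_eq_mul_inv]
  exact (hasCompactSupport_mollProfile hε).mul_right

/-- Smooth approximants exist on every compact set at all small scales. -/
lemma SubharmonicWeight.exists_isApprox {D : Set ℂ} {r : ℂ → ℝ} (h : SubharmonicWeight D r)
    {L : Set ℂ} (hL : IsCompact L) (hLD : L ⊆ D) :
    ∃ ε₀ > 0, ∀ ε, 0 < ε → ε < ε₀ → ∃ a, IsApprox D r L ε a := by
  obtain ⟨η, hη, hηD⟩ := hL.exists_cthickening_subset_open h.isOpen hLD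
  set L' := cthickening η L with hL'
  have hL'c : IsCompact L' := hL.cthickening
  obtain ⟨B, hB0, hB⟩ := h.exists_bound hL'c hηD
  set F := L'.indicator r with hF
  have hFm : Measurable F := h.measurable.indicator hL'c.isClosed.measurableSet
  have hF0 : ∀ z, 0 ≤ F z := fun z => indicator_nonneg (fun z _ => h.nonneg z) z
  have hFB : ∀ z, ‖F z‖ ≤ B := by
    intro z
    rw [Real.norm_of_nonneg (hF0 z)]
    by_cases hz : z ∈ L'
    · rw [hF, indicator_of_mem hz]; exact hB z hz
    · rw [hF, indicator_of_notMem hz]; exact hB0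
  have hFs : HasCompactSupport F := HasCompactSupport.intro hL'c fun z hz => indicator_of_notMem hz _
  have hFi : Integrable F := by
    rw [hF, integrable_indicator_iff hL'c.isClosed.measurableSet]
    refine Measure.integrableOn_of_bounded (M := B) hL'c.measure_lt_top.ne
      h.measurable.aestronglyMeasurable ?_
    refine (ae_restrict_iff' hL'c.isClosed.measurableSet).2 (Eventually.of_forall fun z hz => ?_)
    rw [Real.norm_of_nonneg (h.nonneg z)]
    exact hB z hz
  have hmem : ∀ z ∈ L, ∀ y : ℂ, ‖y‖ ≤ η → z + y ∈ L' := by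
    intro z hz y hy
    refine mem_cthickening_of_dist_le _ z _ _ hz ?_
    simpa [dist_eq_norm] using hy
  refine ⟨η / 2, by positivity, fun ε hε hε2 => ⟨mollify ε F, ?_⟩⟩
  have hm := integral_mollProfile_pos hε
  have hball : ∀ z ∈ L, ∀ y : ℂ, ‖y‖ ≤ η / 2 → closedBall (z + y) (η / 2) ⊆ D := by
    intro z hz y hy w hw
    refine hηD ?_
    have := hmem z hz (y + (w - (z + y))) (by
      rw [mem_closedBall, dist_eq_norm] at hw
      linarith [norm_add_le y (w - (z + y))])
    rwa [show z + (y + (w - (z + y))) = w by ring] at this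
  have hzero : ∀ y : ℂ, ¬ ‖y‖ < ε → mollProfile ε (Complex.normSq y) = 0 := by
    intro y hy
    refine mollProfile_eq_zero hε ?_
    rw [Complex.normSq_eq_norm_sq]
    have := not_lt.1 hy
    gcongr
  have eqF : ∀ z ∈ L, ∀ y, mollProfile ε (Complex.normSq y) * F (z + y) =
      mollProfile ε (Complex.normSq y) * r (z + y) := by
    intro z hz y
    by_cases hy : ‖y‖ < ε
    · rw [hF, indicator_of_mem (hmem z hz y (by linarith))]
    · rw [hzero y hy, zero_mul, zero_mul]
  have hint : ∀ z, Integrable fun y => mollProfile ε (Complex.normSq y) * F (z + y) := fun z =>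
    (integrable_mollProfile hε).mul_bdd (c := B)
      (hFm.comp (measurable_const_add z)).aestronglyMeasurable (Eventually.of_forall fun y => hFB _)
  have hcd : ContDiff ℝ 4 (mollify ε F) := contDiff_mollify hε hFi (n := 4)
  refine ⟨hcd, hasCompactSupport_mollify hε hFs, fun z hz => ?_, fun z hz => ?_,
    fun z hz t ht => ?_⟩
  · refine lap_nonneg_of_submean (hcd.of_le (by norm_num)) (hasCompactSupport_mollify hε hFs)
      (η := η / 2) (by positivity) fun R hR hRη => ?_
    simp only [mollify_apply]
    have bi : Integrable fun x : ℂ => radBump R (Complex.normSq x) := by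
      have := integrable_radBump_mul hR (F := fun _ => (1:ℝ)) (C := 1) measurable_const (by simp)
      simpa using this
    have hprod : Integrable (Function.uncurry fun x y : ℂ => radBump R (Complex.normSq x) *
        (mollProfile ε (Complex.normSq y) * F (z + x + y))) (volume.prod volume) := by
      have := (bi.mul_prod (integrable_mollProfile hε)).mul_bdd (c := B)
        (g := fun p : ℂ × ℂ => F (z + p.1 + p.2))
        ((hFm.comp (by fun_prop : Measurable fun p : ℂ × ℂ => z + p.1 + p.2)).aestronglyMeasurable)
        (Eventually.of_forall fun p => hFB _)
      refine this.congr (Eventually.of_forall fun p => ?_)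
      simp only [Function.uncurry]
      ring
    have e1 : ∫ y, radBump R (Complex.normSq y) *
        ((∫ x : ℂ, mollProfile ε (Complex.normSq x) * F (z + y + x)) /
          ∫ y : ℂ, mollProfile ε (Complex.normSq y)) =
        (∫ y, mollProfile ε (Complex.normSq y) *
          ∫ x, radBump R (Complex.normSq x) * F (z + y + x)) /
          ∫ y : ℂ, mollProfile ε (Complex.normSq y) := by
      simp only [← mul_div_assoc]
      rw [integral_div]
      congr 1
      simp only [← integral_const_mul]
      rw [integral_integral_swap hprod]
      congr 1; ext y; congr 1; ext x
      rw [show z + x + y = z + y + x by ring]; ring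
    rw [e1, ← mul_div_assoc]
    refine div_le_div_of_nonneg_right ?_ hm.le
    rw [← integral_const_mul]
    refine integral_mono ((hint z).const_mul _) ?_ fun y => ?_
    · have := hprod.integral_prod_right
      refine this.congr (Eventually.of_forall fun y => ?_)
      simp only [Function.uncurry]
      rw [← integral_const_mul]
      congr 1; ext x
      rw [show z + x + y = z + y + x by ring]; ring
    · by_cases hy : ‖y‖ < ε
      · have key := h.radial_submean (q := radBump R) (c := z + y) hR
          ((closedBall_subset_closedBall hRη.le).trans (hball z hz y (by linarith)))
          (continuous_radBump R) (fun s _ => radBump_nonneg R s) (fun s hs => radBump_eq_zero hR hs)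
        rw [integral_radBump hR] at key
        have e2 : ∫ x, radBump R (Complex.normSq x) * F (z + y + x) =
            ∫ x, radBump R (Complex.normSq x) * r (z + y + x) := by
          congr 1; ext x
          by_cases hx : ‖x‖ < R
          · rw [add_assoc, hF, indicator_of_mem (hmem z hz (y + x) ?_)]
            linarith [norm_add_le y x]
          · rw [radBump_eq_zero hR, zero_mul, zero_mul]
            rw [Complex.normSq_eq_norm_sq]
            have := not_lt.1 hx
            gcongr
        simp only [e2]
        rw [eqF z hz y]
        have := mul_le_mul_of_nonneg_left key (mollProfile_nonneg ε (Complex.normSq y))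
        linarith
      · simp [hzero y hy]
  · rw [mollify_apply, le_div_iff₀ hm]
    simp only [eqF z hz]
    refine h.radial_submean hε ?_ (contDiff_mollProfile ε (n := 0)).continuous
      (fun s _ => mollProfile_nonneg ε s) (fun s hs => mollProfile_eq_zero hε hs)
    have := hball z hz 0 (by simp; positivity)
    rw [add_zero] at this
    exact (closedBall_subset_closedBall hε2.le).trans this
  · rw [mollify_apply, div_le_iff₀ hm]
    simp only [eqF z hz]
    rw [← integral_const_mul]
    refine integral_mono ?_ ((integrable_mollProfile hε).const_mul _) fun y => ?_
    · simpa only [eqF z hz] using hint z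
    · by_cases hy : ‖y‖ < ε
      · have := ht (z + y) (by simpa [dist_eq_norm] using hy.le)
        simp only
        nlinarith [mollProfile_nonneg ε (Complex.normSq y)]
      · simp [hzero y hy]

/-! ### Approximating sequences -/

/-- A sequence of smooth approximants decreasing to the weight `r` on `L`. -/
structure ApproxSeq (D : Set ℂ) (r : ℂ → ℝ) (L : Set ℂ) (a : ℕ → ℂ → ℝ) : Prop where
  contDiff : ∀ n, ContDiff ℝ 4 (a n)
  compact : ∀ n, HasCompactSupport (a n)
  lap_nonneg : ∀ n, ∀ z ∈ L, 0 ≤ lap (a n) z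
  le : ∀ n, ∀ z ∈ L, r z ≤ a n z
  eventually_le : ∀ K, IsCompact K → K ⊆ L → ∀ U, IsOpen U → K ⊆ U → ∀ t, (∀ y ∈ U, r y ≤ t) →
    ∀ᶠ n in atTop, ∀ z ∈ K, a n z ≤ t

lemma SubharmonicWeight.exists_approxSeq {D : Set ℂ} {r : ℂ → ℝ} (h : SubharmonicWeight D r)
    {L : Set ℂ} (hL : IsCompact L) (hLD : L ⊆ D) : ∃ a, ApproxSeq D r L a := by
  obtain ⟨ε₀, hε₀, he⟩ := h.exists_isApprox hL hLD
  have hpos : ∀ n : ℕ, 0 < ε₀ / (n + 2) := fun n => by positivity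
  choose a ha using fun n : ℕ => he (ε₀ / (n + 2)) (hpos n) (by
    rw [div_lt_iff₀ (by positivity)]
    have : (0:ℝ) ≤ n := by positivity
    nlinarith)
  have hlim : Tendsto (fun n : ℕ => ε₀ / ((n:ℝ) + 2)) atTop (nhds 0) :=
    tendsto_const_nhds.div_atTop (tendsto_natCast_atTop_atTop.atTop_add tendsto_const_nhds)
  refine ⟨a, fun n => (ha n).contDiff, fun n => (ha n).compact, fun n => (ha n).lap_nonneg,
    fun n => (ha n).le, fun K hK hKL U hU hKU t ht => ?_⟩
  obtain ⟨d, hd, hdU⟩ := hK.exists_cthickening_subset_open hU hKU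
  filter_upwards [hlim.eventually (gt_mem_nhds hd)] with n hn z hz
  refine (ha n).le_of_forall z (hKL hz) t fun y hy => ht y (hdU ?_)
  exact mem_cthickening_of_dist_le y z _ _ hz ((mem_closedBall.1 hy).trans hn.le)

lemma ApproxSeq.mono {D : Set ℂ} {r : ℂ → ℝ} {L L' : Set ℂ} {a : ℕ → ℂ → ℝ}
    (ha : ApproxSeq D r L' a) (hL : L ⊆ L') : ApproxSeq D r L a :=
  ⟨ha.contDiff, ha.compact, fun n z hz => ha.lap_nonneg n z (hL hz),
    fun n z hz => ha.le n z (hL hz), fun K hK hKL => ha.eventually_le K hK (hKL.trans hL)⟩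

lemma ApproxSeq.tendsto {D : Set ℂ} {r : ℂ → ℝ} (h : SubharmonicWeight D r) {L : Set ℂ}
    (hLD : L ⊆ D) {a : ℕ → ℂ → ℝ} (ha : ApproxSeq D r L a) {z : ℂ} (hz : z ∈ L) :
    Tendsto (fun n => a n z) atTop (nhds (r z)) := by
  rw [Metric.tendsto_atTop]
  intro ε hε
  have h1 := h.eventually_lt (hLD hz) (t := r z + ε / 2) (by linarith)
  obtain ⟨d, hd, h2⟩ := Metric.eventually_nhds_iff_ball.1 h1
  have h3 := ha.eventually_le {z} isCompact_singleton (by simpa using hz) (ball z d) isOpen_ball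
    (by simpa using hd) (r z + ε / 2) (fun y hy => (h2 y hy).le)
  obtain ⟨N, hN⟩ := eventually_atTop.1 h3
  refine ⟨N, fun n hn => ?_⟩
  rw [Real.dist_eq, abs_of_nonneg (by linarith [ha.le n z hz])]
  linarith [hN n hn z rfl]

/-- A uniform bound for approximating sequences on a compact set. -/
lemma SubharmonicWeight.exists_bound_approxSeq {D : Set ℂ} {r : ℂ → ℝ} (h : SubharmonicWeight D r)
    {K : Set ℂ} (hK : IsCompact K) (hKD : K ⊆ D) : ∃ B, 0 ≤ B ∧ (∀ z ∈ K, r z ≤ B) ∧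
      ∀ L, K ⊆ L → ∀ a, ApproxSeq D r L a → ∀ᶠ n in atTop, ∀ z ∈ K, a n z ≤ B := by
  obtain ⟨d, hd, hdD⟩ := hK.exists_cthickening_subset_open h.isOpen hKD
  obtain ⟨B, hB0, hB⟩ := h.exists_bound hK.cthickening hdD
  refine ⟨B, hB0, fun z hz => hB z (self_subset_cthickening K hz), fun L hKL a ha => ?_⟩
  exact ha.eventually_le K hK hKL (thickening d K) isOpen_thickening (self_subset_thickening hd K) B
    fun y hy => hB y (thickening_subset_cthickening d K hy)

/-! ### A strictly convex modification -/

/-- A strictly convex increasing function of the weight, growing at most linearly. -/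
noncomputable def chi (t : ℝ) : ℝ := t + Real.exp (-t) - 1

lemma chi_zero : chi 0 = 0 := by simp [chi]

lemma continuous_chi : Continuous chi := by unfold chi; fun_prop

lemma chi_tangent (m t : ℝ) : chi t = chi m + (1 - Real.exp (-m)) * (t - m) +
    Real.exp (-m) * chi (t - m) := by
  have : Real.exp (-t) = Real.exp (-m) * Real.exp (-(t - m)) := by
    rw [← Real.exp_add]; congr 1; ring
  simp only [chi]
  rw [this]; ring

lemma chi_nonneg (t : ℝ) : 0 ≤ chi t := by
  have := Real.add_one_le_exp (-t)
  unfold chi; linarith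

lemma chi_pos {t : ℝ} (ht : t ≠ 0) : 0 < chi t := by
  have := Real.add_one_lt_exp (neg_ne_zero.2 ht)
  unfold chi; linarith

lemma chi_le {t : ℝ} (ht : 0 ≤ t) : chi t ≤ t := by
  have := Real.exp_le_one_iff.2 (neg_nonpos.2 ht)
  unfold chi; linarith

lemma chi_mono {s t : ℝ} (hs : 0 ≤ s) (hst : s ≤ t) : chi s ≤ chi t := by
  rw [chi_tangent s t]
  have h1 := Real.exp_le_one_iff.2 (neg_nonpos.2 hs)
  have h2 := mul_nonneg (sub_nonneg.2 h1) (sub_nonneg.2 hst)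
  have h3 := mul_nonneg (Real.exp_pos (-s)).le (chi_nonneg (t - s))
  linarith

lemma exists_lt_of_chi_lt {t x : ℝ} (h : chi t < x) : ∃ s, t < s ∧ chi s < x := by
  have : ∀ᶠ s in nhds t, chi s < x := continuous_chi.continuousAt.eventually_lt
    continuousAt_const h
  obtain ⟨d, hd, h2⟩ := Metric.eventually_nhds_iff.1 this
  refine ⟨t + d / 2, by linarith, h2 ?_⟩
  rw [Real.dist_eq, add_sub_cancel_left, abs_of_pos (by positivity)]
  linarith

namespace SubharmonicWeight

variable {D : Set ℂ} {r : ℂ → ℝ}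

/-- If a strictly convex function of the weight has vanishing mass near `p`, the weight is
a.e. constant near `p`. -/
lemma ae_eq_of_mass_nonpos (h : SubharmonicWeight D r) {p : ℂ} {R : ℝ} (hR : 0 < R)
    (hD : closedBall p R ⊆ D)
    (hm : ∀ δ, 0 < δ → ∫ y, (posKer R δ (Complex.normSq y) - negKer R δ (Complex.normSq y)) *
      chi (r (p + y)) ≤ 0) :
    ∀ᵐ y : ℂ, y ∈ ball 0 R → r (p + y) = r p := by
  obtain ⟨B, hB0, hB⟩ := h.exists_bound (isCompact_closedBall p R) hD
  set w : ℂ → ℝ := fun y => (closedBall p R).indicator r (p + y) with hw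
  have hwm : Measurable w :=
    (h.measurable.indicator measurableSet_closedBall).comp (measurable_const_add p)
  have hw0 : ∀ y, 0 ≤ w y := fun y => indicator_nonneg (fun z _ => h.nonneg z) _
  have hwB : ∀ y, w y ≤ B := by
    intro y
    by_cases hy : p + y ∈ closedBall p R
    · simp only [hw, indicator_of_mem hy]; exact hB _ hy
    · simp only [hw, indicator_of_notMem hy]; exact hB0
  have hwr : ∀ y, Complex.normSq y < R ^ 2 → w y = r (p + y) := by
    intro y hy
    have : p + y ∈ closedBall p R := by
      have := (normSq_sub_lt_iff hR (c := p) (z := p + y)).1 (by simpa using hy)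
      exact this.le
    simp only [hw, indicator_of_mem this]
  set F : ℂ → ℝ := fun y => chi (w y)
  set m := chi (r p)
  have hFm : Measurable F := continuous_chi.measurable.comp hwm
  have hF0 : ∀ y, 0 ≤ F y := fun y => chi_nonneg _
  have hFB : ∀ y, |F y| ≤ B := fun y => by
    rw [abs_of_nonneg (hF0 y)]; exact (chi_le (hw0 y)).trans (hwB y)
  have hrp : r p ≤ B := hB p (mem_closedBall_self hR.le)
  have hmB : m ≤ B := (chi_le (h.nonneg p)).trans hrp
  have hV : ∀ y, |max (F y) m| ≤ B := fun y => by
    rw [abs_of_nonneg ((hF0 y).trans (le_max_left _ _))]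
    exact max_le ((le_abs_self _).trans (hFB y)) hmB
  have hR2 : 0 < R ^ 2 := by positivity
  have hF00 : F 0 = m := by
    simp only [F, m]; rw [hwr 0 (by simpa using hR2), add_zero]
  have hVc : ContinuousAt (fun y => max (F y) m) 0 := by
    rw [Metric.continuousAt_iff']
    intro e he
    obtain ⟨s, hs, hs2⟩ := exists_lt_of_chi_lt (t := r p) (x := m + e) (by simp only [m]; linarith)
    have h1 := h.eventually_lt (hD (mem_closedBall_self hR.le)) hs
    have h2 : Tendsto (fun y : ℂ => p + y) (nhds 0) (nhds p) := by
      have : Continuous fun y : ℂ => p + y := by fun_prop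
      simpa using this.tendsto 0
    filter_upwards [h2.eventually h1, (Complex.continuous_normSq.tendsto 0).eventually
      (gt_mem_nhds (show Complex.normSq 0 < R ^ 2 by simpa using hR2))] with y hy hy2
    rw [hF00, max_self, Real.dist_eq, abs_of_nonneg (by linarith [le_max_right (F y) m])]
    have : F y ≤ chi s := by
      simp only [F]; rw [hwr y hy2]; exact chi_mono (h.nonneg _) hy.le
    have : max (F y) m < m + e := max_lt (by linarith) (by linarith)
    linarith
  have Lneg := tendsto_integral_negKer (R := R) (F := fun y => max (F y) m)
    (hFm.max measurable_const) hV hVc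
  rw [hF00, max_self] at Lneg
  have Lpos := tendsto_integral_posKer hR hFm hFB
  have bF := integrable_radBump_mul hR hFm hFB
  have step : ∀ᶠ δ in nhdsWithin (0:ℝ) (Ioi 0), ∫ y, posKer R δ (Complex.normSq y) * F y ≤
      ∫ y, negKer R δ (Complex.normSq y) * max (F y) m := by
    filter_upwards [self_mem_nhdsWithin] with δ hδ
    have hδ : 0 < δ := hδ
    have e : ∀ y, (posKer R δ (Complex.normSq y) - negKer R δ (Complex.normSq y)) *
        chi (r (p + y)) = posKer R δ (Complex.normSq y) * F y -
          negKer R δ (Complex.normSq y) * F y := by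
      intro y
      rcases lt_or_ge (Complex.normSq y) (R ^ 2) with hy | hy
      · simp only [F]; rw [hwr y hy]; ring
      · rw [posKer_eq_zero hR hy, negKer_eq_zero hR hy]; ring
    have ci : ∀ {k : ℝ → ℝ}, Continuous (fun y : ℂ => k (Complex.normSq y)) →
        (∀ s, R ^ 2 ≤ s → k s = 0) → ∀ {G : ℂ → ℝ}, Measurable G → (∀ y, |G y| ≤ B) →
        Integrable fun y => k (Complex.normSq y) * G y := by
      intro k hk hk0 G hG hGB
      refine (hk.integrable_of_hasCompactSupport ?_).mul_bdd (c := B)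
        hG.aestronglyMeasurable (Eventually.of_forall hGB)
      simpa using hasCompactSupport_radial hR hk0 0
    have i1 := ci (continuous_posKer (R := R) hδ) (fun s hs => posKer_eq_zero hR hs) hFm hFB
    have i2 := ci (continuous_negKer (R := R) hδ) (fun s hs => negKer_eq_zero hR hs) hFm hFB
    have i3 := ci (continuous_negKer (R := R) hδ) (fun s hs => negKer_eq_zero hR hs)
      (hFm.max (measurable_const (a := m))) hV
    have h1 := hm δ hδ
    simp only [e] at h1
    rw [integral_sub i1 i2] at h1
    have h2 : ∫ y, negKer R δ (Complex.normSq y) * F y ≤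
        ∫ y, negKer R δ (Complex.normSq y) * max (F y) m :=
      integral_mono i2 i3 fun y =>
        mul_le_mul_of_nonneg_left (le_max_left _ _) (negKer_nonneg _ _ _)
    linarith
  have hle : ∫ y, radBump R (Complex.normSq y) * F y ≤ kerMass * m :=
    le_of_tendsto_of_tendsto Lpos Lneg step
  have hsub := h.radial_submean (q := radBump R) hR hD (continuous_radBump R)
    (fun s _ => radBump_nonneg R s) (fun s hs => radBump_eq_zero hR hs)
  rw [integral_radBump hR] at hsub
  have hsub' : ∫ y, radBump R (Complex.normSq y) * r (p + y) =
      ∫ y, radBump R (Complex.normSq y) * w y := by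
    congr 1; ext y
    rcases lt_or_ge (Complex.normSq y) (R ^ 2) with hy | hy
    · rw [hwr y hy]
    · rw [radBump_eq_zero hR hy]; ring
  rw [hsub'] at hsub
  have bw := integrable_radBump_mul hR hwm (C := B) fun y => by
    rw [abs_of_nonneg (hw0 y)]; exact hwB y
  have b1 : Integrable fun y : ℂ => radBump R (Complex.normSq y) := by
    simpa using integrable_radBump_mul hR (F := fun _ => (1:ℝ)) (C := 1) measurable_const (by simp)
  set e := Real.exp (-(r p)) with he
  have hepos : 0 < e := Real.exp_pos _
  have he1 : e ≤ 1 := Real.exp_le_one_iff.2 (neg_nonpos.2 (h.nonneg p))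
  have expand : ∀ y, radBump R (Complex.normSq y) * (e * chi (w y - r p)) =
      radBump R (Complex.normSq y) * F y - radBump R (Complex.normSq y) * (m - (1 - e) * r p) -
        (1 - e) * (radBump R (Complex.normSq y) * w y) := by
    intro y
    have := chi_tangent (r p) (w y)
    simp only [F, m]
    rw [this]; ring
  have iG : Integrable fun y => radBump R (Complex.normSq y) * (e * chi (w y - r p)) := by
    simp only [expand]
    exact (bF.sub (b1.mul_const _)).sub (bw.const_mul _)
  have hG0 : ∀ y, 0 ≤ radBump R (Complex.normSq y) * (e * chi (w y - r p)) := fun y =>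
    mul_nonneg (radBump_nonneg _ _) (mul_nonneg hepos.le (chi_nonneg _))
  have hGle : ∫ y, radBump R (Complex.normSq y) * (e * chi (w y - r p)) ≤ 0 := by
    simp only [expand]
    have b2 := b1.mul_const (m - (1 - e) * r p)
    rw [integral_sub (by exact bF.sub b2) (bw.const_mul _), integral_sub bF b2, integral_mul_const, integral_const_mul, integral_radBump hR]
    have := mul_le_mul_of_nonneg_left hsub (sub_nonneg.2 he1)
    nlinarith
  have hGz := (integral_eq_zero_iff_of_nonneg hG0 iG).1 (le_antisymm hGle (integral_nonneg hG0))
  filter_upwards [hGz] with y hy hyR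
  have hyR2 : Complex.normSq y < R ^ 2 := by
    have := (normSq_sub_lt_iff hR (c := 0) (z := y)).2 hyR
    simpa using this
  by_contra hne
  have h1 := radBump_pos hR hyR2
  have h2 := chi_pos (sub_ne_zero.2 hne)
  rw [← hwr y hyR2] at h2
  have : 0 < radBump R (Complex.normSq y) * (e * chi (w y - r p)) := by positivity
  exact this.ne' hy

/-- A nonconstant weight carries mass after a strictly convex modification. -/
lemma exists_mass_pos (h : SubharmonicWeight D r) (hnc : ¬ ∃ c, ∀ z ∈ D, r z = c) :
    ∃ p R δ, 0 < R ∧ 0 < δ ∧ closedBall p (8 * R) ⊆ D ∧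
      0 < ∫ y, (posKer R δ (Complex.normSq y) - negKer R δ (Complex.normSq y)) *
        chi (r (p + y)) := by
  by_contra hcon
  push Not at hcon
  have hloc : ∀ p ∈ D, ∃ R > 0, closedBall p (8 * R) ⊆ D ∧
      ∀ᵐ z : ℂ, z ∈ ball p R → r z = r p := by
    intro p hp
    obtain ⟨d, hd, hdD⟩ := Metric.isOpen_iff.1 h.isOpen p hp
    have h8 : closedBall p (8 * (d / 16)) ⊆ D :=
      (closedBall_subset_ball (by linarith)).trans hdD
    refine ⟨d / 16, by positivity, h8, ?_⟩
    have := h.ae_eq_of_mass_nonpos (p := p) (R := d / 16) (by positivity)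
      ((closedBall_subset_closedBall (by linarith)).trans h8)
      fun δ hδ => hcon p (d / 16) δ (by positivity) hδ h8
    have h2 := (measurePreserving_sub_right volume p).quasiMeasurePreserving.ae this
    filter_upwards [h2] with z hz hzb
    have := hz (by simpa [dist_eq_norm] using hzb)
    simpa using this
  have hopen : ∀ p ∈ D, ∀ᶠ q in nhds p, r q = r p := by
    intro p hp
    obtain ⟨R, hR, hRD, hae⟩ := hloc p hp
    filter_upwards [ball_mem_nhds p hR] with q hq
    obtain ⟨R', hR', -, hae'⟩ := hloc q (hRD (ball_subset_closedBall
      (ball_subset_ball (by linarith) hq)))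
    have hne : (ball p R ∩ ball q R').Nonempty := ⟨q, hq, mem_ball_self hR'⟩
    have hpos := (isOpen_ball.inter isOpen_ball).measure_pos volume hne
    have hfr : ∃ᵐ z : ℂ, z ∈ ball p R ∩ ball q R' := by
      rw [frequently_ae_mem_iff]; exact hpos.ne'
    obtain ⟨z, hz, h1, h2⟩ := (hfr.and_eventually (hae.and hae')).exists
    rw [← h1 hz.1, ← h2 hz.2]
  obtain ⟨p, hp⟩ := h.isConnected.nonempty
  refine hnc ⟨r p, ?_⟩
  have := h.isConnected.isPreconnected.subset_left_of_subset_union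
    (u := {z | ∀ᶠ q in nhds z, r q = r p}) (v := {z | ∀ᶠ q in nhds z, r q ≠ r p})
    isOpen_setOfPred_eventually_nhds isOpen_setOfPred_eventually_nhds ?_ ?_ ⟨p, hp, hopen p hp⟩
  · exact fun z hz => (this hz).self_of_nhds
  · rw [Set.disjoint_left]
    intro z hz hz2
    exact hz2.self_of_nhds hz.self_of_nhds
  · intro z hz
    have hz2 := hopen z hz
    by_cases he : r z = r p
    · left; filter_upwards [hz2] with q hq; rw [hq, he]
    · right; filter_upwards [hz2] with q hq; rw [hq]; exact he

end SubharmonicWeight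

/-! ### Truncated logarithmic potentials -/

open scoped Convolution in
/-- The truncated logarithmic potential of `g`. -/
noncomputable def logPot (R : ℝ) (g : ℂ → ℝ) : ℂ → ℝ :=
  (fun y => logKer R 0 (Complex.normSq y)) ⋆[ContinuousLinearMap.lsmul ℝ ℝ, volume] g

lemma logPot_apply (R : ℝ) (g : ℂ → ℝ) (z : ℂ) :
    logPot R g z = ∫ y, logKer R 0 (Complex.normSq y) * g (z + y) := by
  rw [logPot, convolution_def, ← integral_neg_eq_self]
  simp [Complex.normSq_neg, sub_neg_eq_add]

lemma contDiff_logPot {R : ℝ} (hR : 0 < R) {g : ℂ → ℝ} {n : ℕ∞} (hg : ContDiff ℝ n g)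
    (hc : HasCompactSupport g) : ContDiff ℝ n (logPot R g) :=
  hc.contDiff_convolution_right _ (integrable_logKer_zero hR).locallyIntegrable hg

lemma dX_logPot {R : ℝ} (hR : 0 < R) {g : ℂ → ℝ} (hg : ContDiff ℝ 1 g)
    (hc : HasCompactSupport g) : dX (logPot R g) = logPot R (dX g) := by
  ext z
  have hl := (integrable_logKer_zero hR).locallyIntegrable
  have := hc.hasFDerivAt_convolution_right (ContinuousLinearMap.lsmul ℝ ℝ) hl hg z
  simp only [dX, logPot]
  rw [this.fderiv]
  exact convolution_precompR_apply _ hl (hc.fderiv ℝ) (hg.continuous_fderiv (by norm_num)) z 1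

lemma dY_logPot {R : ℝ} (hR : 0 < R) {g : ℂ → ℝ} (hg : ContDiff ℝ 1 g)
    (hc : HasCompactSupport g) : dY (logPot R g) = logPot R (dY g) := by
  ext z
  have hl := (integrable_logKer_zero hR).locallyIntegrable
  have := hc.hasFDerivAt_convolution_right (ContinuousLinearMap.lsmul ℝ ℝ) hl hg z
  simp only [dY, logPot]
  rw [this.fderiv]
  exact convolution_precompR_apply _ hl (hc.fderiv ℝ) (hg.continuous_fderiv (by norm_num)) z _

lemma lap_logPot {R : ℝ} (hR : 0 < R) {g : ℂ → ℝ} (hg : ContDiff ℝ 2 g)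
    (hc : HasCompactSupport g) (z : ℂ) : lap (logPot R g) z =
      4 * ((∫ y, radBump R (Complex.normSq y) * g (z + y)) - kerMass * g z) := by
  rw [← integral_logKer_zero_mul_lap hR hg hc z]
  have h1 : ContDiff ℝ 1 g := hg.of_le (by norm_num)
  have gx := hg.dX (n := 2) (m := 1) (by norm_num)
  have gy := hg.dY (n := 2) (m := 1) (by norm_num)
  have ic : ∀ {k : ℂ → ℝ}, Continuous k → HasCompactSupport k →
      Integrable fun y => logKer R 0 (Complex.normSq y) * k (z + y) := by
    intro k hk hkc
    obtain ⟨C, hC⟩ := hkc.exists_bound_of_continuous hk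
    exact (integrable_logKer_zero hR).mul_bdd (c := C)
      (hk.comp (continuous_const_add z)).aestronglyMeasurable (Eventually.of_forall fun y => hC _)
  simp only [lap, dX_logPot hR h1 hc, dY_logPot hR h1 hc, dX_logPot hR gx hc.dX,
    dY_logPot hR gy hc.dY, logPot_apply, mul_add]
  exact (integral_add (ic (gx.dX (n := 1) (m := 0) (by norm_num)).continuous hc.dX.dX)
    (ic (gy.dY (n := 1) (m := 0) (by norm_num)).continuous hc.dY.dY)).symm

/-! ### Good points -/

/-- `z₀` is good if there are uniformly bounded auxiliary weights, dominated by multiples of the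
approximants, which are strictly subharmonic near `z₀`. -/
def GoodPoint (D : Set ℂ) (r : ℂ → ℝ) (z₀ : ℂ) : Prop :=
  ∃ c ρ₀ N C : ℝ, ∃ L₀ : Set ℂ, 0 < c ∧ 0 < ρ₀ ∧ 0 ≤ N ∧ IsCompact L₀ ∧ L₀ ⊆ D ∧
    ∀ L, L₀ ⊆ L → IsCompact L → L ⊆ D → ∀ a, ApproxSeq D r L a → ∀ᶠ n in atTop,
      ∃ ψ : ℂ → ℝ, ContDiff ℝ 2 ψ ∧ (∀ z ∈ L, 0 ≤ lap ψ z) ∧ (∀ z ∈ L, -C ≤ ψ z) ∧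
        (∀ z ∈ L, ψ z ≤ N * a n z + C) ∧ ∀ z ∈ L, z ∈ ball z₀ ρ₀ → c ≤ lap ψ z

lemma contDiff_chi {n : WithTop ℕ∞} : ContDiff ℝ n chi := by
  unfold chi; fun_prop

lemma lap_chi_comp_nonneg {a : ℂ → ℝ} (ha : ContDiff ℝ 2 a) {z : ℂ} (h0 : 0 ≤ a z)
    (h1 : 0 ≤ lap a z) : 0 ≤ lap (fun x => chi (a x)) z := by
  have d1 : ∀ s ∈ (univ : Set ℝ), HasDerivAt chi (1 - Real.exp (-s)) s := fun s _ => by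
    have := ((hasDerivAt_id s).add (hasDerivAt_neg s).exp).sub_const 1
    refine this.congr_deriv ?_
    ring
  have d2 : ∀ s ∈ (univ : Set ℝ), HasDerivAt (fun s => 1 - Real.exp (-s)) (Real.exp (-s)) s :=
    fun s _ => by
      have := (hasDerivAt_neg s).exp.const_sub 1
      refine this.congr_deriv ?_
      ring
  rw [lap_comp (fun _ => mem_univ _) ha d1 d2]
  have h2 := Real.exp_le_one_iff.2 (neg_nonpos.2 h0)
  have h3 := mul_nonneg (sub_nonneg.2 h2) h1
  have h4 := (Real.exp_pos (-a z)).le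
  positivity

lemma ContDiff.lap {f : ℂ → ℝ} (hf : ContDiff ℝ 4 f) : ContDiff ℝ 2 (lap f) :=
  ((hf.dX (n := 4) (m := 3) (by norm_num)).dX (n := 3) (m := 2) (by norm_num)).add
    ((hf.dY (n := 4) (m := 3) (by norm_num)).dY (n := 3) (m := 2) (by norm_num))

namespace SubharmonicWeight

variable {D : Set ℂ} {r : ℂ → ℝ}

/-- The mass found by `exists_mass_pos` persists for approximants. -/
lemma eventually_mass (h : SubharmonicWeight D r) {p : ℂ} {R δ : ℝ} (hR : 0 < R) (hδ : 0 < δ)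
    (hD : closedBall p R ⊆ D) {L : Set ℂ} (hL : closedBall p R ⊆ L) (hLD : L ⊆ D)
    {a : ℕ → ℂ → ℝ} (ha : ApproxSeq D r L a) {m : ℝ}
    (hm : m < ∫ y, (posKer R δ (Complex.normSq y) - negKer R δ (Complex.normSq y)) *
      chi (r (p + y))) :
    ∀ᶠ n in atTop, 4 * m ≤ ∫ z, logKer R δ (Complex.normSq (z - p)) *
      lap (fun x => chi (a n x)) z := by
  obtain ⟨B, hB0, -, hB⟩ := h.exists_bound_approxSeq (isCompact_closedBall p R) hD
  have hcont : Continuous fun y : ℂ =>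
      posKer R δ (Complex.normSq y) - negKer R δ (Complex.normSq y) :=
    (continuous_posKer (R := R) hδ).sub (continuous_negKer (R := R) hδ)
  have hz : ∀ y : ℂ, p + y ∉ closedBall p R →
      posKer R δ (Complex.normSq y) - negKer R δ (Complex.normSq y) = 0 := by
    intro y hy
    have h1 := (le_normSq_sub_iff hR (c := p) (z := p + y)).2 (not_le.1 hy).le
    rw [add_sub_cancel_left] at h1
    rw [posKer_eq_zero hR h1, negKer_eq_zero hR h1, sub_zero]
  have hsupp : HasCompactSupport fun y : ℂ =>
      posKer R δ (Complex.normSq y) - negKer R δ (Complex.normSq y) :=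
    HasCompactSupport.intro (isCompact_closedBall 0 R) fun y hy => hz y (by simpa using hy)
  have lim : Tendsto (fun n => ∫ y, (posKer R δ (Complex.normSq y) - negKer R δ (Complex.normSq y)) *
      chi (a n (p + y))) atTop (nhds (∫ y, (posKer R δ (Complex.normSq y) -
        negKer R δ (Complex.normSq y)) * chi (r (p + y)))) := by
    refine tendsto_integral_filter_of_dominated_convergence
      (fun y => ‖posKer R δ (Complex.normSq y) - negKer R δ (Complex.normSq y)‖ * B)
      (Eventually.of_forall fun n => ?_) ?_
      ((hcont.integrable_of_hasCompactSupport hsupp).norm.mul_const B)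
      (Eventually.of_forall fun y => ?_)
    · have := (ha.contDiff n).continuous
      have h2 := continuous_chi
      exact (hcont.mul (by fun_prop)).aestronglyMeasurable
    · filter_upwards [hB L hL a ha] with n hn
      refine Eventually.of_forall fun y => ?_
      by_cases hy : p + y ∈ closedBall p R
      · rw [norm_mul]
        refine mul_le_mul_of_nonneg_left ?_ (norm_nonneg _)
        have h0 := (h.nonneg _).trans (ha.le n _ (hL hy))
        rw [Real.norm_of_nonneg (chi_nonneg _)]
        exact (chi_le h0).trans (hn _ hy)
      · simp [hz y hy]
    · by_cases hy : p + y ∈ closedBall p R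
      · exact ((continuous_chi.tendsto _).comp (ha.tendsto h hLD (hL hy))).const_mul _
      · simp [hz y hy]
  filter_upwards [lim.eventually (lt_mem_nhds hm)] with n hn
  have hv : ContDiff ℝ 2 fun x => chi (a n x) :=
    contDiff_chi.comp ((ha.contDiff n).of_le (by norm_num))
  have key : ∫ z, logKer R δ (Complex.normSq (z - p)) * lap (fun x => chi (a n x)) z =
      4 * ∫ y, (posKer R δ (Complex.normSq y) - negKer R δ (Complex.normSq y)) *
        chi (a n (p + y)) := by
    have h1 := integral_mul_lap hv (contDiff_logKer hR hδ p) (hasCompactSupport_logKer hR p)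
    simp only [lap_logKer hR hδ] at h1
    have h2 := integral_sub_right_mul_normSq (fun s => posKer R δ s - negKer R δ s)
      (fun x => chi (a n x)) p
    rw [← h2, ← integral_const_mul]
    calc _ = ∫ z, lap (fun x => chi (a n x)) z * logKer R δ (Complex.normSq (z - p)) := by
          congr 1; ext z; ring
      _ = _ := by rw [← h1]; congr 1; ext z; ring
  rw [key]
  linarith

/-- A nonconstant weight has a good point. -/
lemma exists_goodPoint (h : SubharmonicWeight D r) (hnc : ¬ ∃ c, ∀ z ∈ D, r z = c) :
    ∃ p ∈ D, GoodPoint D r p := by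
  obtain ⟨p, R, δ, hR, hδ, hD, hm⟩ := h.exists_mass_pos hnc
  set m := ∫ y, (posKer R δ (Complex.normSq y) - negKer R δ (Complex.normSq y)) *
        chi (r (p + y)) with hmdef
  set Θ : ℂ → ℝ := fun z => logKer R δ (Complex.normSq (z - p)) with hΘ
  have hΘd : ContDiff ℝ 2 Θ := contDiff_logKer hR hδ p
  have hΘc : HasCompactSupport Θ := hasCompactSupport_logKer hR p
  have hΘ0 : ∀ z, 0 ≤ Θ z := fun z => logKer_nonneg hR (Complex.normSq_nonneg _)
  have hΘz : ∀ z, z ∉ ball p R → Θ z = 0 := fun z hz =>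
    logKer_eq_zero hR ((le_normSq_sub_iff hR).2 (not_lt.1 hz))
  obtain ⟨S₀, hS₀⟩ := hΘc.exists_bound_of_continuous hΘd.continuous
  set S := max S₀ 1
  have hS1 : 1 ≤ S := le_max_right _ _
  have hS : ∀ z, Θ z ≤ S := fun z =>
    (le_abs_self _).trans ((hS₀ z).trans (le_max_left _ _))
  obtain ⟨B, hB0, -, hB⟩ := h.exists_bound_approxSeq (isCompact_closedBall p (8 * R)) hD
  have hk := kerMass_pos
  have hT : (0:ℝ) < 3 * R := by positivity
  set α := 1 / (4 * kerMass * S) with hα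
  have hα0 : 0 < α := by positivity
  have hb0 : 0 < radBump (3 * R) (4 * R ^ 2) := radBump_pos hT (by nlinarith [sq_pos_of_pos hR])
  refine ⟨p, hD (mem_closedBall_self (by positivity)),
    4 * α * (radBump (3 * R) (4 * R ^ 2) * (2 * m)), R, 1, 4 * α * S * kerMass * B,
    closedBall p (8 * R), by positivity, hR, zero_le_one, isCompact_closedBall _ _, hD,
    fun L hL hLc hLD a ha => ?_⟩
  have hRsub : closedBall p R ⊆ closedBall p (8 * R) := closedBall_subset_closedBall (by linarith)
  have hmass := h.eventually_mass hR hδ (hRsub.trans hD) (hRsub.trans hL) hLD ha (m := m / 2)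
    (by rw [← hmdef]; linarith)
  filter_upwards [hmass, hB L hL a ha] with n hn1 hn2
  set v : ℂ → ℝ := fun x => chi (a n x) with hvdef
  have hv4 : ContDiff ℝ 4 v := contDiff_chi.comp (ha.contDiff n)
  have hv2 : ContDiff ℝ 2 v := hv4.of_le (by norm_num)
  have hvc : HasCompactSupport v := (ha.compact n).comp_left (g := chi) chi_zero
  have ha0 : ∀ z ∈ L, 0 ≤ a n z := fun z hz => (h.nonneg z).trans (ha.le n z hz)
  have hμ : ∀ z ∈ L, 0 ≤ lap v z := fun z hz =>
    lap_chi_comp_nonneg ((ha.contDiff n).of_le (by norm_num)) (ha0 z hz) (ha.lap_nonneg n z hz)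
  have hvB : ∀ z ∈ closedBall p (8 * R), v z ≤ B := fun z hz =>
    (chi_le (ha0 z (hL hz))).trans (hn2 z hz)
  set g : ℂ → ℝ := fun z => Θ z * lap v z with hg
  have hgd : ContDiff ℝ 2 g := hΘd.mul hv4.lap
  have hgc : HasCompactSupport g := hΘc.mul_right
  have hg0 : ∀ z, 0 ≤ g z := by
    intro z
    by_cases hz : z ∈ ball p R
    · exact mul_nonneg (hΘ0 z) (hμ z (hL (hRsub (ball_subset_closedBall hz))))
    · simp [hg, hΘz z hz]
  have hgz : ∀ z, z ∉ ball p R → g z = 0 := fun z hz => by simp [hg, hΘz z hz]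
  have hgS : ∀ z ∈ L, g z ≤ S * lap v z := fun z hz =>
    mul_le_mul_of_nonneg_right (hS z) (hμ z hz)
  have hpot0 : ∀ z, 0 ≤ logPot (3 * R) g z := fun z => by
    rw [logPot_apply]
    exact integral_nonneg fun y => mul_nonneg (logKer_nonneg hT (Complex.normSq_nonneg _)) (hg0 _)
  have hpotD : ContDiff ℝ 2 (logPot (3 * R) g) := contDiff_logPot hT hgd hgc (n := 2)
  have hlapψ : ∀ z, lap (fun x => v x + α * logPot (3 * R) g x) z = lap v z +
      α * (4 * ((∫ y, radBump (3 * R) (Complex.normSq y) * g (z + y)) - kerMass * g z)) := by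
    intro z
    rw [lap_add hv2 (contDiff_const.mul hpotD), lap_const_mul, lap_logPot hT hgd hgc]
  have hαS : α * 4 * kerMass * S = 1 := by rw [hα]; field_simp
  have hlow : ∀ z ∈ L, 4 * α * (∫ y, radBump (3 * R) (Complex.normSq y) * g (z + y)) ≤
      lap (fun x => v x + α * logPot (3 * R) g x) z := by
    intro z hz
    rw [hlapψ]
    have h1 := mul_le_mul_of_nonneg_left (hgS z hz) (by positivity : 0 ≤ α * 4 * kerMass)
    have h2 : α * 4 * kerMass * (S * lap v z) = lap v z := by
      rw [← mul_assoc, hαS, one_mul]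
    linarith
  refine ⟨fun x => v x + α * logPot (3 * R) g x, hv2.add (contDiff_const.mul hpotD),
    fun z hz => ?_, fun z hz => ?_, fun z hz => ?_, fun z hz hzR => ?_⟩
  · refine le_trans ?_ (hlow z hz)
    have : 0 ≤ ∫ y, radBump (3 * R) (Complex.normSq y) * g (z + y) :=
      integral_nonneg fun y => mul_nonneg (radBump_nonneg _ _) (hg0 _)
    positivity
  · have h1 := hpot0 z
    have h2 : 0 ≤ v z := chi_nonneg _
    have h3 : 0 ≤ 4 * α * S * kerMass * B := by positivity
    have h4 := mul_nonneg hα0.le h1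
    linarith
  · have h2 : v z ≤ a n z := chi_le (ha0 z hz)
    suffices hs : logPot (3 * R) g z ≤ 4 * S * kerMass * B by
      have := mul_le_mul_of_nonneg_left hs hα0.le
      linarith
    rw [logPot_apply]
    by_cases hzp : z ∈ closedBall p (4 * R)
    · have hmem : ∀ y : ℂ, Complex.normSq y < (3 * R) ^ 2 → z + y ∈ closedBall p (8 * R) := by
        intro y hy
        have h1 := (normSq_sub_lt_iff hT (c := z) (z := z + y)).1 (by simpa using hy)
        rw [mem_closedBall] at hzp ⊢
        linarith [dist_triangle (z + y) z p]
      have h5 : ∫ y, logKer (3 * R) 0 (Complex.normSq y) * g (z + y) ≤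
          ∫ y, S * (logKer (3 * R) 0 (Complex.normSq y) * lap v (z + y)) := by
        have ic : ∀ {k : ℂ → ℝ}, Continuous k → HasCompactSupport k →
            Integrable fun y => logKer (3 * R) 0 (Complex.normSq y) * k (z + y) := by
          intro k hk hkc
          obtain ⟨C, hC⟩ := hkc.exists_bound_of_continuous hk
          exact (integrable_logKer_zero hT).mul_bdd (c := C)
            (hk.comp (continuous_const_add z)).aestronglyMeasurable
            (Eventually.of_forall fun y => hC _)
        refine integral_mono (ic hgd.continuous hgc)
          ((ic hv2.continuous_lap hvc.lap).const_mul S) fun y => ?_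
        rcases lt_or_ge (Complex.normSq y) ((3 * R) ^ 2) with hy | hy
        · have := mul_le_mul_of_nonneg_left (hgS _ (hL (hmem y hy)))
            (logKer_nonneg (R := 3 * R) (δ := 0) hT (Complex.normSq_nonneg y))
          simp only
          linarith
        · simp [logKer_eq_zero hT hy]
      refine h5.trans ?_
      rw [integral_const_mul, integral_logKer_zero_mul_lap hT hv2 hvc z]
      have b1 : Integrable fun y : ℂ => radBump (3 * R) (Complex.normSq y) := by
        simpa using integrable_radBump_mul hT (F := fun _ => (1:ℝ)) (C := 1)
          measurable_const (by simp)
      have h6 : ∫ y, radBump (3 * R) (Complex.normSq y) * v (z + y) ≤ kerMass * B := by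
        rw [← integral_radBump hT, ← integral_mul_const]
        refine integral_mono ?_ (b1.mul_const B) fun y => ?_
        · obtain ⟨C, hC⟩ := hvc.exists_bound_of_continuous hv2.continuous
          exact b1.mul_bdd (c := C)
            (hv2.continuous.comp (continuous_const_add z)).aestronglyMeasurable
            (Eventually.of_forall fun y => hC _)
        · rcases lt_or_ge (Complex.normSq y) ((3 * R) ^ 2) with hy | hy
          · exact mul_le_mul_of_nonneg_left (hvB _ (hmem y hy)) (radBump_nonneg _ _)
          · simp [radBump_eq_zero hT hy]
      have h7 : 0 ≤ kerMass * v z := mul_nonneg hk.le (chi_nonneg _)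
      have h8 : (∫ y, radBump (3 * R) (Complex.normSq y) * v (z + y)) - kerMass * v z ≤
        kerMass * B := by linarith
      have h9 := mul_le_mul_of_nonneg_left h8 (by positivity : 0 ≤ S * 4)
      linarith
    · have : ∀ y, logKer (3 * R) 0 (Complex.normSq y) * g (z + y) = 0 := by
        intro y
        rcases lt_or_ge (Complex.normSq y) ((3 * R) ^ 2) with hy | hy
        · rw [hgz, mul_zero]
          have h1 := (normSq_sub_lt_iff hT (c := z) (z := z + y)).1 (by simpa using hy)
          rw [mem_closedBall] at hzp
          rw [mem_ball]
          have := dist_triangle z (z + y) p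
          rw [dist_comm z (z + y)] at this
          linarith
        · simp [logKer_eq_zero hT hy]
      simp only [this, integral_zero]
      positivity
  · refine le_trans ?_ (hlow z hz)
    refine mul_le_mul_of_nonneg_left ?_ (by positivity)
    have e1 : ∫ y, radBump (3 * R) (Complex.normSq y) * g (z + y) =
        ∫ y, radBump (3 * R) (Complex.normSq (y - z)) * g y :=
      (integral_sub_right_mul_normSq (radBump (3 * R)) g z).symm
    rw [e1]
    have gi := hgd.continuous.integrable_of_hasCompactSupport hgc (μ := volume)
    calc radBump (3 * R) (4 * R ^ 2) * (2 * m) ≤ radBump (3 * R) (4 * R ^ 2) * ∫ y, g y := by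
          refine mul_le_mul_of_nonneg_left ?_ hb0.le
          have : ∫ y, g y = ∫ z, logKer R δ (Complex.normSq (z - p)) * lap v z := rfl
          rw [this]; linarith
      _ = ∫ y, radBump (3 * R) (4 * R ^ 2) * g y := by rw [integral_const_mul]
      _ ≤ _ := by
          refine integral_mono (gi.const_mul _) ?_ fun y => ?_
          · refine gi.bdd_mul (c := 4 / (3 * R) ^ 2) ?_ (Eventually.of_forall fun y => ?_)
            · exact ((continuous_radBump _).comp
                (contDiff_normSq_sub z (n := 0)).continuous).aestronglyMeasurable
            · rw [Real.norm_of_nonneg (radBump_nonneg _ _)]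
              exact radBump_le _ (Complex.normSq_nonneg _)
          · by_cases hy : y ∈ ball p R
            · refine mul_le_mul_of_nonneg_right (radBump_anti _ ?_) (hg0 y)
              rw [Complex.normSq_eq_norm_sq, ← dist_eq_norm]
              have h1 : dist y z ≤ 2 * R := by
                rw [mem_ball] at hy hzR
                have := dist_triangle_right y z p
                linarith
              calc dist y z ^ 2 ≤ (2 * R) ^ 2 := by gcongr
                _ = _ := by ring
            · simp [hgz y hy]

end SubharmonicWeight

lemma contDiff_radCut_pow (R : ℝ) (n : ℕ) : ContDiff ℝ 2 fun s => radCut R s ^ (n + 4) := by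
  have d1 : deriv (fun s => radCut R s ^ (n + 4)) =
      fun s => -(((n + 2 : ℕ) + 2) / R ^ 2 * radCut R s ^ (n + 3)) :=
    funext fun s => (hasDerivAt_radCut_pow R (n + 2) s).deriv
  have d2 : deriv (fun s => radCut R s ^ (n + 3)) =
      fun s => -(((n + 1 : ℕ) + 2) / R ^ 2 * radCut R s ^ (n + 2)) :=
    funext fun s => (hasDerivAt_radCut_pow R (n + 1) s).deriv
  have hc := continuous_radCut R
  have c1 : ContDiff ℝ 1 fun s => radCut R s ^ (n + 3) := by
    rw [contDiff_one_iff_deriv]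
    refine ⟨fun s => (hasDerivAt_radCut_pow R (n + 1) s).differentiableAt, ?_⟩
    rw [d2]
    fun_prop
  rw [show (2 : WithTop ℕ∞) = 1 + 1 by norm_num, contDiff_succ_iff_deriv]
  refine ⟨fun s => (hasDerivAt_radCut_pow R (n + 2) s).differentiableAt, by simp, ?_⟩
  rw [d1]
  exact (contDiff_const.mul c1).neg

lemma lap_radCut_pow (R : ℝ) (n : ℕ) (c z : ℂ) :
    lap (fun z => radCut R (Complex.normSq (z - c)) ^ (n + 4)) z =
      4 * (n + 4) / R ^ 2 * radCut R (Complex.normSq (z - c)) ^ (n + 2) *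
        ((n + 3) * Complex.normSq (z - c) / R ^ 2 - radCut R (Complex.normSq (z - c))) := by
  have h1 : ∀ s : ℝ, 0 ≤ s → HasDerivAt (fun s => radCut R s ^ (n + 4))
      (-(((n + 2 : ℕ) + 2) / R ^ 2 * radCut R s ^ (n + 3))) s :=
    fun s _ => hasDerivAt_radCut_pow R (n + 2) s
  have h2 : ∀ s : ℝ, 0 ≤ s →
      HasDerivAt (fun s => -(((n + 2 : ℕ) + 2) / R ^ 2 * radCut R s ^ (n + 3)))
      (-(((n + 2 : ℕ) + 2) / R ^ 2 * -(((n + 1 : ℕ) + 2) / R ^ 2 * radCut R s ^ (n + 2)))) s :=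
    fun s _ => ((hasDerivAt_radCut_pow R (n + 1) s).const_mul _).neg
  rw [lap_radial h1 h2 c z]
  push_cast
  ring

/-- All points of the plane are good as soon as one of them is. -/
lemma GoodPoint.forall {D : Set ℂ} {r : ℂ → ℝ} {z₀ : ℂ} (hz₀ : GoodPoint D r z₀) (z₁ : ℂ) :
    GoodPoint D r z₁ := by
  obtain ⟨c, ρ₀, N, C, L₀, hc, hρ₀, hN, hL₀, hL₀D, H⟩ := hz₀
  set R := dist z₁ z₀ + 2 with hRdef
  have hR : 0 < R := by positivity
  obtain ⟨n, hn⟩ := exists_nat_gt (R ^ 2 / ρ₀ ^ 2)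
  have hn' : R ^ 2 < n * ρ₀ ^ 2 := (div_lt_iff₀ (by positivity)).1 hn
  set η : ℂ → ℝ := fun z => radCut R (Complex.normSq (z - z₀)) ^ (n + 4) with hη
  have hηd : ContDiff ℝ 2 η := (contDiff_radCut_pow R n).comp (contDiff_normSq_sub z₀)
  have hη0 : ∀ z, 0 ≤ η z := fun z => pow_nonneg (radCut_nonneg _ _) _
  have hη1 : ∀ z, η z ≤ 1 := fun z =>
    pow_le_one₀ (radCut_nonneg _ _) (radCut_le_one _ (Complex.normSq_nonneg _))
  set A := 4 * ((n:ℝ) + 4) / R ^ 2 with hA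
  have hA0 : 0 < A := by positivity
  have hlow : ∀ z, -A ≤ lap η z := by
    intro z
    rw [hη, lap_radCut_pow]
    have h0 := radCut_nonneg R (Complex.normSq (z - z₀))
    have h1 := radCut_le_one R (Complex.normSq_nonneg (z - z₀))
    have h2 := pow_le_one₀ (n := n + 2) h0 h1
    have h3 := pow_nonneg h0 (n + 2)
    have h4 : 0 ≤ (n + 3) * Complex.normSq (z - z₀) / R ^ 2 := by
      have := Complex.normSq_nonneg (z - z₀)
      positivity
    set q := radCut R (Complex.normSq (z - z₀)) ^ (n + 2)
    have h5 : -1 ≤ q * ((n + 3) * Complex.normSq (z - z₀) / R ^ 2 -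
      radCut R (Complex.normSq (z - z₀))) := by nlinarith
    rw [mul_assoc]
    nlinarith
  have hout : ∀ z, z ∉ ball z₀ ρ₀ →
      A * radCut R (Complex.normSq (z - z₀)) ^ (n + 2) * (3 * ρ₀ ^ 2 / R ^ 2) ≤ lap η z := by
    intro z hz
    have hs := (le_normSq_sub_iff hρ₀ (c := z₀) (z := z)).2 (not_lt.1 hz)
    rw [hη, lap_radCut_pow]
    have h0 := radCut_nonneg R (Complex.normSq (z - z₀))
    have h1 := radCut_le_one R (Complex.normSq_nonneg (z - z₀))
    refine mul_le_mul_of_nonneg_left ?_ (by positivity)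
    have h2 : (n + 3) * ρ₀ ^ 2 / R ^ 2 ≤ (n + 3) * Complex.normSq (z - z₀) / R ^ 2 := by gcongr
    have h3 : 1 ≤ n * ρ₀ ^ 2 / R ^ 2 := by rw [one_le_div (by positivity)]; exact hn'.le
    have h4 : (n + 3) * ρ₀ ^ 2 / R ^ 2 = n * ρ₀ ^ 2 / R ^ 2 + 3 * ρ₀ ^ 2 / R ^ 2 := by ring
    linarith
  set t := c / (2 * A) with ht
  have ht0 : 0 < t := by positivity
  have htA : t * A = c / 2 := by rw [ht]; field_simp
  have hRpos : 0 < radCut R ((R - 1) ^ 2) := radCut_pos hR (by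
    have : 0 ≤ dist z₁ z₀ := dist_nonneg
    nlinarith)
  set c₁ := t * (A * radCut R ((R - 1) ^ 2) ^ (n + 2) * (3 * ρ₀ ^ 2 / R ^ 2)) with hc₁
  have hc₁0 : 0 < c₁ := by positivity
  refine ⟨min (c / 2) c₁, 1, N, C + t, L₀, by positivity, one_pos, hN, hL₀, hL₀D,
    fun L hL hLc hLD a ha => ?_⟩
  filter_upwards [H L hL hLc hLD a ha] with k ⟨ψ, hψd, hψ0, hψl, hψu, hψc⟩
  have hlap : ∀ z, lap (fun x => ψ x + t * η x) z = lap ψ z + t * lap η z := fun z => by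
    rw [lap_add hψd (contDiff_const.mul hηd), lap_const_mul]
  have hin : ∀ z ∈ L, z ∈ ball z₀ ρ₀ → c / 2 ≤ lap (fun x => ψ x + t * η x) z := by
    intro z hz hzb
    rw [hlap]
    have h1 := hψc z hz hzb
    have h2 := mul_le_mul_of_nonneg_left (hlow z) ht0.le
    linarith
  refine ⟨fun x => ψ x + t * η x, hψd.add (contDiff_const.mul hηd), fun z hz => ?_,
    fun z hz => ?_, fun z hz => ?_, fun z hz hzb => ?_⟩
  · by_cases hzb : z ∈ ball z₀ ρ₀
    · exact (by positivity : 0 ≤ c / 2).trans (hin z hz hzb)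
    · rw [hlap]
      have h1 : 0 ≤ lap η z := le_trans (by
        have := radCut_nonneg R (Complex.normSq (z - z₀))
        positivity) (hout z hzb)
      have := hψ0 z hz
      positivity
  · have := hψl z hz
    have := mul_nonneg ht0.le (hη0 z)
    linarith
  · have := hψu z hz
    have := mul_le_mul_of_nonneg_left (hη1 z) ht0.le
    linarith
  · by_cases hzb' : z ∈ ball z₀ ρ₀
    · exact (min_le_left _ _).trans (hin z hz hzb')
    · refine (min_le_right _ _).trans ?_
      rw [hlap]
      have h1 := hψ0 z hz
      have h2 := mul_le_mul_of_nonneg_left (hout z hzb') ht0.le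
      refine le_trans ?_ (h2.trans (le_add_of_nonneg_left h1))
      rw [hc₁]
      have h3 : radCut R ((R - 1) ^ 2) ≤ radCut R (Complex.normSq (z - z₀)) := by
        refine radCut_anti R ?_
        rw [Complex.normSq_eq_norm_sq, ← dist_eq_norm]
        have : dist z z₀ ≤ R - 1 := by
          rw [mem_ball] at hzb
          linarith [dist_triangle z z₁ z₀]
        gcongr
      gcongr

/-! ### The weighted a priori inequality -/

lemma DifferentiableAt.hasDerivAt_line {f : ℂ → ℝ} {z : ℂ} (hf : DifferentiableAt ℝ f z) (v : ℂ) :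
    HasDerivAt (fun t : ℝ => f (z + t • v)) (fderiv ℝ f z v) 0 := by
  have h1 : HasDerivAt (fun t : ℝ => z + t • v) v 0 := by
    simpa using ((hasDerivAt_id (0:ℝ)).smul_const v).const_add z
  have h2 : HasFDerivAt f (fderiv ℝ f z) (z + (0:ℝ) • v) := by simpa using hf.hasFDerivAt
  exact h2.comp_hasDerivAt 0 h1

/-- One component of the flux in the weighted integral identity. -/
noncomputable def flux (w Φ p q pt qt Φt wt : ℂ → ℝ) (z : ℂ) : ℝ :=
  Real.exp (Φ z) * (w z * (2 * (p z * qt z - q z * pt z) + Φt z * (p z * p z + q z * q z)) -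
    (p z * p z + q z * q z) * wt z)

lemma fderiv_flux {w Φ p q pt qt Φt wt : ℂ → ℝ} {z : ℂ} (hw : DifferentiableAt ℝ w z)
    (hΦ : DifferentiableAt ℝ Φ z) (hp : DifferentiableAt ℝ p z) (hq : DifferentiableAt ℝ q z)
    (hpt : DifferentiableAt ℝ pt z) (hqt : DifferentiableAt ℝ qt z)
    (hΦt : DifferentiableAt ℝ Φt z) (hwt : DifferentiableAt ℝ wt z) (v : ℂ) :
    fderiv ℝ (flux w Φ p q pt qt Φt wt) z v =
      Real.exp (Φ z) * (fderiv ℝ Φ z v * (w z * (2 * (p z * qt z - q z * pt z) +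
        Φt z * (p z * p z + q z * q z)) - (p z * p z + q z * q z) * wt z) +
      (fderiv ℝ w z v * (2 * (p z * qt z - q z * pt z) + Φt z * (p z * p z + q z * q z)) +
        w z * (2 * (fderiv ℝ p z v * qt z + p z * fderiv ℝ qt z v -
          (fderiv ℝ q z v * pt z + q z * fderiv ℝ pt z v)) +
          (fderiv ℝ Φt z v * (p z * p z + q z * q z) +
            Φt z * (2 * (p z * fderiv ℝ p z v + q z * fderiv ℝ q z v)))) -
        (2 * (p z * fderiv ℝ p z v + q z * fderiv ℝ q z v) * wt z +
          (p z * p z + q z * q z) * fderiv ℝ wt z v))) := by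
  have hX : DifferentiableAt ℝ (flux w Φ p q pt qt Φt wt) z := by
    unfold flux; fun_prop
  refine (hX.hasDerivAt_line v).unique ?_
  have w' := hw.hasDerivAt_line v
  have p' := hp.hasDerivAt_line v
  have q' := hq.hasDerivAt_line v
  have N' := (p'.fun_mul p').fun_add (q'.fun_mul q')
  have U := (w'.fun_mul (((p'.fun_mul (hqt.hasDerivAt_line v)).fun_sub
    (q'.fun_mul (hpt.hasDerivAt_line v))).const_mul 2 |>.fun_add
      ((hΦt.hasDerivAt_line v).fun_mul N'))).fun_sub (N'.fun_mul (hwt.hasDerivAt_line v))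
  have := (hΦ.hasDerivAt_line v).exp.fun_mul U
  refine this.congr_deriv ?_
  simp only [zero_smul, add_zero]
  ring

lemma divergence_flux {w Φ p q : ℂ → ℝ} (hw : ContDiff ℝ 2 w) (hΦ : ContDiff ℝ 2 Φ)
    (hp : ContDiff ℝ 2 p) (hq : ContDiff ℝ 2 q) (z : ℂ) :
    dX (flux w Φ p q (dY p) (dY q) (dX Φ) (dX w)) z +
      dY (flux w Φ q p (dX q) (dX p) (dY Φ) (dY w)) z =
    Real.exp (Φ z) * ((w z * lap Φ z - lap w z) * (p z ^ 2 + q z ^ 2) +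
      w z * ((dX p z + dY q z + dX Φ z * p z + dY Φ z * q z) ^ 2 +
        (dX q z - dY p z + dX Φ z * q z - dY Φ z * p z) ^ 2) -
      w z * ((dX p z - dY q z) ^ 2 + (dX q z + dY p z) ^ 2) -
      2 * ((dX p z - dY q z) * (dX w z * p z - dY w z * q z) +
        (dX q z + dY p z) * (dX w z * q z + dY w z * p z))) := by
  have d : ∀ {f : ℂ → ℝ}, ContDiff ℝ 2 f → DifferentiableAt ℝ f z ∧
      DifferentiableAt ℝ (dX f) z ∧ DifferentiableAt ℝ (dY f) z := fun hf =>
    ⟨hf.differentiable (by norm_num) z,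
      (hf.dX (n := 2) (m := 1) (by norm_num)).differentiable (by norm_num) z,
      (hf.dY (n := 2) (m := 1) (by norm_num)).differentiable (by norm_num) z⟩
  obtain ⟨w0, w1, w2⟩ := d hw
  obtain ⟨f0, f1, f2⟩ := d hΦ
  obtain ⟨p0, p1, p2⟩ := d hp
  obtain ⟨q0, q1, q2⟩ := d hq
  have e1 := fderiv_flux w0 f0 p0 q0 p2 q2 f1 w1 1
  have e2 := fderiv_flux w0 f0 q0 p0 q1 p1 f2 w2 Complex.I
  have cp := dX_dY_comm hp z
  have cq := dX_dY_comm hq z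
  simp only [← dX.eq_def, ← dY.eq_def] at e1 e2
  rw [e1, e2, cp, cq]
  simp only [lap]
  ring

/-- The weighted a priori inequality for the Cauchy-Riemann operator with a regularized
logarithmic factor. -/
lemma integral_negKer_le {L : Set ℂ} {p q Φ : ℂ → ℝ} {z₀ : ℂ} {R δ : ℝ} (hR : 0 < R) (hδ : 0 < δ)
    (hp : ContDiff ℝ 2 p) (hq : ContDiff ℝ 2 q) (hΦ : ContDiff ℝ 2 Φ) (hpc : HasCompactSupport p)
    (hqc : HasCompactSupport q) (hpL : ∀ z ∉ L, p z = 0) (hqL : ∀ z ∉ L, q z = 0)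
    (h0 : ∀ z ∈ L, 0 ≤ lap Φ z)
    (h1 : ∀ z ∈ L, z ∈ ball z₀ R → 16 / R ^ 2 + 1 ≤ lap Φ z) :
    4 * ∫ z, negKer R δ (Complex.normSq (z - z₀)) * ((p z ^ 2 + q z ^ 2) * Real.exp (Φ z)) ≤
      ∫ z, (1 + logKer R δ (Complex.normSq (z - z₀)) +
        (dX (fun z => logKer R δ (Complex.normSq (z - z₀))) z ^ 2 +
          dY (fun z => logKer R δ (Complex.normSq (z - z₀))) z ^ 2)) *
        (((dX p z - dY q z) ^ 2 + (dX q z + dY p z) ^ 2) * Real.exp (Φ z)) := by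
  set Θ : ℂ → ℝ := fun z => logKer R δ (Complex.normSq (z - z₀)) with hΘ
  have hΘd : ContDiff ℝ 2 Θ := contDiff_logKer hR hδ z₀
  set w : ℂ → ℝ := fun z => 1 + Θ z with hw
  have hwd : ContDiff ℝ 2 w := contDiff_const.add hΘd
  have wx : ∀ z, dX w z = dX Θ z := fun z => by
    rw [hw, dX_add (by fun_prop) (hΘd.differentiable (by norm_num) z), dX_const, zero_add]
  have wy : ∀ z, dY w z = dY Θ z := fun z => by
    rw [hw, dY_add (by fun_prop) (hΘd.differentiable (by norm_num) z), dY_const, zero_add]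
  have wl : ∀ z, lap w z = 4 * (posKer R δ (Complex.normSq (z - z₀)) -
      negKer R δ (Complex.normSq (z - z₀))) := fun z => by
    rw [hw, lap_add contDiff_const hΘd, lap_const, zero_add, hΘ, lap_logKer hR hδ]
  have hΘ0 : ∀ z, 0 ≤ Θ z := fun z => logKer_nonneg hR (Complex.normSq_nonneg _)
  have cd1 : ∀ {f : ℂ → ℝ}, ContDiff ℝ 2 f → ContDiff ℝ 1 f ∧ ContDiff ℝ 1 (dX f) ∧
      ContDiff ℝ 1 (dY f) := fun hf => ⟨hf.of_le (by norm_num),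
      hf.dX (n := 2) (m := 1) (by norm_num), hf.dY (n := 2) (m := 1) (by norm_num)⟩
  obtain ⟨w0, w1, w2⟩ := cd1 hwd
  obtain ⟨t0, t1, t2⟩ := cd1 hΘd
  obtain ⟨f0, f1, f2⟩ := cd1 hΦ
  obtain ⟨p0, p1, p2⟩ := cd1 hp
  obtain ⟨q0, q1, q2⟩ := cd1 hq
  have hXd : ContDiff ℝ 1 (flux w Φ p q (dY p) (dY q) (dX Φ) (dX w)) := by
    unfold flux; fun_prop
  have hYd : ContDiff ℝ 1 (flux w Φ q p (dX q) (dX p) (dY Φ) (dY w)) := by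
    unfold flux; fun_prop
  set K := tsupport p ∪ tsupport q with hK
  have hKc : IsCompact K := IsCompact.union hpc hqc
  have pK : ∀ z ∉ K, p z = 0 := fun z hz => image_eq_zero_of_notMem_tsupport fun h => hz (Or.inl h)
  have qK : ∀ z ∉ K, q z = 0 := fun z hz => image_eq_zero_of_notMem_tsupport fun h => hz (Or.inr h)
  have hXc : HasCompactSupport (flux w Φ p q (dY p) (dY q) (dX Φ) (dX w)) :=
    HasCompactSupport.intro hKc fun z hz => by simp [flux, pK z hz, qK z hz]
  have hYc : HasCompactSupport (flux w Φ q p (dX q) (dX p) (dY Φ) (dY w)) :=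
    HasCompactSupport.intro hKc fun z hz => by simp [flux, pK z hz, qK z hz]
  have hdK : ∀ z ∉ K, dX p z = 0 ∧ dY p z = 0 ∧ dX q z = 0 ∧ dY q z = 0 := by
    intro z hz
    have hp' : fderiv ℝ p z = 0 := by
      by_contra h
      exact hz (Or.inl (support_fderiv_subset ℝ h))
    have hq' : fderiv ℝ q z = 0 := by
      by_contra h
      exact hz (Or.inr (support_fderiv_subset ℝ h))
    simp [dX, dY, hp', hq']
  have cN : Continuous fun z => negKer R δ (Complex.normSq (z - z₀)) :=
    (continuous_negKer (R := R) hδ).comp (continuous_id.sub continuous_const)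
  have c0 := w0.continuous
  have c1 := t0.continuous
  have c2 := t1.continuous
  have c3 := t2.continuous
  have c4 := f0.continuous
  have c5 := p0.continuous
  have c6 := p1.continuous
  have c7 := p2.continuous
  have c8 := q0.continuous
  have c9 := q1.continuous
  have c10 := q2.continuous
  have iL : Integrable fun z => 4 * (negKer R δ (Complex.normSq (z - z₀)) *
      ((p z ^ 2 + q z ^ 2) * Real.exp (Φ z))) := by
    refine Continuous.integrable_of_hasCompactSupport (by fun_prop)
      (HasCompactSupport.intro hKc fun z hz => ?_)
    simp [pK z hz, qK z hz]
  have iR : Integrable fun z => (1 + Θ z + (dX Θ z ^ 2 + dY Θ z ^ 2)) *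
      (((dX p z - dY q z) ^ 2 + (dX q z + dY p z) ^ 2) * Real.exp (Φ z)) := by
    refine Continuous.integrable_of_hasCompactSupport (by fun_prop)
      (HasCompactSupport.intro hKc fun z hz => ?_)
    obtain ⟨e1, e2, e3, e4⟩ := hdK z hz
    simp [e1, e2, e3, e4]
  have iX := (hXd.dX (n := 1) (m := 0) (by norm_num)).continuous.integrable_of_hasCompactSupport
    hXc.dX (μ := volume)
  have iY := (hYd.dY (n := 1) (m := 0) (by norm_num)).continuous.integrable_of_hasCompactSupport
    hYc.dY (μ := volume)
  have zero : ∫ z, (dX (flux w Φ p q (dY p) (dY q) (dX Φ) (dX w)) z +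
      dY (flux w Φ q p (dX q) (dX p) (dY Φ) (dY w)) z) = 0 := by
    rw [integral_add iX iY, integral_dX_eq_zero hXd hXc, integral_dY_eq_zero hYd hYc, add_zero]
  have iXY : Integrable fun z => dX (flux w Φ p q (dY p) (dY q) (dX Φ) (dX w)) z +
      dY (flux w Φ q p (dX q) (dX p) (dY Φ) (dY w)) z := iX.add iY
  have iD : Integrable fun z => (1 + Θ z + (dX Θ z ^ 2 + dY Θ z ^ 2)) *
      (((dX p z - dY q z) ^ 2 + (dX q z + dY p z) ^ 2) * Real.exp (Φ z)) -
      4 * (negKer R δ (Complex.normSq (z - z₀)) * ((p z ^ 2 + q z ^ 2) * Real.exp (Φ z))) :=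
    iR.sub iL
  suffices key : 0 ≤ ∫ z, (((1 + Θ z + (dX Θ z ^ 2 + dY Θ z ^ 2)) *
      (((dX p z - dY q z) ^ 2 + (dX q z + dY p z) ^ 2) * Real.exp (Φ z)) -
      4 * (negKer R δ (Complex.normSq (z - z₀)) * ((p z ^ 2 + q z ^ 2) * Real.exp (Φ z)))) +
      (dX (flux w Φ p q (dY p) (dY q) (dX Φ) (dX w)) z +
      dY (flux w Φ q p (dX q) (dX p) (dY Φ) (dY w)) z)) by
    rw [integral_add iD iXY, zero, add_zero, integral_sub iR iL] at key
    rw [← integral_const_mul]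
    linarith
  refine integral_nonneg fun z => ?_
  show 0 ≤ _
  rw [divergence_flux hwd hΦ hp hq z]
  set c₁ := dX p z - dY q z
  set c₂ := dX q z + dY p z
  set A := (dX p z + dY q z + dX Φ z * p z + dY Φ z * q z) ^ 2 +
        (dX q z - dY p z + dX Φ z * q z - dY Φ z * p z) ^ 2
  have hA : 0 ≤ A := by positivity
  rw [wx, wy, wl]
  have hE := (Real.exp_pos (Φ z)).le
  have hwz : w z = 1 + Θ z := rfl
  have hT := hΘ0 z
  set M := negKer R δ (Complex.normSq (z - z₀))
  suffices hs : 0 ≤ (w z * lap Φ z - 4 * (posKer R δ (Complex.normSq (z - z₀)) - M) - 4 * M) *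
      (p z ^ 2 + q z ^ 2) + (dX Θ z ^ 2 + dY Θ z ^ 2) * (c₁ ^ 2 + c₂ ^ 2) -
      2 * (c₁ * (dX Θ z * p z - dY Θ z * q z) + c₂ * (dX Θ z * q z + dY Θ z * p z)) by
    have h2 : 0 ≤ w z * A := mul_nonneg (by rw [hwz]; linarith) hA
    have h3 := mul_nonneg hE (add_nonneg hs h2)
    rw [hwz] at h3 ⊢
    linarith
  by_cases hzL : z ∈ L
  · by_cases hzb : z ∈ ball z₀ R
    · have h2 := h1 z hzL hzb
      have h3 := h0 z hzL
      have h4 : posKer R δ (Complex.normSq (z - z₀)) ≤ 4 / R ^ 2 :=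
        (posKer_le _ _ (Complex.normSq_nonneg _)).trans (radBump_le _ (Complex.normSq_nonneg _))
      have h5 : 1 ≤ w z * lap Φ z - 4 * (posKer R δ (Complex.normSq (z - z₀)) - M) - 4 * M := by
        rw [hwz]
        have := mul_nonneg hT h3
        have : 16 / R ^ 2 = 4 * (4 / R ^ 2) := by ring
        linarith
      have h6 : 0 ≤ p z ^ 2 + q z ^ 2 := by positivity
      have h7 := mul_le_mul_of_nonneg_right h5 h6
      have h8 := add_nonneg (sq_nonneg (p z - (c₁ * dX Θ z + c₂ * dY Θ z)))
        (sq_nonneg (q z - (c₂ * dX Θ z - c₁ * dY Θ z)))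
      linarith
    · have hs := (le_normSq_sub_iff hR (c := z₀) (z := z)).2 (not_lt.1 hzb)
      have e1 : dX Θ z = 0 := by rw [hΘ, dX_logKer hR hδ, radTail_eq_zero hR hs]; simp
      have e2 : dY Θ z = 0 := by rw [hΘ, dY_logKer hR hδ, radTail_eq_zero hR hs]; simp
      rw [e1, e2, posKer_eq_zero hR hs]
      have h3 := mul_nonneg (by rw [hwz]; linarith : 0 ≤ w z) (h0 z hzL)
      have h4 := mul_nonneg h3 (by positivity : 0 ≤ p z ^ 2 + q z ^ 2)
      linarith
  · rw [hpL z hzL, hqL z hzL]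
    have : 0 ≤ (dX Θ z ^ 2 + dY Θ z ^ 2) * (c₁ ^ 2 + c₂ ^ 2) := by positivity
    linarith

/-! ### The a priori estimate with a singular weight -/

/-- A radial profile that is strongly superharmonic only near the origin. -/
noncomputable def logWeight (β s : ℝ) : ℝ := Real.log (s + β) - Real.log β + 3 - 3 * β / (s + β)

lemma hasDerivAt_logWeight {β s : ℝ} (h : 0 < s + β) :
    HasDerivAt (logWeight β) (1 / (s + β) + 3 * β / (s + β) ^ 2) s := by
  have h1 : HasDerivAt (fun s : ℝ => s + β) 1 s := (hasDerivAt_id s).add_const β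
  have h2 := (((h1.log h.ne').sub_const (Real.log β)).add_const 3).sub
    ((hasDerivAt_const s (3 * β)).div h1 h.ne')
  refine h2.congr_deriv ?_
  field_simp
  ring

lemma hasDerivAt_logWeight_deriv {β s : ℝ} (h : 0 < s + β) :
    HasDerivAt (fun s => 1 / (s + β) + 3 * β / (s + β) ^ 2)
      (-1 / (s + β) ^ 2 - 6 * β / (s + β) ^ 3) s := by
  have h1 : HasDerivAt (fun s : ℝ => s + β) 1 s := (hasDerivAt_id s).add_const β
  have h2 := ((hasDerivAt_const s (1:ℝ)).fun_div h1 h.ne').fun_add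
    ((hasDerivAt_const s (3 * β)).fun_div (h1.fun_pow 2) (by positivity))
  refine h2.congr_deriv ?_
  field_simp
  ring

lemma logWeight_zero {β : ℝ} (hβ : 0 < β) : logWeight β 0 = 0 := by
  simp [logWeight, hβ.ne']

lemma exp_neg_logWeight_le {β s : ℝ} (hβ : 0 < β) (hs : 0 ≤ s) :
    Real.exp (-logWeight β s) ≤ β / (s + β) := by
  have h : 0 < s + β := by linarith
  have h1 : Real.log β - Real.log (s + β) = Real.log (β / (s + β)) := by
    rw [Real.log_div hβ.ne' h.ne']
  have h2 : 3 * β / (s + β) ≤ 3 := by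
    rw [div_le_iff₀ h]; linarith
  rw [← Real.exp_log (by positivity : 0 < β / (s + β)), ← h1]
  apply Real.exp_le_exp.2
  unfold logWeight
  linarith

lemma contDiff_logWeight {β : ℝ} (hβ : 0 < β) (c : ℂ) :
    ContDiff ℝ 2 fun z => logWeight β (Complex.normSq (z - c)) := by
  have h : ∀ z, Complex.normSq (z - c) + β ≠ 0 := fun z => by
    have := Complex.normSq_nonneg (z - c); positivity
  have h1 : ContDiff ℝ 2 fun z => Complex.normSq (z - c) := contDiff_normSq_sub c
  unfold logWeight
  exact ((((h1.add contDiff_const).log h).sub contDiff_const).add contDiff_const).sub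
    (contDiff_const.div (h1.add contDiff_const) h)

lemma lap_logWeight {β : ℝ} (hβ : 0 < β) (c z : ℂ) :
    lap (fun z => logWeight β (Complex.normSq (z - c))) z =
      4 * ((4 * β ^ 2 - 2 * β * Complex.normSq (z - c)) / (Complex.normSq (z - c) + β) ^ 3) := by
  rw [lap_radial (fun s hs => hasDerivAt_logWeight (by linarith))
    (fun s hs => hasDerivAt_logWeight_deriv (by linarith))]
  have := Complex.normSq_nonneg (z - c)
  have h : Complex.normSq (z - c) + β ≠ 0 := by positivity
  field_simp
  ring

lemma lap_logWeight_le {β : ℝ} (hβ : 0 < β) (c z : ℂ) :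
    lap (fun z => logWeight β (Complex.normSq (z - c))) z ≤ 16 / β := by
  rw [lap_logWeight hβ]
  have := Complex.normSq_nonneg (z - c)
  set s := Complex.normSq (z - c)
  have h1 : (4 * β ^ 2 - 2 * β * s) / (s + β) ^ 3 ≤ 4 * β ^ 2 / β ^ 3 := by
    gcongr
    · have : 0 ≤ 2 * β * s := by positivity
      linarith
    · linarith
  have : 4 * β ^ 2 / β ^ 3 = 4 / β := by field_simp
  rw [this] at h1
  have : 16 / β = 4 * (4 / β) := by ring
  linarith

lemma lap_logWeight_nonpos {β : ℝ} (hβ : 0 < β) {c z : ℂ} (h : 2 * β ≤ Complex.normSq (z - c)) :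
    lap (fun z => logWeight β (Complex.normSq (z - c))) z ≤ 0 := by
  rw [lap_logWeight hβ]
  have := Complex.normSq_nonneg (z - c)
  set s := Complex.normSq (z - c)
  have h1 : 4 * β ^ 2 - 2 * β * s ≤ 0 := by nlinarith
  have := div_nonpos_of_nonpos_of_nonneg h1 (by positivity : 0 ≤ (s + β) ^ 3)
  linarith

lemma weight_mul_exp_le {R δ : ℝ} (hR : 0 < R) (hδ : 0 < δ) {c z : ℂ} (hz : z ≠ c) :
    (1 + logKer R δ (Complex.normSq (z - c)) +
        (dX (fun z => logKer R δ (Complex.normSq (z - c))) z ^ 2 +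
          dY (fun z => logKer R δ (Complex.normSq (z - c))) z ^ 2)) *
      Real.exp (-logWeight (R ^ 2 / 2) (Complex.normSq (z - c))) ≤
      (3 * R ^ 2 + 4) / Complex.normSq (z - c) := by
  have hs : 0 < Complex.normSq (z - c) := Complex.normSq_pos.2 (sub_ne_zero.2 hz)
  have hg := grad_logKer_sq_le hR hδ c z
  set g := dX (fun z => logKer R δ (Complex.normSq (z - c))) z ^ 2 +
          dY (fun z => logKer R δ (Complex.normSq (z - c))) z ^ 2
  have hg0 : 0 ≤ g := by positivity
  set s := Complex.normSq (z - c)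
  have he := exp_neg_logWeight_le (by positivity : 0 < R ^ 2 / 2) hs.le
  set E := Real.exp (-logWeight (R ^ 2 / 2) s)
  have hE1 : E ≤ 1 := he.trans (by rw [div_le_one (by positivity)]; linarith)
  have hE2 : E ≤ R ^ 2 / s := he.trans (by
    rw [div_le_div_iff₀ (by positivity) hs]
    have : 0 ≤ R ^ 2 * s := by positivity
    nlinarith [sq_nonneg (R ^ 2)])
  have hE0 : 0 ≤ E := (Real.exp_pos _).le
  have hl0 : 0 ≤ logKer R δ s := logKer_nonneg hR hs.le
  have hl : logKer R δ s ≤ 2 * R ^ 2 / s := by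
    by_cases hsR : s < R ^ 2
    · refine (logKer_le hR hs).trans ?_
      have h1 : Real.sqrt s ≤ R := Real.sqrt_le_iff.2 ⟨hR.le, hsR.le⟩
      have h2 : 0 < Real.sqrt s := Real.sqrt_pos.2 hs
      rw [div_le_div_iff₀ h2 hs]
      nth_rewrite 1 [← Real.mul_self_sqrt hs.le]
      nlinarith [mul_le_mul_of_nonneg_left h1 (by positivity : 0 ≤ R * Real.sqrt s)]
    · rw [logKer_eq_zero hR (not_lt.1 hsR)]
      positivity
  have h3 : logKer R δ s * E ≤ 2 * R ^ 2 / s := by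
    nlinarith [mul_le_mul_of_nonneg_left hE1 hl0]
  have h4 : g * E ≤ 4 / s := by
    nlinarith [mul_le_mul_of_nonneg_left hE1 hg0]
  have : (3 * R ^ 2 + 4) / s = R ^ 2 / s + 2 * R ^ 2 / s + 4 / s := by ring
  rw [this]
  linarith

/-- The Cauchy-Riemann operator (twice the Wirtinger derivative). -/
noncomputable def dbar (b : ℂ → ℂ) (z : ℂ) : ℂ :=
  fderiv ℝ b z 1 + Complex.I * fderiv ℝ b z Complex.I

lemma dX_re {b : ℂ → ℂ} {z : ℂ} (hb : DifferentiableAt ℝ b z) :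
    dX (fun z => (b z).re) z = (fderiv ℝ b z 1).re ∧
      dY (fun z => (b z).re) z = (fderiv ℝ b z Complex.I).re := by
  have := (Complex.reCLM.hasFDerivAt.comp z hb.hasFDerivAt).fderiv
  have e : (Complex.reCLM ∘ b) = fun z => (b z).re := rfl
  rw [e] at this
  simp [dX, dY, this]

lemma dX_im {b : ℂ → ℂ} {z : ℂ} (hb : DifferentiableAt ℝ b z) :
    dX (fun z => (b z).im) z = (fderiv ℝ b z 1).im ∧
      dY (fun z => (b z).im) z = (fderiv ℝ b z Complex.I).im := by
  have := (Complex.imCLM.hasFDerivAt.comp z hb.hasFDerivAt).fderiv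
  have e : (Complex.imCLM ∘ b) = fun z => (b z).im := rfl
  rw [e] at this
  simp [dX, dY, this]

lemma norm_dbar_sq {b : ℂ → ℂ} {z : ℂ} (hb : DifferentiableAt ℝ b z) :
    ‖dbar b z‖ ^ 2 = (dX (fun z => (b z).re) z - dY (fun z => (b z).im) z) ^ 2 +
      (dX (fun z => (b z).im) z + dY (fun z => (b z).re) z) ^ 2 := by
  rw [(dX_re hb).1, (dX_re hb).2, (dX_im hb).1, (dX_im hb).2, Complex.sq_norm,
    Complex.normSq_apply, dbar]
  simp
  ring

lemma norm_sq_re_im (w : ℂ) : ‖w‖ ^ 2 = w.re ^ 2 + w.im ^ 2 := by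
  rw [Complex.sq_norm, Complex.normSq_apply]; ring

lemma ContDiff.continuous_dbar {b : ℂ → ℂ} (hb : ContDiff ℝ 2 b) : Continuous (dbar b) := by
  have : Continuous (fderiv ℝ b) := hb.continuous_fderiv (by norm_num)
  unfold dbar
  fun_prop

lemma dbar_eq_zero_of_notMem_tsupport {b : ℂ → ℂ} {z : ℂ} (hz : z ∉ tsupport b) :
    dbar b z = 0 := by
  have : fderiv ℝ b z = 0 := by
    by_contra h
    exact hz (support_fderiv_subset ℝ h)
  simp [dbar, this]

lemma integrable_dbar_sq_div_mul {b : ℂ → ℂ} {z₀ : ℂ} {A B : ℝ} {g : ℂ → ℝ} (hb : ContDiff ℝ 2 b)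
    (hbc : HasCompactSupport b) (hA : ∀ z, ‖dbar b z‖ ≤ A * ‖z - z₀‖) (hg : Measurable g)
    (hgB : ∀ z ∈ tsupport b, ‖g z‖ ≤ B) :
    Integrable fun z => ‖dbar b z‖ ^ 2 / Complex.normSq (z - z₀) * g z := by
  have hm : Measurable fun z => ‖dbar b z‖ ^ 2 / Complex.normSq (z - z₀) * g z :=
    ((hb.continuous_dbar.norm.pow 2).measurable.div
      (Complex.continuous_normSq.comp (continuous_id.sub continuous_const)).measurable).mul hg
  have hi : Integrable ((tsupport b).indicator fun _ => A ^ 2 * B) :=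
    (integrable_indicator_iff hbc.isCompact.measurableSet).2
      (integrableOn_const hbc.isCompact.measure_lt_top.ne)
  refine hi.mono' hm.aestronglyMeasurable (ae_of_all _ fun z => ?_)
  by_cases hz : z ∈ tsupport b
  · rw [indicator_of_mem hz, norm_mul]
    refine mul_le_mul ?_ (hgB z hz) (norm_nonneg _) (sq_nonneg A)
    rw [Real.norm_of_nonneg (div_nonneg (sq_nonneg _) (Complex.normSq_nonneg _)),
      ← Complex.sq_norm]
    refine div_le_of_le_mul₀ (sq_nonneg _) (sq_nonneg _) ?_
    rw [← mul_pow]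
    exact pow_le_pow_left₀ (norm_nonneg _) (hA z) 2
  · rw [indicator_of_notMem hz, dbar_eq_zero_of_notMem_tsupport hz]
    simp

/-- The a priori inequality for a weight with positive Laplacian near the base point. -/
lemma norm_sq_mul_exp_le {L : Set ℂ} {b : ℂ → ℂ} {φ : ℂ → ℝ} {z₀ : ℂ} {R A : ℝ} (hR : 0 < R)
    (hb : ContDiff ℝ 2 b) (hbc : HasCompactSupport b) (hbL : tsupport b ⊆ L)
    (hA : ∀ z, ‖dbar b z‖ ≤ A * ‖z - z₀‖) (hφ : ContDiff ℝ 2 φ) (h0 : ∀ z ∈ L, 0 ≤ lap φ z)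
    (h1 : ∀ z ∈ L, z ∈ ball z₀ R → 48 / R ^ 2 + 1 ≤ lap φ z) :
    4 * (kerMass * (‖b z₀‖ ^ 2 * Real.exp (φ z₀))) ≤
      (3 * R ^ 2 + 4) * ∫ z, ‖dbar b z‖ ^ 2 / Complex.normSq (z - z₀) * Real.exp (φ z) := by
  have hβ : 0 < R ^ 2 / 2 := by positivity
  set Λ : ℂ → ℝ := fun z => logWeight (R ^ 2 / 2) (Complex.normSq (z - z₀)) with hΛ
  have hΛd : ContDiff ℝ 2 Λ := contDiff_logWeight hβ z₀
  set Φ : ℂ → ℝ := fun z => φ z + (-1) * Λ z with hΦ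
  have hΦd : ContDiff ℝ 2 Φ := hφ.add (contDiff_const.mul hΛd)
  have hΦl : ∀ z, lap Φ z = lap φ z - lap Λ z := fun z => by
    rw [hΦ, lap_add hφ (contDiff_const.mul hΛd), lap_const_mul]; ring
  have hpd : ContDiff ℝ 2 fun z => (b z).re := Complex.reCLM.contDiff.comp hb
  have hqd : ContDiff ℝ 2 fun z => (b z).im := Complex.imCLM.contDiff.comp hb
  have hbz : ∀ z ∉ L, b z = 0 := fun z hz => image_eq_zero_of_notMem_tsupport fun h => hz (hbL h)
  have hint := integrable_dbar_sq_div_mul hb hbc hA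
    (Real.continuous_exp.comp hφ.continuous).measurable
    (B := _) (fun z hz => ((hbc.isCompact.exists_bound_of_continuousOn
      (Real.continuous_exp.comp hφ.continuous).continuousOn).choose_spec z hz))
  have key : ∀ δ : ℝ, 0 < δ →
      4 * ∫ z, negKer R δ (Complex.normSq (z - z₀)) * (‖b z‖ ^ 2 * Real.exp (Φ z)) ≤
      (3 * R ^ 2 + 4) * ∫ z, ‖dbar b z‖ ^ 2 / Complex.normSq (z - z₀) * Real.exp (φ z) := by
    intro δ hδ
    have h := integral_negKer_le (L := L) hR hδ hpd hqd hΦd (hbc.comp_left (g := Complex.re) rfl)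
      (hbc.comp_left (g := Complex.im) rfl) (fun z hz => by simp [hbz z hz])
      (fun z hz => by simp [hbz z hz]) (z₀ := z₀) ?_ ?_
    · simp only [← norm_sq_re_im, ← norm_dbar_sq (hb.differentiable (by norm_num) _)] at h
      refine h.trans ?_
      rw [← integral_const_mul]
      refine integral_mono_of_nonneg (ae_of_all _ fun z => ?_) (hint.const_mul _)
        (ae_of_all _ fun z => ?_)
      · have := logKer_nonneg (δ := δ) hR (Complex.normSq_nonneg (z - z₀))
        simp only [Pi.zero_apply]
        positivity
      · by_cases hz : z = z₀
        · have : ‖dbar b z‖ = 0 := le_antisymm (by simpa [hz] using hA z₀) (norm_nonneg _)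
          simp [this]
        · have := mul_le_mul_of_nonneg_right (weight_mul_exp_le hR hδ hz)
            (by positivity : 0 ≤ ‖dbar b z‖ ^ 2 * Real.exp (φ z))
          have e : Real.exp (Φ z) = Real.exp (-Λ z) * Real.exp (φ z) := by
            rw [← Real.exp_add, hΦ]; congr 1; ring
          beta_reduce
          rw [e]
          refine le_trans (le_of_eq ?_) (this.trans (le_of_eq ?_)) <;> ring
    · intro z hz
      rw [hΦl]
      by_cases hzb : z ∈ ball z₀ R
      · have := h1 z hz hzb
        have h2 := lap_logWeight_le hβ z₀ z
        have e : 16 / (R ^ 2 / 2) = 32 / R ^ 2 := by field_simp; norm_num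
        have : 0 < 16 / R ^ 2 := by positivity
        have : 48 / R ^ 2 = 32 / R ^ 2 + 16 / R ^ 2 := by ring
        linarith
      · have := (le_normSq_sub_iff hR (c := z₀) (z := z)).2 (not_lt.1 hzb)
        have := lap_logWeight_nonpos hβ (c := z₀) (z := z) (by linarith)
        linarith [h0 z hz]
    · intro z hz hzb
      rw [hΦl]
      have := h1 z hz hzb
      have h2 := lap_logWeight_le hβ z₀ z
      have e : 16 / (R ^ 2 / 2) = 32 / R ^ 2 := by field_simp; norm_num
      have : 48 / R ^ 2 = 32 / R ^ 2 + 16 / R ^ 2 := by ring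
      linarith
  have hc : Continuous fun z => ‖b z‖ ^ 2 * Real.exp (Φ z) :=
    (hb.continuous.norm.pow 2).mul (Real.continuous_exp.comp hΦd.continuous)
  have hcs : HasCompactSupport fun z => ‖b z‖ ^ 2 * Real.exp (Φ z) :=
    HasCompactSupport.intro hbc.isCompact fun z hz => by
      simp [image_eq_zero_of_notMem_tsupport hz]
  obtain ⟨B, hB⟩ := hcs.exists_bound_of_continuous hc
  have lim := tendsto_integral_negKer (R := R) (F := fun y => ‖b (z₀ + y)‖ ^ 2 * Real.exp (Φ (z₀ + y)))
    (hc.comp (continuous_const.add continuous_id)).measurable (fun y => hB (z₀ + y))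
    (hc.comp (continuous_const.add continuous_id)).continuousAt
  have lim2 := lim.const_mul 4
  have e0 : Φ (z₀ + 0) = φ z₀ := by simp [hΦ, hΛ, logWeight_zero hβ]
  rw [e0, add_zero] at lim2
  refine le_of_tendsto lim2 (eventually_nhdsWithin_of_forall fun δ hδ => ?_)
  have := key δ hδ
  rwa [integral_sub_right_mul_normSq (negKer R δ) (fun z => ‖b z‖ ^ 2 * Real.exp (Φ z)) z₀] at this

/-- The a priori estimate for the Cauchy-Riemann operator on `D` with singular weight. -/
lemma SubharmonicWeight.exists_apriori {D : Set ℂ} {r : ℂ → ℝ} {z₀ : ℂ} (h : SubharmonicWeight D r)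
    (hz₀ : z₀ ∈ D) (hg : GoodPoint D r z₀) :
    ∃ C : ℝ, ∃ N : ℕ, 0 ≤ C ∧ 1 ≤ N ∧ ∀ j : ℕ, ∀ b : ℂ → ℂ, ContDiff ℝ 2 b → HasCompactSupport b →
      tsupport b ⊆ D → (∃ A : ℝ, ∀ z, ‖dbar b z‖ ≤ A * ‖z - z₀‖) →
      ‖b z₀‖ ^ 2 * Real.exp (2 * j * r z₀) ≤
        C * ∫ z, ‖dbar b z‖ ^ 2 / Complex.normSq (z - z₀) * Real.exp (2 * (j + N) * r z) := by
  obtain ⟨c, R, N, C, L₀, hc, hR, hN, hL₀, hL₀D, hgood⟩ := hg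
  set m : ℝ := (48 / R ^ 2 + 1) / c with hm
  have hm0 : 0 ≤ m := by positivity
  obtain ⟨N₀, hN₀⟩ := exists_nat_ge (m * N + 1)
  have hN1 : (1:ℝ) ≤ N₀ := by nlinarith [mul_nonneg hm0 hN]
  have hkm := kerMass_pos
  refine ⟨(3 * R ^ 2 + 4) * Real.exp (2 * m * C) / (4 * kerMass), N₀, by positivity,
    by exact_mod_cast hN1, ?_⟩
  intro j b hb hbc hbD ⟨A, hA⟩
  set L : Set ℂ := L₀ ∪ ({z₀} ∪ tsupport b) with hLdef
  have hL : IsCompact L := hL₀.union (isCompact_singleton.union hbc.isCompact)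
  have hLD : L ⊆ D := union_subset hL₀D (union_subset (singleton_subset_iff.2 hz₀) hbD)
  have hz₀L : z₀ ∈ L := Or.inr (Or.inl rfl)
  have hbL : tsupport b ⊆ L := fun z hz => Or.inr (Or.inr hz)
  obtain ⟨a, ha⟩ := h.exists_approxSeq hL hLD
  obtain ⟨B, hB0, -, hB⟩ := h.exists_bound_approxSeq hL hLD
  have evB := hB L subset_rfl a ha
  have evψ := hgood L subset_union_left hL hLD a ha
  set K : ℝ := 2 * (j + N₀) with hK
  have hK0 : 0 ≤ K := by positivity
  have step : ∀ᶠ n in atTop, 4 * kerMass * (‖b z₀‖ ^ 2 * Real.exp (2 * j * r z₀)) ≤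
      (3 * R ^ 2 + 4) * Real.exp (2 * m * C) *
        ∫ z, ‖dbar b z‖ ^ 2 / Complex.normSq (z - z₀) * Real.exp (K * a n z) := by
    filter_upwards [evψ] with n ⟨ψ, hψ, hψ0, hψ1, hψ2, hψ3⟩
    have had : ContDiff ℝ 2 (a n) := (ha.contDiff n).of_le (by norm_num)
    set φ : ℂ → ℝ := fun z => 2 * j * a n z + m * ψ z with hφ
    have hφd : ContDiff ℝ 2 φ := (contDiff_const.mul had).add (contDiff_const.mul hψ)
    have hφl : ∀ z, lap φ z = 2 * j * lap (a n) z + m * lap ψ z := fun z => by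
      rw [hφ, lap_add (contDiff_const.mul had) (contDiff_const.mul hψ), lap_const_mul,
        lap_const_mul]
    have key := norm_sq_mul_exp_le hR hb hbc hbL hA hφd
      (fun z hz => by
        rw [hφl]
        have := ha.lap_nonneg n z hz
        have := hψ0 z hz
        positivity)
      (fun z hz hzb => by
        rw [hφl]
        have := mul_nonneg (by positivity : (0:ℝ) ≤ 2 * j) (ha.lap_nonneg n z hz)
        have h2 := mul_le_mul_of_nonneg_left (hψ3 z hz hzb) hm0
        have : m * c = 48 / R ^ 2 + 1 := by rw [hm]; field_simp
        linarith)
    have l1 : Real.exp (2 * j * r z₀) * Real.exp (-(m * C)) ≤ Real.exp (φ z₀) := by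
      rw [← Real.exp_add]
      apply Real.exp_le_exp.2
      have h1 := mul_le_mul_of_nonneg_left (ha.le n z₀ hz₀L) (by positivity : (0:ℝ) ≤ 2 * j)
      have h2 := mul_le_mul_of_nonneg_left (hψ1 z₀ hz₀L) hm0
      simp only [hφ]
      linarith
    have l2 : ∫ z, ‖dbar b z‖ ^ 2 / Complex.normSq (z - z₀) * Real.exp (φ z) ≤
        Real.exp (m * C) *
          ∫ z, ‖dbar b z‖ ^ 2 / Complex.normSq (z - z₀) * Real.exp (K * a n z) := by
      have cK : Continuous fun z => Real.exp (K * a n z) :=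
        Real.continuous_exp.comp (continuous_const.mul had.continuous)
      rw [← integral_const_mul]
      refine integral_mono_of_nonneg (ae_of_all _ fun z => ?_)
        ((integrable_dbar_sq_div_mul hb hbc hA cK.measurable (fun z hz =>
          ((hbc.isCompact.exists_bound_of_continuousOn cK.continuousOn).choose_spec z
            hz))).const_mul _) (ae_of_all _ fun z => ?_)
      · have := Complex.normSq_nonneg (z - z₀)
        simp only [Pi.zero_apply]
        positivity
      · have h0 : 0 ≤ ‖dbar b z‖ ^ 2 / Complex.normSq (z - z₀) :=
          div_nonneg (sq_nonneg _) (Complex.normSq_nonneg _)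
        by_cases hz : z ∈ L
        · have h1 : Real.exp (φ z) ≤ Real.exp (m * C) * Real.exp (K * a n z) := by
            rw [← Real.exp_add]
            apply Real.exp_le_exp.2
            have h2 := mul_le_mul_of_nonneg_left (hψ2 z hz) hm0
            have h3 : 0 ≤ a n z := (h.nonneg z).trans (ha.le n z hz)
            have h4 := mul_le_mul_of_nonneg_right hN₀ h3
            have h5 := mul_nonneg (by positivity : (0:ℝ) ≤ N₀) h3
            simp only [hφ, hK]
            nlinarith
          calc _ ≤ ‖dbar b z‖ ^ 2 / Complex.normSq (z - z₀) *
                (Real.exp (m * C) * Real.exp (K * a n z)) := mul_le_mul_of_nonneg_left h1 h0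
            _ = _ := by ring
        · have : dbar b z = 0 := dbar_eq_zero_of_notMem_tsupport fun h => hz (hbL h)
          simp [this]
    have l3 : Real.exp (2 * j * r z₀) ≤ Real.exp (m * C) * Real.exp (φ z₀) := by
      have := mul_le_mul_of_nonneg_left l1 (Real.exp_pos (m * C)).le
      rwa [mul_comm (Real.exp (2 * j * r z₀)), ← mul_assoc, ← Real.exp_add, add_neg_cancel,
        Real.exp_zero, one_mul] at this
    have e : Real.exp (2 * m * C) = Real.exp (m * C) * Real.exp (m * C) := by
      rw [← Real.exp_add]; ring_nf
    rw [e]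
    calc 4 * kerMass * (‖b z₀‖ ^ 2 * Real.exp (2 * j * r z₀))
        ≤ 4 * kerMass * (‖b z₀‖ ^ 2 * (Real.exp (m * C) * Real.exp (φ z₀))) := by gcongr
      _ = Real.exp (m * C) * (4 * (kerMass * (‖b z₀‖ ^ 2 * Real.exp (φ z₀)))) := by ring
      _ ≤ Real.exp (m * C) * ((3 * R ^ 2 + 4) * (Real.exp (m * C) *
          ∫ z, ‖dbar b z‖ ^ 2 / Complex.normSq (z - z₀) * Real.exp (K * a n z))) := by
        exact mul_le_mul_of_nonneg_left
          (key.trans (mul_le_mul_of_nonneg_left l2 (by positivity))) (Real.exp_pos _).le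
      _ = _ := by ring
  have lim : Tendsto (fun n => ∫ z, ‖dbar b z‖ ^ 2 / Complex.normSq (z - z₀) *
      Real.exp (K * a n z)) atTop (nhds (∫ z, ‖dbar b z‖ ^ 2 / Complex.normSq (z - z₀) *
      Real.exp (K * r z))) := by
    refine tendsto_integral_filter_of_dominated_convergence
      ((tsupport b).indicator fun _ => A ^ 2 * Real.exp (K * B))
      (Eventually.of_forall fun n => ?_) ?_ ?_ (ae_of_all _ fun z => ?_)
    · have := (ha.contDiff n).continuous
      have := hb.continuous_dbar
      exact ((this.norm.pow 2).measurable.div (Complex.continuous_normSq.comp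
        (continuous_id.sub continuous_const)).measurable).mul
        (Real.continuous_exp.comp (by fun_prop)).measurable |>.aestronglyMeasurable
    · filter_upwards [evB] with n hn
      refine ae_of_all _ fun z => ?_
      by_cases hz : z ∈ tsupport b
      · rw [indicator_of_mem hz, norm_mul, Real.norm_of_nonneg (Real.exp_pos _).le,
          Real.norm_of_nonneg (div_nonneg (sq_nonneg _) (Complex.normSq_nonneg _)),
          ← Complex.sq_norm]
        refine mul_le_mul ?_ (Real.exp_le_exp.2 (mul_le_mul_of_nonneg_left (hn z (hbL hz)) hK0))
          (Real.exp_pos _).le (sq_nonneg A)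
        refine div_le_of_le_mul₀ (sq_nonneg _) (sq_nonneg _) ?_
        rw [← mul_pow]
        exact pow_le_pow_left₀ (norm_nonneg _) (hA z) 2
      · rw [indicator_of_notMem hz, dbar_eq_zero_of_notMem_tsupport hz]
        simp
    · exact (integrable_indicator_iff hbc.isCompact.measurableSet).2
        (integrableOn_const hbc.isCompact.measure_lt_top.ne)
    · by_cases hz : z ∈ tsupport b
      · have := ha.tendsto h hLD (hbL hz)
        exact ((Real.continuous_exp.tendsto _).comp (this.const_mul K)).const_mul _
      · simp [dbar_eq_zero_of_notMem_tsupport hz]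
  have := ge_of_tendsto (lim.const_mul ((3 * R ^ 2 + 4) * Real.exp (2 * m * C))) step
  rw [div_mul_eq_mul_div, le_div_iff₀ (by positivity)]
  linarith

/-! ### Duality -/

/-- A functional dominated by a linear map into a Hilbert space is represented by a vector. -/
lemma exists_inner_eq_of_norm_le {E H : Type*} [AddCommGroup E] [Module ℂ E]
    [NormedAddCommGroup H] [InnerProductSpace ℂ H] [CompleteSpace H] (T : E →ₗ[ℂ] H)
    (l : E →ₗ[ℂ] ℂ) {c : ℝ} (hc : 0 ≤ c) (hb : ∀ v, ‖l v‖ ≤ c * ‖T v‖) :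
    ∃ h : H, ‖h‖ ≤ c ∧ ∀ v, inner ℂ h (T v) = l v := by
  have hker : T.ker ≤ l.ker := fun v hv => by
    rw [LinearMap.mem_ker] at hv ⊢
    have := hb v
    rw [hv, norm_zero, mul_zero] at this
    exact norm_le_zero_iff.1 this
  set g₀ : T.range →ₗ[ℂ] ℂ := (T.ker.liftQ l hker).comp T.quotKerEquivRange.symm.toLinearMap
  have hg₀ : ∀ v, g₀ ⟨T v, LinearMap.mem_range_self T v⟩ = l v := fun v => by
    have : T.quotKerEquivRange.symm ⟨T v, LinearMap.mem_range_self T v⟩ = T.ker.mkQ v :=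
      T.quotKerEquivRange_symm_apply_image v _
    simp [g₀, this]
  set g := g₀.mkContinuous c (by
    rintro ⟨-, v, rfl⟩
    rw [hg₀]
    exact hb v)
  obtain ⟨G, hG, hGn⟩ := exists_extension_norm_eq T.range g
  refine ⟨(InnerProductSpace.toDual ℂ H).symm G, ?_, fun v => ?_⟩
  · rw [LinearIsometryEquiv.norm_map, hGn]
    exact LinearMap.mkContinuous_norm_le _ hc _
  · rw [InnerProductSpace.toDual_symm_apply, hG ⟨T v, LinearMap.mem_range_self T v⟩]
    exact hg₀ v

lemma norm_sq_eq_integral_norm_sq (g : Lp ℂ 2 (volume : Measure ℂ)) :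
    ‖g‖ ^ 2 = ∫ z, ‖g z‖ ^ 2 := by
  have h := L2.inner_def (𝕜 := ℂ) g g
  simp only [inner_self_eq_norm_sq_to_K] at h
  have h2 : (∫ z, ((‖g z‖ : ℂ)) ^ 2) = ((∫ z, ‖g z‖ ^ 2 : ℝ) : ℂ) := by
    rw [← integral_complex_ofReal]
    simp
  exact Complex.ofReal_injective (by rw [Complex.ofReal_pow]; exact h.trans h2)

section dbar

variable {f g : ℂ → ℂ} {z : ℂ}

lemma dbar_add (hf : DifferentiableAt ℝ f z) (hg : DifferentiableAt ℝ g z) :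
    dbar (f + g) z = dbar f z + dbar g z := by
  simp only [dbar, fderiv_add hf hg, add_apply]
  ring

lemma dbar_const_smul (c : ℂ) (hf : DifferentiableAt ℝ f z) : dbar (c • f) z = c * dbar f z := by
  simp only [dbar, fderiv_const_smul hf c, smul_apply, smul_eq_mul]
  ring

lemma dbar_mul (hf : DifferentiableAt ℝ f z) (hg : DifferentiableAt ℝ g z) :
    dbar (fun z => f z * g z) z = f z * dbar g z + g z * dbar f z := by
  simp only [dbar, fderiv_fun_mul hf hg, add_apply,
    smul_apply, smul_eq_mul]
  ring

lemma dbar_eq_zero_iff (hf : DifferentiableAt ℝ f z) :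
    dbar f z = 0 ↔ DifferentiableAt ℂ f z := by
  rw [differentiableAt_complex_iff_differentiableAt_real]
  refine ⟨fun h => ⟨hf, ?_⟩, fun ⟨_, h⟩ => ?_⟩
  · rw [dbar] at h
    rw [smul_eq_mul]
    linear_combination (-Complex.I) * h + fderiv ℝ f z Complex.I * Complex.I_mul_I
  · rw [dbar, h, smul_eq_mul, ← mul_assoc, Complex.I_mul_I]
    ring

end dbar

/-- Test functions on `D` whose Cauchy-Riemann derivative vanishes at `z₀`. -/
def testSpace (D : Set ℂ) (z₀ : ℂ) : Submodule ℂ (ℂ → ℂ) where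
  carrier := {b | ContDiff ℝ 2 b ∧ HasCompactSupport b ∧ tsupport b ⊆ D ∧
    ∃ A : ℝ, ∀ z, ‖dbar b z‖ ≤ A * ‖z - z₀‖}
  add_mem' := by
    rintro f g ⟨f1, f2, f3, A, f4⟩ ⟨g1, g2, g3, B, g4⟩
    refine ⟨f1.add g1, f2.add g2, (tsupport_add f g).trans (union_subset f3 g3), A + B,
      fun z => ?_⟩
    rw [dbar_add (f1.differentiable (by norm_num) z) (g1.differentiable (by norm_num) z), add_mul]
    exact (norm_add_le _ _).trans (add_le_add (f4 z) (g4 z))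
  zero_mem' := by
    refine ⟨contDiff_const, HasCompactSupport.zero, ?_, 0, fun z => ?_⟩
    · simp [tsupport]
    · simp [dbar]
  smul_mem' := by
    rintro c f ⟨f1, f2, f3, A, f4⟩
    refine ⟨contDiff_const.smul f1, ?_, ?_, ‖c‖ * A, fun z => ?_⟩
    · exact HasCompactSupport.intro f2.isCompact fun z hz => by
        simp [image_eq_zero_of_notMem_tsupport hz]
    · refine (closure_minimal ?_ (isClosed_tsupport f)).trans f3
      intro z hz
      refine subset_tsupport f ?_
      intro h0
      exact hz (by simp [h0])
    · rw [dbar_const_smul c (f1.differentiable (by norm_num) z), norm_mul, mul_assoc]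
      exact mul_le_mul_of_nonneg_left (f4 z) (norm_nonneg c)

lemma exists_dual_density {D : Set ℂ} {z₀ : ℂ} {w : ℂ → ℝ} {c : ℝ} (hc : 0 ≤ c) (hw : Measurable w)
    (hwb : ∀ K, IsCompact K → K ⊆ D → ∃ B, ∀ z ∈ K, ‖w z‖ ≤ B)
    (hest : ∀ b ∈ testSpace D z₀, ‖b z₀‖ ^ 2 ≤
      c ^ 2 * ∫ z, ‖dbar b z‖ ^ 2 / Complex.normSq (z - z₀) * w z ^ 2) :
    ∃ h : ℂ → ℂ, Measurable h ∧ Integrable (fun z => ‖h z‖ ^ 2) ∧ ∫ z, ‖h z‖ ^ 2 ≤ c ^ 2 ∧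
      ∀ b ∈ testSpace D z₀, b z₀ = ∫ z, h z * (dbar b z * (w z / ‖z - z₀‖ : ℝ)) := by
  have hsq : ∀ (b : ℂ → ℂ) (z : ℂ), ‖dbar b z * (w z / ‖z - z₀‖ : ℝ)‖ ^ 2 =
      ‖dbar b z‖ ^ 2 / Complex.normSq (z - z₀) * w z ^ 2 := fun b z => by
    rw [norm_mul, Complex.norm_real, norm_div, norm_norm, ← Complex.sq_norm, mul_pow, div_pow,
      Real.norm_eq_abs, sq_abs]
    ring
  have hmem : ∀ b ∈ testSpace D z₀, MemLp (fun z => dbar b z * (w z / ‖z - z₀‖ : ℝ)) 2 := by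
    rintro b ⟨b1, b2, b3, A, b4⟩
    have hm : AEStronglyMeasurable (fun z => dbar b z * (w z / ‖z - z₀‖ : ℝ)) volume :=
      (b1.continuous_dbar.measurable.mul (Complex.measurable_ofReal.comp
        (hw.div (continuous_id.sub continuous_const).norm.measurable))).aestronglyMeasurable
    rw [memLp_two_iff_integrable_sq_norm hm]
    simp only [hsq]
    obtain ⟨B, hB⟩ := hwb _ b2.isCompact b3
    refine integrable_dbar_sq_div_mul b1 b2 b4 (hw.pow_const 2) (B := B ^ 2) fun z hz => ?_
    rw [norm_pow]
    exact pow_le_pow_left₀ (norm_nonneg _) (hB z hz) 2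
  set T : testSpace D z₀ →ₗ[ℂ] Lp ℂ 2 (volume : Measure ℂ) :=
    { toFun := fun b => (hmem b.1 b.2).toLp _
      map_add' := fun a b => by
        rw [← MemLp.toLp_add]
        congr 1
        funext z
        have e := dbar_add (a.2.1.differentiable (by norm_num) z)
          (b.2.1.differentiable (by norm_num) z)
        simp only [Submodule.coe_add, Pi.add_apply, e]
        ring
      map_smul' := fun c b => by
        rw [RingHom.id_apply, ← MemLp.toLp_const_smul]
        congr 1
        funext z
        have e := dbar_const_smul c (b.2.1.differentiable (by norm_num) z)
        simp only [Submodule.coe_smul, Pi.smul_apply, e, smul_eq_mul]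
        ring } with hT
  set l : testSpace D z₀ →ₗ[ℂ] ℂ := (LinearMap.proj z₀).comp (testSpace D z₀).subtype with hl
  have hTn : ∀ b, ‖T b‖ ^ 2 = ∫ z, ‖dbar b.1 z‖ ^ 2 / Complex.normSq (z - z₀) * w z ^ 2 := by
    intro b
    rw [norm_sq_eq_integral_norm_sq]
    refine integral_congr_ae ?_
    filter_upwards [(hmem b.1 b.2).coeFn_toLp] with z hz
    rw [← hsq, ← hz]
    rfl
  obtain ⟨h, hn, hh⟩ := exists_inner_eq_of_norm_le T l hc fun b => by
    have := hest b.1 b.2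
    rw [← hTn, ← mul_pow] at this
    exact le_of_sq_le_sq this (by positivity)
  have hhm : Measurable h := (Lp.stronglyMeasurable h).measurable
  refine ⟨fun z => star (h z), Complex.continuous_conj.measurable.comp hhm, ?_, ?_, fun b hb => ?_⟩
  · simp only [norm_star]
    exact (memLp_two_iff_integrable_sq_norm (Lp.memLp h).1).1 (Lp.memLp h)
  · simp only [norm_star]
    rw [← norm_sq_eq_integral_norm_sq]
    exact pow_le_pow_left₀ (norm_nonneg _) hn 2
  · have e := hh ⟨b, hb⟩
    rw [L2.inner_def] at e
    have e2 : l ⟨b, hb⟩ = b z₀ := rfl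
    rw [← e2, ← e]
    refine integral_congr_ae ?_
    filter_upwards [(hmem b hb).coeFn_toLp] with z hz
    have : T ⟨b, hb⟩ z = dbar b z * (w z / ‖z - z₀‖ : ℝ) := hz
    rw [this, RCLike.inner_apply, mul_comm]
    rfl

/-! ### Weyl's lemma for the Cauchy-Riemann operator -/

/-- A smooth bump on the line, supported in `[1/4, 1]`. -/
noncomputable def ringBump (t : ℝ) : ℝ := expNegInvGlue (t - 1 / 4) * expNegInvGlue (1 - t)

lemma contDiff_ringBump {n : ℕ∞} : ContDiff ℝ n ringBump :=
  (expNegInvGlue.contDiff.comp (contDiff_id.sub contDiff_const)).mul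
    (expNegInvGlue.contDiff.comp (contDiff_const.sub contDiff_id))

lemma continuous_ringBump : Continuous ringBump := (contDiff_ringBump (n := 1)).continuous

lemma ringBump_nonneg (t : ℝ) : 0 ≤ ringBump t :=
  mul_nonneg (expNegInvGlue.nonneg _) (expNegInvGlue.nonneg _)

lemma ringBump_eq_zero_of_le {t : ℝ} (h : t ≤ 1 / 4) : ringBump t = 0 := by
  rw [ringBump, expNegInvGlue.zero_of_nonpos (by linarith), zero_mul]

lemma ringBump_eq_zero_of_ge {t : ℝ} (h : 1 ≤ t) : ringBump t = 0 := by
  rw [ringBump, expNegInvGlue.zero_of_nonpos (x := 1 - t) (by linarith), mul_zero]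

lemma ringBump_pos {t : ℝ} (h1 : 1 / 4 < t) (h2 : t < 1) : 0 < ringBump t :=
  mul_pos (expNegInvGlue.pos_of_pos (by linarith)) (expNegInvGlue.pos_of_pos (by linarith))

/-- The primitive of `ringBump`. -/
noncomputable def ringPrim (t : ℝ) : ℝ := ∫ u in (0:ℝ)..t, ringBump u

lemma hasDerivAt_ringPrim (t : ℝ) : HasDerivAt ringPrim (ringBump t) t :=
  intervalIntegral.integral_hasDerivAt_right (continuous_ringBump.intervalIntegrable _ _)
    continuous_ringBump.stronglyMeasurable.stronglyMeasurableAtFilter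
    continuous_ringBump.continuousAt

lemma contDiff_ringPrim : ContDiff ℝ 2 ringPrim := by
  have hd : deriv ringPrim = ringBump := funext fun t => (hasDerivAt_ringPrim t).deriv
  rw [show (2 : WithTop ℕ∞) = 1 + 1 from one_add_one_eq_two.symm, contDiff_succ_iff_deriv]
  refine ⟨fun t => (hasDerivAt_ringPrim t).differentiableAt, by simp, ?_⟩
  rw [hd]
  exact contDiff_ringBump (n := 1)

lemma ringPrim_eq_zero {t : ℝ} (h : t ≤ 1 / 4) : ringPrim t = 0 := by
  rw [ringPrim, intervalIntegral.integral_congr (g := fun _ => 0)]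
  · simp
  · intro u hu
    exact ringBump_eq_zero_of_le (hu.2.trans (max_le (by norm_num) h))

lemma ringPrim_eq {t : ℝ} (h : 1 ≤ t) : ringPrim t = ringPrim 1 := by
  have e : ringPrim t = ringPrim 1 + ∫ u in (1:ℝ)..t, ringBump u :=
    (intervalIntegral.integral_add_adjacent_intervals
      (continuous_ringBump.intervalIntegrable _ _) (continuous_ringBump.intervalIntegrable _ _)).symm
  rw [e, intervalIntegral.integral_congr (g := fun _ => 0)]
  · simp
  · intro u hu
    rw [uIcc_of_le h] at hu
    exact ringBump_eq_zero_of_ge hu.1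

lemma ringPrim_one_pos : 0 < ringPrim 1 := by
  have e : ringPrim 1 = ringPrim (1 / 4) + ∫ u in (1 / 4 : ℝ)..1, ringBump u :=
    (intervalIntegral.integral_add_adjacent_intervals
      (continuous_ringBump.intervalIntegrable _ _) (continuous_ringBump.intervalIntegrable _ _)).symm
  rw [e, ringPrim_eq_zero le_rfl, zero_add]
  exact intervalIntegral.intervalIntegral_pos_of_pos_on (continuous_ringBump.intervalIntegrable _ _)
    (fun u hu => ringBump_pos hu.1 hu.2) (by norm_num)

lemma dbar_ofReal {u : ℂ → ℝ} {z : ℂ} (hu : DifferentiableAt ℝ u z) :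
    dbar (fun z => (u z : ℂ)) z = dX u z + Complex.I * dY u z := by
  have := (Complex.ofRealCLM.hasFDerivAt.comp z hu.hasFDerivAt).fderiv
  have e : (Complex.ofRealCLM ∘ u) = fun z => (u z : ℂ) := rfl
  rw [e] at this
  simp [dbar, dX, dY, this]

lemma dbar_radial {u : ℝ → ℝ} {u' : ℝ} {c z : ℂ} (hu : HasDerivAt u u' (Complex.normSq (z - c))) :
    dbar (fun z => (u (Complex.normSq (z - c)) : ℂ)) z = 2 * u' * (z - c) := by
  have h := (hasFDerivAt_normSq_sub c z).differentiableAt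
  have hd : DifferentiableAt ℝ (fun z => u (Complex.normSq (z - c))) z :=
    hu.differentiableAt.comp (f := fun z => Complex.normSq (z - c)) z h
  rw [dbar_ofReal hd, dX_comp h hu, dY_comp h hu, dX_normSq_sub, dY_normSq_sub]
  nth_rewrite 3 [← Complex.re_add_im (z - c)]
  push_cast
  ring

/-- A radial function times the Cauchy kernel. -/
noncomputable def cauchyRadial (u : ℝ → ℝ) (c z : ℂ) : ℂ :=
  u (Complex.normSq (z - c)) * (z - c)⁻¹

section cauchyRadial

variable {u : ℝ → ℝ} {c : ℂ} {ε R : ℝ}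

lemma cauchyRadial_eventuallyEq (hε : 0 < ε) (h0 : ∀ t ≤ ε, u t = 0) :
    cauchyRadial u c =ᶠ[nhds c] fun _ => 0 := by
  have : ∀ᶠ z in nhds c, Complex.normSq (z - c) < ε := by
    have hc : Continuous fun z => Complex.normSq (z - c) :=
      Complex.continuous_normSq.comp (continuous_id.sub continuous_const)
    refine hc.tendsto c |>.eventually (gt_mem_nhds ?_)
    simpa using hε
  filter_upwards [this] with z hz
  simp [cauchyRadial, h0 _ hz.le]

lemma contDiff_cauchyRadial (hu : ContDiff ℝ 2 u) (hε : 0 < ε) (h0 : ∀ t ≤ ε, u t = 0) :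
    ContDiff ℝ 2 (cauchyRadial u c) := by
  rw [contDiff_iff_contDiffAt]
  intro z
  by_cases hz : z = c
  · rw [hz]
    exact contDiffAt_const.congr_of_eventuallyEq (cauchyRadial_eventuallyEq hε h0)
  · have h1 : ContDiffAt ℝ 2 (fun z => (u (Complex.normSq (z - c)) : ℂ)) z :=
      (Complex.ofRealCLM.contDiff.comp (hu.comp (contDiff_normSq_sub c))).contDiffAt
    exact h1.mul ((contDiff_id.sub contDiff_const).contDiffAt.inv (sub_ne_zero.2 hz))

lemma dbar_cauchyRadial (hu : ContDiff ℝ 2 u) (hε : 0 < ε) (h0 : ∀ t ≤ ε, u t = 0) (z : ℂ) :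
    dbar (cauchyRadial u c) z = 2 * deriv u (Complex.normSq (z - c)) := by
  by_cases hz : z = c
  · have h1 : dbar (cauchyRadial u c) z = 0 := by
      rw [hz, dbar, (cauchyRadial_eventuallyEq hε h0).fderiv_eq]
      simp
    have h2 : deriv u (Complex.normSq (z - c)) = 0 := by
      have : u =ᶠ[nhds (Complex.normSq (z - c))] fun _ => 0 := by
        filter_upwards [Iio_mem_nhds (show Complex.normSq (z - c) < ε by simpa [hz] using hε)]
          with t ht using h0 t (le_of_lt ht)
      rw [this.deriv_eq]
      simp
    rw [h1, h2]
    simp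
  · have h3 : z - c ≠ 0 := sub_ne_zero.2 hz
    have hd : HasDerivAt u (deriv u (Complex.normSq (z - c))) (Complex.normSq (z - c)) :=
      (hu.differentiable (by norm_num) _).hasDerivAt
    have h1 : DifferentiableAt ℝ (fun z => (u (Complex.normSq (z - c)) : ℂ)) z :=
      (Complex.ofRealCLM.contDiff.comp (hu.comp (contDiff_normSq_sub c))).differentiable
        (by norm_num) z
    have h4 : DifferentiableAt ℂ (fun z : ℂ => (z - c)⁻¹) z :=
      (differentiableAt_id.sub_const c).inv h3
    have := dbar_mul h1 (h4.restrictScalars ℝ)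
    rw [(dbar_eq_zero_iff (h4.restrictScalars ℝ)).2 h4, dbar_radial hd] at this
    refine Eq.trans this ?_
    field_simp
    ring

lemma cauchyRadial_eq_zero (hR : 0 < R) (h1 : ∀ t, R ^ 2 ≤ t → u t = 0) {z : ℂ}
    (hz : z ∉ ball c R) : cauchyRadial u c z = 0 := by
  rw [cauchyRadial, h1 _ ((le_normSq_sub_iff hR).2 (not_lt.1 hz))]
  simp

end cauchyRadial

/-- `f` is annihilated by the Cauchy-Riemann operator on `D` in the weak sense. -/
def WeaklyHolomorphicOn (f : ℂ → ℂ) (D : Set ℂ) : Prop :=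
  ∀ b : ℂ → ℂ, ContDiff ℝ 2 b → HasCompactSupport b → tsupport b ⊆ D → ∫ z, f z * dbar b z = 0

/-- The average of `f` against a scaled radial bump. -/
noncomputable def ringMean (f : ℂ → ℂ) (R : ℝ) (z : ℂ) : ℂ :=
  ∫ x, f x * ((ringBump (Complex.normSq (x - z) / R ^ 2) / R ^ 2 : ℝ) : ℂ)

lemma ringBump_scaled_eq_zero {R : ℝ} (hR : 0 < R) {x z : ℂ} (h : x ∉ ball z R) :
    ringBump (Complex.normSq (x - z) / R ^ 2) = 0 :=
  ringBump_eq_zero_of_ge ((one_le_div (by positivity)).2 ((le_normSq_sub_iff hR).2 (not_lt.1 h)))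

lemma continuous_ringBump_scaled (R : ℝ) (z : ℂ) :
    Continuous fun x => ((ringBump (Complex.normSq (x - z) / R ^ 2) / R ^ 2 : ℝ) : ℂ) :=
  Complex.continuous_ofReal.comp ((continuous_ringBump.comp ((Complex.continuous_normSq.comp
    (continuous_id.sub continuous_const)).div_const _)).div_const _)

lemma integrable_ringMean {f : ℂ → ℂ} {R : ℝ} (hR : 0 < R) {z : ℂ}
    (hf : IntegrableOn f (closedBall z R)) :
    Integrable fun x => f x * ((ringBump (Complex.normSq (x - z) / R ^ 2) / R ^ 2 : ℝ) : ℂ) := by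
  have h1 : IntegrableOn (fun x => f x * ((ringBump (Complex.normSq (x - z) / R ^ 2) / R ^ 2 : ℝ) : ℂ))
      (closedBall z R) :=
    hf.mul_continuousOn (continuous_ringBump_scaled R z).continuousOn (isCompact_closedBall z R)
  refine (integrableOn_iff_integrable_of_support_subset fun x hx => ?_).1 h1
  by_contra h
  refine hx ?_
  have := ringBump_scaled_eq_zero hR (fun hb => h (ball_subset_closedBall hb))
  simp [this]

lemma ringMean_eq {f : ℂ → ℂ} {D : Set ℂ} (hf : WeaklyHolomorphicOn f D) {z : ℂ} {R R' : ℝ}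
    (hR : 0 < R) (hR' : 0 < R') (hD : closedBall z (max R R') ⊆ D)
    (hi : IntegrableOn f (closedBall z (max R R'))) : ringMean f R z = ringMean f R' z := by
  set u : ℝ → ℝ := fun t => ringPrim (t / R ^ 2) - ringPrim (t / R' ^ 2) with hu
  have hud : ContDiff ℝ 2 u := (contDiff_ringPrim.comp (contDiff_id.div_const _)).sub
    (contDiff_ringPrim.comp (contDiff_id.div_const _))
  have hu' : ∀ t, deriv u t = ringBump (t / R ^ 2) / R ^ 2 - ringBump (t / R' ^ 2) / R' ^ 2 := by
    intro t
    have h : ∀ S : ℝ, HasDerivAt (fun t => ringPrim (t / S ^ 2)) (ringBump (t / S ^ 2) / S ^ 2) t :=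
      fun S => ((hasDerivAt_ringPrim _).comp t ((hasDerivAt_id t).div_const (S ^ 2))).congr_deriv
        (by simp; rfl)
    exact ((h R).sub (h R')).deriv
  set ε := min (R ^ 2) (R' ^ 2) / 4 with hε
  have hε0 : 0 < ε := by positivity
  have h0 : ∀ t ≤ ε, u t = 0 := by
    intro t ht
    have h1 : t / R ^ 2 ≤ 1 / 4 := by
      rw [div_le_iff₀ (by positivity)]
      have := min_le_left (R ^ 2) (R' ^ 2)
      linarith
    have h2 : t / R' ^ 2 ≤ 1 / 4 := by
      rw [div_le_iff₀ (by positivity)]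
      have := min_le_right (R ^ 2) (R' ^ 2)
      linarith
    simp only [hu]
    rw [ringPrim_eq_zero h1, ringPrim_eq_zero h2, sub_zero]
  have hM : 0 < max R R' := lt_max_of_lt_left hR
  have h1 : ∀ t, max R R' ^ 2 ≤ t → u t = 0 := by
    intro t ht
    have e1 : 1 ≤ t / R ^ 2 := (one_le_div (by positivity)).2
      ((pow_le_pow_left₀ hR.le (le_max_left R R') 2).trans ht)
    have e2 : 1 ≤ t / R' ^ 2 := (one_le_div (by positivity)).2
      ((pow_le_pow_left₀ hR'.le (le_max_right R R') 2).trans ht)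
    simp only [hu]
    rw [ringPrim_eq e1, ringPrim_eq e2, sub_self]
  have hsupp : Function.support (cauchyRadial u z) ⊆ closedBall z (max R R') := fun x hx => by
    by_contra h
    exact hx (cauchyRadial_eq_zero hM h1 fun hb => h (ball_subset_closedBall hb))
  have hts : tsupport (cauchyRadial u z) ⊆ closedBall z (max R R') :=
    closure_minimal hsupp isClosed_closedBall
  have key := hf (cauchyRadial u z) (contDiff_cauchyRadial hud hε0 h0)
    ((isCompact_closedBall z _).of_isClosed_subset (isClosed_tsupport _) hts) (hts.trans hD)
  have i1 := integrable_ringMean hR (hi.mono_set (closedBall_subset_closedBall (le_max_left R R')))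
  have i2 := integrable_ringMean hR' (hi.mono_set (closedBall_subset_closedBall (le_max_right R R')))
  have e : ∀ x, f x * dbar (cauchyRadial u z) x =
      2 * (f x * ((ringBump (Complex.normSq (x - z) / R ^ 2) / R ^ 2 : ℝ) : ℂ) -
        f x * ((ringBump (Complex.normSq (x - z) / R' ^ 2) / R' ^ 2 : ℝ) : ℂ)) := fun x => by
    rw [dbar_cauchyRadial hud hε0 h0, hu']
    push_cast
    ring
  simp only [e] at key
  rw [integral_const_mul, integral_sub i1 i2] at key
  have := (mul_eq_zero.1 key).resolve_left two_ne_zero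
  exact sub_eq_zero.1 this

/-- The total mass of the radial bump. -/
noncomputable def ringMass : ℝ := ∫ y : ℂ, ringBump (Complex.normSq y)

lemma ringMass_pos : 0 < ringMass := by
  have hc : Continuous fun y : ℂ => ringBump (Complex.normSq y) :=
    continuous_ringBump.comp Complex.continuous_normSq
  refine hc.integral_pos_of_hasCompactSupport_nonneg_nonzero ?_ (fun y => ringBump_nonneg _)
    (x := ((3 / 4 : ℝ) : ℂ)) ?_
  · refine HasCompactSupport.intro (isCompact_closedBall (0:ℂ) 1) fun y hy => ?_
    have h := ringBump_scaled_eq_zero (one_pos) (x := y) (z := 0)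
      fun hb => hy (ball_subset_closedBall hb)
    simpa using h
  · refine (ringBump_pos ?_ ?_).ne' <;> rw [Complex.normSq_ofReal] <;> norm_num

lemma integral_ringBump_scaled {R : ℝ} (hR : 0 < R) (z : ℂ) :
    ∫ x, ringBump (Complex.normSq (x - z) / R ^ 2) / R ^ 2 = ringMass := by
  rw [integral_sub_right_eq_self (fun x => ringBump (Complex.normSq x / R ^ 2) / R ^ 2) z]
  have h := Measure.integral_comp_inv_smul_of_nonneg (volume : Measure ℂ)
    (fun y => ringBump (Complex.normSq y)) hR.le
  rw [Complex.finrank_real_complex] at h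
  have e : ∀ x : ℂ, Complex.normSq (R⁻¹ • x) = Complex.normSq x / R ^ 2 := fun x => by
    rw [Complex.real_smul, map_mul, Complex.normSq_ofReal]
    field_simp
  simp only [e] at h
  rw [integral_div, h, smul_eq_mul, mul_div_cancel_left₀ _ (by positivity)]
  rfl

lemma exists_ringBump_le : ∃ B, 0 < B ∧ ∀ t, ringBump t ≤ B := by
  refine ⟨1, one_pos, fun t => ?_⟩
  have h : ∀ s, expNegInvGlue s ≤ 1 := fun s => by
    unfold expNegInvGlue
    split_ifs with hs
    · exact zero_le_one
    · rw [Real.exp_le_one_iff, neg_nonpos, inv_nonneg]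
      exact (not_le.1 hs).le
  exact mul_le_one₀ (h _) (expNegInvGlue.nonneg _) (h _)

lemma ae_tendsto_ringMean {f : ℂ → ℂ} (hf : LocallyIntegrable f) :
    ∀ᵐ z, Tendsto (fun R => ringMean f R z) (nhdsWithin 0 (Ioi 0)) (nhds (ringMass * f z)) := by
  obtain ⟨B, hB0, hB⟩ := exists_ringBump_le
  filter_upwards [IsUnifLocDoublingMeasure.ae_tendsto_average_norm_sub volume hf 1] with z hz
  have h1 := hz (l := nhdsWithin (0:ℝ) (Ioi 0)) (fun _ => z) (fun R => R) tendsto_id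
    (eventually_nhdsWithin_of_forall fun R hR => by
      simpa using (le_of_lt hR : (0:ℝ) ≤ R))
  rw [tendsto_iff_norm_sub_tendsto_zero]
  have h2 := h1.const_mul (B * Real.pi)
  rw [mul_zero] at h2
  refine squeeze_zero' (Eventually.of_forall fun _ => norm_nonneg _)
    (eventually_nhdsWithin_of_forall fun R hR => ?_) h2
  have hR' : (0:ℝ) < R := hR
  have hi : ∀ g : ℂ → ℂ, LocallyIntegrable g → Integrable fun x =>
      g x * ((ringBump (Complex.normSq (x - z) / R ^ 2) / R ^ 2 : ℝ) : ℂ) := fun g hg =>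
    integrable_ringMean hR' (hg.integrableOn_isCompact (isCompact_closedBall z R))
  have i0 : LocallyIntegrable fun _ : ℂ => f z := locallyIntegrable_const _
  have e1 : ringMean f R z - ringMass * f z =
      ∫ x, (f x - f z) * ((ringBump (Complex.normSq (x - z) / R ^ 2) / R ^ 2 : ℝ) : ℂ) := by
    simp only [sub_mul]
    rw [integral_sub (hi f hf) (hi _ i0), integral_const_mul, integral_complex_ofReal,
      integral_ringBump_scaled hR', mul_comm (f z)]
    rfl
  have i1 : IntegrableOn (fun x => ‖f x - f z‖) (closedBall z R) :=
    ((hf.integrableOn_isCompact (isCompact_closedBall z R)).sub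
      (i0.integrableOn_isCompact (isCompact_closedBall z R))).norm
  have hv : volume.real (closedBall z R) = R ^ 2 * Real.pi := by
    rw [Measure.real, Complex.volume_closedBall]
    simp [hR'.le]
  rw [e1]
  calc ‖∫ x, (f x - f z) * ((ringBump (Complex.normSq (x - z) / R ^ 2) / R ^ 2 : ℝ) : ℂ)‖
      ≤ ∫ x, (closedBall z R).indicator (fun x => (B / R ^ 2) * ‖f x - f z‖) x := by
        refine norm_integral_le_of_norm_le ((integrable_indicator_iff
          isClosed_closedBall.measurableSet).2 (i1.const_mul _)) (ae_of_all _ fun x => ?_)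
        by_cases hx : x ∈ closedBall z R
        · rw [indicator_of_mem hx, norm_mul, Complex.norm_real, Real.norm_of_nonneg
            (div_nonneg (ringBump_nonneg _) (sq_nonneg _)), mul_comm]
          gcongr
          exact hB _
        · have := ringBump_scaled_eq_zero hR' (fun hb => hx (ball_subset_closedBall hb))
          simp [hx, this]
    _ = (B / R ^ 2) * ∫ x in closedBall z R, ‖f x - f z‖ := by
        rw [integral_indicator isClosed_closedBall.measurableSet, integral_const_mul]
    _ = B * Real.pi * ⨍ x in closedBall z R, ‖f x - f z‖ := by
        rw [setAverage_eq, hv, smul_eq_mul]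
        have := Real.pi_pos
        field_simp

lemma dbar_ringBump_scaled (R : ℝ) (c x : ℂ) :
    dbar (fun x => ((ringBump (Complex.normSq (x - c) / R ^ 2) / R ^ 2 : ℝ) : ℂ)) x =
      2 * (deriv (fun t => ringBump (t / R ^ 2) / R ^ 2) (Complex.normSq (x - c)) : ℝ) * (x - c) := by
  have hd : ContDiff ℝ 1 fun t => ringBump (t / R ^ 2) / R ^ 2 :=
    ((contDiff_ringBump (n := 1)).comp (contDiff_id.div_const _)).div_const _
  exact dbar_radial (u := fun t => ringBump (t / R ^ 2) / R ^ 2)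
    (hd.differentiable (by norm_num) _).hasDerivAt

lemma contDiff_ringBump_scaled (R : ℝ) (z : ℂ) :
    ContDiff ℝ 2 fun x => ((ringBump (Complex.normSq (x - z) / R ^ 2) / R ^ 2 : ℝ) : ℂ) :=
  Complex.ofRealCLM.contDiff.comp (((contDiff_ringBump (n := 2)).comp
    ((contDiff_normSq_sub z).div_const _)).div_const _)

lemma hasCompactSupport_ringBump_scaled {R : ℝ} (hR : 0 < R) (z : ℂ) :
    HasCompactSupport fun x => ((ringBump (Complex.normSq (x - z) / R ^ 2) / R ^ 2 : ℝ) : ℂ) :=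
  HasCompactSupport.intro (isCompact_closedBall z R) fun x hx => by
    have := ringBump_scaled_eq_zero hR (fun hb => hx (ball_subset_closedBall hb))
    simp [this]

lemma dbar_ringMean {f : ℂ → ℂ} (hf : Integrable f) {R : ℝ} (hR : 0 < R) (z : ℂ) :
    DifferentiableAt ℝ (ringMean f R) z ∧ dbar (ringMean f R) z =
      -∫ x, f x * dbar (fun x => ((ringBump (Complex.normSq (x - z) / R ^ 2) / R ^ 2 : ℝ) : ℂ)) x := by
  set k : ℂ → ℂ := fun x => ((ringBump (Complex.normSq (x - 0) / R ^ 2) / R ^ 2 : ℝ) : ℂ) with hk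
  have hkd : ContDiff ℝ 2 k := contDiff_ringBump_scaled R 0
  have hkc : HasCompactSupport k := hasCompactSupport_ringBump_scaled hR 0
  set M := ContinuousLinearMap.mul ℝ ℂ with hM
  have e : ringMean f R = convolution f k M volume := by
    funext z
    rw [convolution_def]
    refine integral_congr_ae (ae_of_all _ fun x => ?_)
    have : Complex.normSq (x - z) = Complex.normSq (z - x) := by
      rw [← Complex.normSq_neg, neg_sub]
    simp [hk, hM, this]
  have hd := hkc.hasFDerivAt_convolution_right M hf.locallyIntegrable
    (hkd.of_le (by norm_num)) z
  have hfd : Continuous (fderiv ℝ k) := hkd.continuous_fderiv (by norm_num)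
  have hconv : Integrable fun x => (M.precompR ℂ) (f x) (fderiv ℝ k (z - x)) :=
    (hkc.fderiv ℝ).convolutionExists_right (M.precompR ℂ) hf.locallyIntegrable hfd z
  have hv : ∀ v, fderiv ℝ (ringMean f R) z v = ∫ x, f x * fderiv ℝ k (z - x) v := by
    intro v
    rw [e, hd.fderiv, convolution_def, ContinuousLinearMap.integral_apply hconv]
    rfl
  have iv : ∀ v, Integrable fun x => f x * fderiv ℝ k (z - x) v := fun v => by
    have := hconv.apply_continuousLinearMap v
    exact this
  refine ⟨by rw [e]; exact hd.differentiableAt, ?_⟩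
  rw [dbar, hv, hv, ← integral_const_mul, ← integral_add (iv 1) ((iv Complex.I).const_mul _),
    ← integral_neg]
  refine integral_congr_ae (ae_of_all _ fun x => ?_)
  have h1 := dbar_ringBump_scaled R 0 (z - x)
  have h2 := dbar_ringBump_scaled R z x
  have h3 : Complex.normSq (z - x - 0) = Complex.normSq (x - z) := by
    rw [← Complex.normSq_neg]; congr 1; ring
  rw [h3] at h1
  have h4 : dbar k (z - x) = fderiv ℝ k (z - x) 1 + Complex.I * fderiv ℝ k (z - x) Complex.I := rfl
  beta_reduce
  rw [h2]
  have h5 : fderiv ℝ k (z - x) 1 + Complex.I * fderiv ℝ k (z - x) Complex.I =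
    2 * (deriv (fun t => ringBump (t / R ^ 2) / R ^ 2) (Complex.normSq (x - z)) : ℝ) * (z - x - 0) :=
    h4.symm.trans h1
  linear_combination f x * h5

/-- **Weyl's lemma**: a weakly holomorphic function agrees almost everywhere with a holomorphic
one, which is given by radial means. -/
lemma WeaklyHolomorphicOn.exists_holomorphic {f : ℂ → ℂ} {D : Set ℂ} (hD : IsOpen D)
    (hf : WeaklyHolomorphicOn f D) (hi : ∀ K, IsCompact K → K ⊆ D → IntegrableOn f K) :
    ∃ F : ℂ → ℂ, DifferentiableOn ℂ F D ∧ (∀ᵐ z, z ∈ D → f z = F z) ∧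
      ∀ z ∈ D, ∀ R, 0 < R → closedBall z R ⊆ D → ringMean f R z = ringMass * F z := by
  have hm : (ringMass : ℂ) ≠ 0 := Complex.ofReal_ne_zero.2 ringMass_pos.ne'
  have hex : ∀ z : ℂ, ∃ R : ℝ, 0 < R ∧ (z ∈ D → closedBall z R ⊆ D) := fun z => by
    by_cases hz : z ∈ D
    · obtain ⟨R, hR, h⟩ := Metric.nhds_basis_closedBall.mem_iff.1 (hD.mem_nhds hz)
      exact ⟨R, hR, fun _ => h⟩
    · exact ⟨1, one_pos, fun h => absurd h hz⟩
  choose S hS0 hSD using hex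
  set F : ℂ → ℂ := fun z => ringMean f (S z) z / ringMass with hF
  have hFR : ∀ z ∈ D, ∀ R, 0 < R → closedBall z R ⊆ D → ringMean f R z = ringMass * F z := by
    intro z hz R hR hRD
    rw [hF]
    simp only
    rw [mul_div_cancel₀ _ hm]
    have hsub : closedBall z (max R (S z)) ⊆ D := by
      rcases max_choice R (S z) with h | h <;> rw [h]
      · exact hRD
      · exact hSD z hz
    exact ringMean_eq hf hR (hS0 z) hsub (hi _ (isCompact_closedBall _ _) hsub)
  have loc : ∀ z₁ ∈ D, ∃ R > 0, closedBall z₁ (2 * R) ⊆ D := fun z₁ h => by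
    refine ⟨S z₁ / 2, half_pos (hS0 z₁), ?_⟩
    rw [mul_div_cancel₀ _ two_ne_zero]
    exact hSD z₁ h
  refine ⟨F, fun z₁ hz₁ => ?_, ?_, hFR⟩
  · obtain ⟨R, hR, hRD⟩ := loc z₁ hz₁
    set g := (closedBall z₁ (2 * R)).indicator f with hg
    have hgi : Integrable g := (integrable_indicator_iff isClosed_closedBall.measurableSet).2
      (hi _ (isCompact_closedBall _ _) hRD)
    have hsub : ∀ z ∈ ball z₁ R, closedBall z R ⊆ closedBall z₁ (2 * R) := fun z hz =>
      closedBall_subset_closedBall' (by have := mem_ball.1 hz; linarith)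
    have e : ∀ z ∈ ball z₁ R, F z = (ringMass : ℂ)⁻¹ * ringMean g R z := by
      intro z hz
      have hzD : closedBall z R ⊆ D := (hsub z hz).trans hRD
      have h1 := hFR z (hzD (mem_closedBall_self hR.le)) R hR hzD
      have h2 : ringMean g R z = ringMean f R z := by
        refine integral_congr_ae (ae_of_all _ fun x => ?_)
        by_cases hx : x ∈ closedBall z₁ (2 * R)
        · simp [hg, hx]
        · have := ringBump_scaled_eq_zero hR (x := x) (z := z)
            fun hb => hx (hsub z hz (ball_subset_closedBall hb))
          simp [this]
      rw [h2, h1, inv_mul_cancel_left₀ hm]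
    have hd : DifferentiableAt ℂ (ringMean g R) z₁ := by
      obtain ⟨d1, d2⟩ := dbar_ringMean hgi hR z₁
      refine (dbar_eq_zero_iff d1).1 ?_
      rw [d2, neg_eq_zero]
      have hts : tsupport (fun x => ((ringBump (Complex.normSq (x - z₁) / R ^ 2) / R ^ 2 : ℝ) : ℂ)) ⊆
          closedBall z₁ (2 * R) := by
        refine (closure_minimal ?_ isClosed_closedBall).trans (hsub z₁ (mem_ball_self hR))
        intro x hx
        by_contra h
        refine hx ?_
        have := ringBump_scaled_eq_zero hR (fun hb => h (ball_subset_closedBall hb))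
        simp [this]
      have := hf _ (contDiff_ringBump_scaled R z₁) (hasCompactSupport_ringBump_scaled hR z₁)
        (hts.trans hRD)
      rw [← this]
      refine integral_congr_ae (ae_of_all _ fun x => ?_)
      by_cases hx : x ∈ closedBall z₁ (2 * R)
      · simp [hg, hx]
      · beta_reduce
        rw [dbar_eq_zero_of_notMem_tsupport fun h => hx (hts h)]
        simp
    have : F =ᶠ[nhds z₁] fun z => (ringMass : ℂ)⁻¹ * ringMean g R z := by
      filter_upwards [ball_mem_nhds z₁ hR] with z hz using e z hz
    exact ((hd.const_mul _).congr_of_eventuallyEq this).differentiableWithinAt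
  · rw [ae_iff]
    refine measure_null_of_locally_null _ fun z₁ hz₁ => ?_
    have hz₁D : z₁ ∈ D := by
      by_contra h
      exact hz₁ fun h' => absurd h' h
    obtain ⟨R, hR, hRD⟩ := loc z₁ hz₁D
    set g := (closedBall z₁ (2 * R)).indicator f with hg
    have hgi : Integrable g := (integrable_indicator_iff isClosed_closedBall.measurableSet).2
      (hi _ (isCompact_closedBall _ _) hRD)
    refine ⟨{z | ¬ (z ∈ D → f z = F z)} ∩ ball z₁ R, inter_mem_nhdsWithin _ (ball_mem_nhds z₁ hR), ?_⟩
    have hae := ae_tendsto_ringMean hgi.locallyIntegrable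
    rw [ae_iff] at hae
    refine measure_mono_null ?_ hae
    rintro z ⟨hz1, hz2⟩ hlim
    refine hz1 fun hzD => ?_
    have hgz : g z = f z := indicator_of_mem
      (ball_subset_closedBall (ball_subset_ball (by linarith) hz2)) f
    rw [hgz] at hlim
    have hconst : Tendsto (fun T => ringMean g T z) (nhdsWithin 0 (Ioi 0))
        (nhds (ringMass * F z)) := by
      refine tendsto_const_nhds.congr' ?_
      have : ∀ᶠ T : ℝ in nhdsWithin 0 (Ioi 0), T < R :=
        eventually_nhdsWithin_of_eventually_nhds (Iio_mem_nhds hR)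
      filter_upwards [this, self_mem_nhdsWithin] with T hT hT0
      have hsub : closedBall z T ⊆ closedBall z₁ (2 * R) :=
        closedBall_subset_closedBall' (by have := mem_ball.1 hz2; linarith)
      rw [← hFR z hzD T hT0 (hsub.trans hRD)]
      refine integral_congr_ae (ae_of_all _ fun x => ?_)
      by_cases hx : x ∈ closedBall z₁ (2 * R)
      · simp [hg, hx]
      · have := ringBump_scaled_eq_zero hT0 (x := x) (z := z)
          fun hb => hx (hsub (ball_subset_closedBall hb))
        simp [this]
    exact mul_left_cancel₀ hm (tendsto_nhds_unique hlim hconst)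

/-- The radial test function that equals a constant near `c`. -/
noncomputable def ringTest (c : ℂ) (R : ℝ) (z : ℂ) : ℂ :=
  ((ringPrim 1 - ringPrim (Complex.normSq (z - c) / R ^ 2) : ℝ) : ℂ)

lemma dbar_ringTest (c : ℂ) (R : ℝ) (z : ℂ) : dbar (ringTest c R) z =
    -2 * ((ringBump (Complex.normSq (z - c) / R ^ 2) / R ^ 2 : ℝ) : ℂ) * (z - c) := by
  have hd : HasDerivAt (fun t => ringPrim 1 - ringPrim (t / R ^ 2))
      (-(ringBump (Complex.normSq (z - c) / R ^ 2) / R ^ 2)) (Complex.normSq (z - c)) := by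
    refine (((hasDerivAt_ringPrim _).comp (Complex.normSq (z - c))
      ((hasDerivAt_id _).div_const (R ^ 2))).const_sub (ringPrim 1)).congr_deriv ?_
    simp
    rfl
  have := dbar_radial (u := fun t => ringPrim 1 - ringPrim (t / R ^ 2)) hd
  refine Eq.trans this ?_
  push_cast
  ring

lemma ringTest_mem_testSpace {D : Set ℂ} {c : ℂ} {R : ℝ} (hR : 0 < R) (h : closedBall c R ⊆ D) :
    ringTest c R ∈ testSpace D c := by
  have h0 : ∀ z ∉ closedBall c R, ringTest c R z = 0 := fun z hz => by
    have : 1 ≤ Complex.normSq (z - c) / R ^ 2 := (one_le_div (by positivity)).2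
      ((le_normSq_sub_iff hR).2 (le_of_lt (not_le.1 hz)))
    simp [ringTest, ringPrim_eq this]
  obtain ⟨B, hB0, hB⟩ := exists_ringBump_le
  refine ⟨Complex.ofRealCLM.contDiff.comp (contDiff_const.sub (contDiff_ringPrim.comp
    ((contDiff_normSq_sub c).div_const _))), HasCompactSupport.intro (isCompact_closedBall c R) h0,
    (closure_minimal ?_ isClosed_closedBall).trans h, 2 * (B / R ^ 2), fun z => ?_⟩
  · intro z hz
    by_contra h
    exact hz (h0 z h)
  · rw [dbar_ringTest, norm_mul, norm_mul, Complex.norm_real, Real.norm_of_nonneg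
      (div_nonneg (ringBump_nonneg _) (sq_nonneg _)), norm_neg, Complex.norm_ofNat]
    gcongr
    exact hB _

lemma sub_mul_mem_testSpace {D : Set ℂ} (z₀ : ℂ) {b : ℂ → ℂ} (h1 : ContDiff ℝ 2 b)
    (h2 : HasCompactSupport b) (h3 : tsupport b ⊆ D) :
    (fun z => (z - z₀) * b z) ∈ testSpace D z₀ ∧
      ∀ z, dbar (fun z => (z - z₀) * b z) z = (z - z₀) * dbar b z := by
  have e : ∀ z, dbar (fun z => (z - z₀) * b z) z = (z - z₀) * dbar b z := fun z => by
    have hd : DifferentiableAt ℂ (fun z : ℂ => z - z₀) z := differentiableAt_id.sub_const z₀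
    rw [dbar_mul (hd.restrictScalars ℝ) (h1.differentiable (by norm_num) z),
      (dbar_eq_zero_iff (hd.restrictScalars ℝ)).2 hd, mul_zero, add_zero]
  have hc : HasCompactSupport (dbar b) := HasCompactSupport.intro h2.isCompact fun z hz =>
    dbar_eq_zero_of_notMem_tsupport hz
  obtain ⟨B, hB⟩ := hc.exists_bound_of_continuous h1.continuous_dbar
  refine ⟨⟨(contDiff_id.sub contDiff_const).mul h1, h2.mul_left, ?_, B, fun z => ?_⟩, e⟩
  · exact (tsupport_mul_subset_right).trans h3
  · rw [e, norm_mul, mul_comm]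
    exact mul_le_mul_of_nonneg_right (hB z) (norm_nonneg _)

/-- Normalized holomorphic functions with weighted square integrals controlled by the value of the
weight at a single point. -/
lemma SubharmonicWeight.exists_holomorphic {D : Set ℂ} {r : ℂ → ℝ} {z₀ : ℂ}
    (h : SubharmonicWeight D r) (hz₀ : z₀ ∈ D) (hg : GoodPoint D r z₀) :
    ∃ C : ℝ, ∃ N : ℕ, 0 ≤ C ∧ 1 ≤ N ∧ ∀ j : ℕ, ∃ F : ℂ → ℂ, DifferentiableOn ℂ F D ∧ F z₀ = 1 ∧
      (∀ z ∈ D, ∀ R, 0 < R → closedBall z R ⊆ D → ringMean F R z = ringMass * F z) ∧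
      IntegrableOn (fun z => ‖F z‖ ^ 2 * Real.exp (-(2 * (j + N) * r z))) D ∧
      ∫ z in D, ‖F z‖ ^ 2 * Real.exp (-(2 * (j + N) * r z)) ≤
        C * Real.exp (-(2 * j * r z₀)) := by
  obtain ⟨C, N, hC, hN, hest⟩ := h.exists_apriori hz₀ hg
  set m : ℝ := -ringPrim 1 / (2 * ringMass) with hm
  have hM := ringMass_pos
  have hm0 : m ≠ 0 := div_ne_zero (neg_ne_zero.2 ringPrim_one_pos.ne') (by positivity)
  refine ⟨C / m ^ 2, N, by positivity, hN, fun j => ?_⟩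
  set w : ℂ → ℝ := fun z => Real.exp ((j + N) * r z) with hw
  have hwm : Measurable w := Real.continuous_exp.measurable.comp (h.measurable.const_mul _)
  have hw0 : ∀ z, 0 < w z := fun z => Real.exp_pos _
  have hwsq : ∀ z, w z ^ 2 = Real.exp (2 * (j + N) * r z) := fun z => by
    rw [hw]; simp only; rw [← Real.exp_nat_mul]; congr 1; push_cast; ring
  have hwb : ∀ K, IsCompact K → K ⊆ D → ∃ B, ∀ z ∈ K, ‖w z‖ ≤ B := fun K hK hKD => by
    obtain ⟨B, -, hB⟩ := h.exists_bound hK hKD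
    refine ⟨Real.exp ((j + N) * B), fun z hz => ?_⟩
    rw [Real.norm_of_nonneg (hw0 z).le]
    exact Real.exp_le_exp.2 (mul_le_mul_of_nonneg_left (hB z hz) (by positivity))
  set c := Real.sqrt (C * Real.exp (-(2 * j * r z₀))) with hc
  have hcsq : c ^ 2 = C * Real.exp (-(2 * j * r z₀)) := Real.sq_sqrt (by positivity)
  obtain ⟨k, hkm, hki, hkn, hk⟩ := exists_dual_density (D := D) (z₀ := z₀)
    (Real.sqrt_nonneg _ : 0 ≤ c) hwm hwb
    (fun b ⟨b1, b2, b3, b4⟩ => by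
      have := mul_le_mul_of_nonneg_right (hest j b b1 b2 b3 b4)
        (Real.exp_pos (-(2 * j * r z₀))).le
      rw [mul_assoc, ← Real.exp_add, add_neg_cancel, Real.exp_zero, mul_one] at this
      simp only [hwsq]
      rw [hcsq]
      linarith)
  set f : ℂ → ℂ := fun z => k z * ((w z / ‖z - z₀‖ : ℝ) * (z - z₀)) with hf
  have hfm : Measurable f := hkm.mul ((Complex.measurable_ofReal.comp (hwm.div
    (continuous_id.sub continuous_const).norm.measurable)).mul (measurable_id.sub_const z₀))
  have hfn : ∀ z, ‖f z‖ ≤ ‖k z‖ * w z := fun z => by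
    rw [hf]
    simp only [norm_mul, Complex.norm_real, norm_div, norm_norm, Real.norm_of_nonneg (hw0 z).le]
    gcongr
    rcases eq_or_ne ‖z - z₀‖ 0 with h0 | h0
    · simpa [h0] using (hw0 z).le
    · exact (div_mul_cancel₀ _ h0).le
  have hweak : WeaklyHolomorphicOn f D := by
    intro b b1 b2 b3
    obtain ⟨h1, h2⟩ := sub_mul_mem_testSpace z₀ b1 b2 b3
    have h3 := hk _ h1
    simp only [h2, sub_self, zero_mul] at h3
    rw [h3]
    refine integral_congr_ae (ae_of_all _ fun z => ?_)
    simp only [hf]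
    ring
  have hloc : ∀ K, IsCompact K → K ⊆ D → IntegrableOn f K := fun K hK hKD => by
    obtain ⟨B, hB⟩ := hwb K hK hKD
    have h1 : IntegrableOn (fun z => (1 + ‖k z‖ ^ 2) * B) K :=
      ((integrableOn_const hK.measure_lt_top.ne).add hki.integrableOn).mul_const B
    refine h1.mono' hfm.aestronglyMeasurable (ae_restrict_of_forall_mem hK.measurableSet
      fun z hz => (hfn z).trans ?_)
    have h2 := (Real.norm_of_nonneg (hw0 z).le).symm.trans_le (hB z hz)
    refine mul_le_mul ?_ h2 (hw0 z).le (by positivity)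
    nlinarith [sq_nonneg (‖k z‖ - 1)]
  obtain ⟨F, hFd, hFe, hFR⟩ := hweak.exists_holomorphic h.isOpen hloc
  have hval : F z₀ = m := by
    obtain ⟨R, hR, hRD⟩ := Metric.nhds_basis_closedBall.mem_iff.1 (h.isOpen.mem_nhds hz₀)
    have h1 := hk _ (ringTest_mem_testSpace hR hRD)
    have h2 : ringTest z₀ R z₀ = ringPrim 1 := by
      simp [ringTest, ringPrim_eq_zero (t := 0) (by norm_num)]
    have h3 := hFR z₀ hz₀ R hR hRD
    have h4 : ∫ z, k z * (dbar (ringTest z₀ R) z * (w z / ‖z - z₀‖ : ℝ)) =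
        -2 * ringMean f R z₀ := by
      rw [ringMean, ← integral_const_mul]
      refine integral_congr_ae (ae_of_all _ fun z => ?_)
      beta_reduce
      rw [dbar_ringTest]
      simp only [hf]
      ring
    rw [h2, h4, h3] at h1
    have hMc : (ringMass : ℂ) ≠ 0 := Complex.ofReal_ne_zero.2 hM.ne'
    rw [hm]
    push_cast
    rw [h1]
    field_simp
  have hae : ∀ᵐ z ∂volume.restrict D, f z = F z :=
    (ae_restrict_iff' h.isOpen.measurableSet).2 hFe
  have hmeas : AEStronglyMeasurable (fun z => ‖F z / m‖ ^ 2 *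
      Real.exp (-(2 * (j + N) * r z))) (volume.restrict D) := by
    have h1 : Measurable fun z => ‖f z / m‖ ^ 2 * Real.exp (-(2 * (j + N) * r z)) :=
      ((hfm.div_const _).norm.pow_const 2).mul
        (Real.continuous_exp.measurable.comp (h.measurable.const_mul _).neg)
    refine h1.aestronglyMeasurable.congr ?_
    filter_upwards [hae] with z hz
    rw [hz]
  have hle : ∀ᵐ z ∂volume.restrict D, ‖F z / m‖ ^ 2 * Real.exp (-(2 * (j + N) * r z)) ≤
      ‖k z‖ ^ 2 / m ^ 2 := by
    filter_upwards [hae] with z hz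
    rw [← hz, norm_div, div_pow, Complex.norm_real, Real.norm_eq_abs, sq_abs, Real.exp_neg, ← hwsq,
      ← div_eq_mul_inv, div_div, mul_comm (m ^ 2), ← div_div]
    gcongr
    rw [div_le_iff₀ (by have := hw0 z; positivity), ← mul_pow]
    exact pow_le_pow_left₀ (norm_nonneg _) (hfn z) 2
  have hint : IntegrableOn (fun z => ‖F z / m‖ ^ 2 * Real.exp (-(2 * (j + N) * r z))) D := by
    refine (hki.div_const (m ^ 2)).integrableOn.mono' hmeas ?_
    filter_upwards [hle] with z hz
    rwa [Real.norm_of_nonneg (by positivity)]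
  refine ⟨fun z => F z / m, hFd.div_const _, ?_, ?_, hint, ?_⟩
  · simp only [hval]
    exact div_self (Complex.ofReal_ne_zero.2 hm0)
  · intro z hz R hR hRD
    rw [mul_div_assoc', ← hFR z hz R hR hRD, ringMean, ringMean, ← integral_div]
    refine integral_congr_ae ?_
    filter_upwards [hFe] with x hx
    by_cases hxR : x ∈ ball z R
    · rw [hx (hRD (ball_subset_closedBall hxR))]
      ring
    · simp [ringBump_scaled_eq_zero hR hxR]
  · calc _ ≤ ∫ z in D, ‖k z‖ ^ 2 / m ^ 2 :=
          integral_mono_ae hint (hki.div_const _).integrableOn hle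
      _ ≤ ∫ z, ‖k z‖ ^ 2 / m ^ 2 := setIntegral_le_integral (hki.div_const _)
          (ae_of_all _ fun z => by positivity)
      _ ≤ c ^ 2 / m ^ 2 := by rw [integral_div]; gcongr
      _ = _ := by rw [hcsq]; ring

/-- A function with the mean value property is bounded by its mean square over a ball. -/
lemma exists_norm_le_of_ringMean {R : ℝ} (hR : 0 < R) : ∃ K, 0 ≤ K ∧ ∀ (F : ℂ → ℂ) (z : ℂ) (Q : ℝ),
    0 < Q → ContinuousOn F (closedBall z R) → ringMean F R z = ringMass * F z →
    ∫ x in closedBall z R, ‖F x‖ ^ 2 ≤ Q ^ 2 → ‖F z‖ ≤ K * Q := by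
  obtain ⟨B, hB0, hB⟩ := exists_ringBump_le
  set V := volume.real (closedBall (0 : ℂ) R) with hV
  have hM := ringMass_pos
  refine ⟨B / R ^ 2 * ((V + 1) / 2) / ringMass, by positivity, fun F z Q hQ hF hmean hI => ?_⟩
  have hVz : volume.real (closedBall z R) = V := by
    rw [hV, Measure.real, Measure.real, Complex.volume_closedBall, Complex.volume_closedBall]
  have hsq : IntegrableOn (fun x => ‖F x‖ ^ 2) (closedBall z R) :=
    (hF.norm.pow 2).integrableOn_compact (isCompact_closedBall z R)
  have hc : IntegrableOn (fun _ : ℂ => Q / 2) (closedBall z R) :=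
    integrableOn_const (isCompact_closedBall z R).measure_lt_top.ne
  have h1 : ‖ringMean F R z‖ ≤ ∫ x in closedBall z R, B / R ^ 2 * (Q / 2 + ‖F x‖ ^ 2 / (2 * Q)) := by
    rw [ringMean, ← setIntegral_eq_integral_of_forall_compl_eq_zero (s := closedBall z R)
      (fun x hx => by
        rw [ringBump_scaled_eq_zero hR (fun h => hx (ball_subset_closedBall h))]; simp)]
    refine norm_integral_le_of_norm_le ((hc.add (hsq.div_const _)).const_mul _)
      (ae_of_all _ fun x => ?_)
    rw [norm_mul, Complex.norm_real, Real.norm_of_nonneg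
      (div_nonneg (ringBump_nonneg _) (sq_nonneg _)), mul_comm]
    gcongr
    · exact hB _
    · have : Q / 2 + ‖F x‖ ^ 2 / (2 * Q) - ‖F x‖ = (‖F x‖ - Q) ^ 2 / (2 * Q) := by
        field_simp
        ring
      have h2 : 0 ≤ (‖F x‖ - Q) ^ 2 / (2 * Q) := by positivity
      linarith
  rw [integral_const_mul, integral_add hc (hsq.div_const _), setIntegral_const, integral_div, hVz,
    smul_eq_mul, hmean, norm_mul, Complex.norm_real, Real.norm_of_nonneg hM.le] at h1
  rw [div_mul_eq_mul_div, le_div_iff₀ hM, mul_comm]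
  refine h1.trans ?_
  rw [mul_assoc]
  gcongr
  have : (∫ x in closedBall z R, ‖F x‖ ^ 2) / (2 * Q) ≤ Q ^ 2 / (2 * Q) := by gcongr
  have h3 : Q ^ 2 / (2 * Q) = Q / 2 := by field_simp
  linarith

/-- The Hartogs domain over `D` with real radius function `exp (-R)`. -/
def hartogsReal (D : Set ℂ) (R : ℂ → ℝ) : Set (ℂ × ℂ) :=
  {p | p.1 ∈ D ∧ ‖p.2‖ < Real.exp (-R p.1)}

/-- A series of holomorphic functions dominated locally by a geometric series is holomorphic. -/
lemma differentiableAt_tsum_of_norm_le_geometric {E : Type*} [NormedAddCommGroup E]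
    [NormedSpace ℂ E] {h : ℕ → E → ℂ} {p : E} {η K q : ℝ} (hη : 0 < η) (hq0 : 0 ≤ q) (hq1 : q < 1)
    (hd : ∀ j, DifferentiableOn ℂ (h j) (ball p η))
    (hb : ∀ j, ∀ x ∈ ball p η, ‖h j x‖ ≤ K * q ^ j) :
    DifferentiableAt ℂ (fun x => ∑' j, h j x) p := by
  have hsum : Summable fun j => K * q ^ j := (summable_geometric_of_lt_one hq0 hq1).mul_left K
  have hη2 : 0 < η / 2 := half_pos hη
  have hsub : ∀ x ∈ ball p (η / 2), ball x (η / 2) ⊆ ball p η := fun x hx =>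
    ball_subset_ball' (by have := mem_ball.1 hx; linarith)
  refine (hasFDerivAt_tsum_of_isPreconnected (𝕜 := ℂ) (f' := fun j => fderiv ℂ (h j))
    (u := fun j => 2 * (K * q ^ j) / (η / 2)) ((hsum.mul_left 2).div_const _) isOpen_ball
    (convex_ball p (η / 2)).isPreconnected (fun j x hx => ?_) (fun j x hx => ?_)
    (mem_ball_self hη2) (Summable.of_norm_bounded hsum fun j => hb j p (mem_ball_self hη))
    (mem_ball_self hη2)).differentiableAt
  · exact ((hd j).differentiableAt (isOpen_ball.mem_nhds
      (hsub x hx (mem_ball_self hη2)))).hasFDerivAt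
  · refine Complex.norm_fderiv_le_div_of_mapsTo_ball ((hd j).mono (hsub x hx)) (fun y hy => ?_) hη2
    rw [mem_closedBall, dist_eq_norm]
    have h1 := hb j y (hsub x hx hy)
    have h2 := hb j x (hsub x hx (mem_ball_self hη2))
    exact (norm_sub_le _ _).trans (by linarith)

/-- Coefficient families on `D` whose weighted square integrals decay geometrically. -/
structure GeometricFamily (D : Set ℂ) (R : ℂ → ℝ) (F : ℕ → ℂ → ℂ) (n : ℕ) (A q : ℝ) : Prop where
  isOpen : IsOpen D
  measurable : Measurable R
  eventually_lt : ∀ z ∈ D, ∀ t, R z < t → ∀ᶠ y in nhds z, R y < t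
  pos : 0 < A
  ratio_pos : 0 < q
  ratio_lt_one : q < 1
  differentiableOn : ∀ j, DifferentiableOn ℂ (F j) D
  ringMean_eq : ∀ j, ∀ z ∈ D, ∀ s, 0 < s → closedBall z s ⊆ D →
    ringMean (F j) s z = ringMass * F j z
  integrableOn : ∀ j : ℕ, IntegrableOn (fun z => ‖F j z‖ ^ 2 * Real.exp (-(2 * (j + n + 1) * R z))) D
  integral_le : ∀ j : ℕ,
    ∫ z in D, ‖F j z‖ ^ 2 * Real.exp (-(2 * (j + n + 1) * R z)) ≤ (A * q ^ j) ^ 2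

namespace GeometricFamily

variable {D : Set ℂ} {R : ℂ → ℝ} {F : ℕ → ℂ → ℂ} {n : ℕ} {A q : ℝ}

lemma exists_bound (h : GeometricFamily D R F n A q) {p : ℂ × ℂ} (hp : p ∈ hartogsReal D R) :
    ∃ η, 0 < η ∧ ∃ K, ball p η ⊆ hartogsReal D R ∧
      ∀ j, ∀ x ∈ ball p η, ‖F j x.1 * x.2 ^ (j + n)‖ ≤ K * q ^ j := by
  obtain ⟨hpD, hpR⟩ := hp
  obtain ⟨t, ht, htp⟩ : ∃ t, R p.1 < t ∧ ‖p.2‖ < Real.exp (-t) := by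
    have hc : Tendsto (fun t => Real.exp (-t)) (nhdsWithin (R p.1) (Ioi (R p.1)))
        (nhds (Real.exp (-R p.1))) :=
      ((Real.continuous_exp.comp continuous_neg).tendsto _).mono_left nhdsWithin_le_nhds
    obtain ⟨t, h1, h2⟩ := ((hc.eventually (lt_mem_nhds hpR)).and self_mem_nhdsWithin).exists
    exact ⟨t, h2, h1⟩
  obtain ⟨s, hs, hsub⟩ := Metric.nhds_basis_closedBall.mem_iff.1
    (inter_mem (h.isOpen.mem_nhds hpD) (h.eventually_lt _ hpD t ht))
  have hs2 : 0 < s / 2 := half_pos hs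
  obtain ⟨K, hK0, hK⟩ := exists_norm_le_of_ringMean hs2
  set η := min (s / 2) (Real.exp (-t) - ‖p.2‖) with hη
  have hη0 : 0 < η := lt_min hs2 (sub_pos.2 htp)
  have hx1 : ∀ x ∈ ball p η, dist x.1 p.1 < s / 2 := fun x hx =>
    ((le_max_left _ _).trans_lt (mem_ball.1 hx)).trans_le (min_le_left _ _)
  have hx2 : ∀ x ∈ ball p η, ‖x.2‖ < Real.exp (-t) := fun x hx => by
    have h1 : dist x.2 p.2 < Real.exp (-t) - ‖p.2‖ :=
      ((le_max_right _ _).trans_lt (mem_ball.1 hx)).trans_le (min_le_right _ _)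
    rw [dist_eq_norm] at h1
    have := norm_le_norm_add_norm_sub' x.2 p.2
    linarith
  refine ⟨η, hη0, K * (Real.exp t * A), fun x hx => ?_, fun j x hx => ?_⟩
  · obtain ⟨h1, h2⟩ := hsub (mem_closedBall.2 ((hx1 x hx).le.trans (half_le_self hs.le)))
    exact ⟨h1, (hx2 x hx).trans (Real.exp_lt_exp.2 (neg_lt_neg h2))⟩
  · have hb : closedBall x.1 (s / 2) ⊆ closedBall p.1 s :=
      closedBall_subset_closedBall' (by linarith [hx1 x hx])
    have hbD : closedBall x.1 (s / 2) ⊆ D := fun y hy => (hsub (hb hy)).1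
    have hQ : 0 < Real.exp ((j + n + 1) * t) * (A * q ^ j) := by
      have := h.pos
      have := h.ratio_pos
      positivity
    have h1 : ∫ y in closedBall x.1 (s / 2), ‖F j y‖ ^ 2 ≤
        (Real.exp ((j + n + 1) * t) * (A * q ^ j)) ^ 2 := by
      have hFc := (h.differentiableOn j).continuousOn.mono hbD
      calc _ ≤ ∫ y in closedBall x.1 (s / 2), Real.exp (2 * (j + n + 1) * t) *
            (‖F j y‖ ^ 2 * Real.exp (-(2 * (j + n + 1) * R y))) := by
            refine setIntegral_mono_on ((hFc.norm.pow 2).integrableOn_compact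
              (isCompact_closedBall _ _)) (((h.integrableOn j).mono_set hbD).const_mul _)
              measurableSet_closedBall fun y hy => ?_
            rw [mul_left_comm, ← Real.exp_add]
            refine le_mul_of_one_le_right (sq_nonneg _) (Real.one_le_exp ?_)
            have : R y < t := (hsub (hb hy)).2
            have h3 : 0 ≤ 2 * ((j : ℝ) + n + 1) * (t - R y) :=
              mul_nonneg (by positivity) (by linarith)
            linarith
        _ = Real.exp (2 * (j + n + 1) * t) * ∫ y in closedBall x.1 (s / 2),
            (‖F j y‖ ^ 2 * Real.exp (-(2 * (j + n + 1) * R y))) := integral_const_mul _ _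
        _ ≤ Real.exp (2 * (j + n + 1) * t) * (A * q ^ j) ^ 2 := by
            gcongr
            refine (setIntegral_mono_set (h.integrableOn j) (ae_of_all _ fun y => ?_)
              hbD.eventuallyLE).trans (h.integral_le j)
            simp only [Pi.zero_apply]
            positivity
        _ = _ := by
            rw [mul_pow _ (A * q ^ j), ← Real.exp_nat_mul]
            congr 2
            push_cast
            ring
    have h2 := hK (F j) x.1 _ hQ ((h.differentiableOn j).continuousOn.mono hbD)
      (h.ringMean_eq j _ (hbD (mem_closedBall_self hs2.le)) _ hs2 hbD) h1
    rw [norm_mul, norm_pow]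
    calc _ ≤ K * (Real.exp ((j + n + 1) * t) * (A * q ^ j)) * Real.exp (-t) ^ (j + n) := by
          gcongr
          exact (hx2 x hx).le
      _ = K * (Real.exp ((j + n + 1) * t) * Real.exp (-t) ^ (j + n)) * (A * q ^ j) := by ring
      _ = K * Real.exp t * (A * q ^ j) := by
          rw [← Real.exp_nat_mul, ← Real.exp_add]
          congr 3
          push_cast
          ring
      _ = _ := by ring

lemma isOpen_hartogsReal (h : GeometricFamily D R F n A q) : IsOpen (hartogsReal D R) :=
  Metric.isOpen_iff.2 fun _ hp =>
    let ⟨η, hη, _, hsub, _⟩ := h.exists_bound hp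
    ⟨η, hη, hsub⟩

lemma differentiableOn_term (h : GeometricFamily D R F n A q) (j : ℕ) :
    DifferentiableOn ℂ (fun p : ℂ × ℂ => F j p.1 * p.2 ^ (j + n)) (hartogsReal D R) :=
  ((h.differentiableOn j).comp differentiableOn_fst fun _ hp => hp.1).mul
    (differentiableOn_snd.pow _)

lemma differentiableOn_tsum (h : GeometricFamily D R F n A q) :
    DifferentiableOn ℂ (fun p : ℂ × ℂ => ∑' j, F j p.1 * p.2 ^ (j + n)) (hartogsReal D R) := by
  intro p hp
  obtain ⟨η, hη, K, hsub, hb⟩ := h.exists_bound hp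
  exact (differentiableAt_tsum_of_norm_le_geometric hη h.ratio_pos.le h.ratio_lt_one
    (fun j => (h.differentiableOn_term j).mono hsub) hb).differentiableWithinAt

lemma summable (h : GeometricFamily D R F n A q) {p : ℂ × ℂ} (hp : p ∈ hartogsReal D R) :
    Summable fun j => F j p.1 * p.2 ^ (j + n) := by
  obtain ⟨η, hη, K, hsub, hb⟩ := h.exists_bound hp
  exact Summable.of_norm_bounded
    ((summable_geometric_of_lt_one h.ratio_pos.le h.ratio_lt_one).mul_left K)
    fun j => hb j p (mem_ball_self hη)

lemma lintegral_term_le (h : GeometricFamily D R F n A q) (j : ℕ) :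
    ∫⁻ p in hartogsReal D R, ENNReal.ofReal (‖F j p.1 * p.2 ^ (j + n)‖ ^ 2) ≤
      ENNReal.ofReal (Real.pi * (A * q ^ j) ^ 2) := by
  have hGm := h.isOpen_hartogsReal.measurableSet
  have hm : AEMeasurable ((hartogsReal D R).indicator fun p =>
      ENNReal.ofReal (‖F j p.1 * p.2 ^ (j + n)‖ ^ 2)) (volume.prod volume) := by
    rw [aemeasurable_indicator_iff hGm]
    exact ((((h.differentiableOn_term j).continuousOn.norm.pow 2).aestronglyMeasurable
      hGm).aemeasurable).ennreal_ofReal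
  rw [← lintegral_indicator hGm, Measure.volume_eq_prod, lintegral_prod _ hm]
  have key : ∀ z, ∫⁻ w, (hartogsReal D R).indicator (fun p =>
      ENNReal.ofReal (‖F j p.1 * p.2 ^ (j + n)‖ ^ 2)) (z, w) ≤
      D.indicator (fun z => ENNReal.ofReal (Real.pi *
        (‖F j z‖ ^ 2 * Real.exp (-(2 * (j + n + 1) * R z))))) z := by
    intro z
    by_cases hz : z ∈ D
    · rw [indicator_of_mem hz]
      set T := Real.exp (-R z) with hT
      have hT0 : 0 < T := Real.exp_pos _
      calc _ ≤ ∫⁻ w, (ball (0 : ℂ) T).indicator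
            (fun _ => ENNReal.ofReal (‖F j z‖ ^ 2 * (T ^ (j + n)) ^ 2)) w := by
            refine lintegral_mono fun w => ?_
            by_cases hw : ‖w‖ < T
            · rw [indicator_of_mem (by exact ⟨hz, hw⟩), indicator_of_mem (by simpa using hw)]
              refine ENNReal.ofReal_le_ofReal ?_
              rw [norm_mul, mul_pow, norm_pow]
              gcongr
            · rw [indicator_of_notMem (fun h => hw h.2)]
              exact zero_le
        _ = ENNReal.ofReal (‖F j z‖ ^ 2 * (T ^ (j + n)) ^ 2) * volume (ball (0 : ℂ) T) := by
            rw [lintegral_indicator measurableSet_ball, setLIntegral_const]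
        _ = ENNReal.ofReal (‖F j z‖ ^ 2 * (T ^ (j + n)) ^ 2) * ENNReal.ofReal (T ^ 2 * Real.pi) := by
            rw [Complex.volume_ball, ENNReal.ofReal_mul (sq_nonneg T), ENNReal.ofReal_pow hT0.le]
            congr 2
            rw [← ENNReal.ofReal_coe_nnreal, NNReal.coe_real_pi]
        _ = ENNReal.ofReal (Real.pi * (‖F j z‖ ^ 2 * Real.exp (-(2 * (j + n + 1) * R z)))) := by
            rw [← ENNReal.ofReal_mul (by positivity)]
            congr 1
            have : Real.exp (-(2 * (j + n + 1) * R z)) = T ^ (2 * (j + n + 1)) := by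
              rw [hT, ← Real.exp_nat_mul]
              congr 1
              push_cast
              ring
            rw [this]
            ring
        _ ≤ _ := le_rfl
    · refine (lintegral_eq_zero_of_ae_eq_zero (ae_of_all _ fun w => ?_)).le.trans zero_le
      exact indicator_of_notMem (fun h => hz h.1) _
  refine (lintegral_mono key).trans ?_
  rw [lintegral_indicator h.isOpen.measurableSet, ← ofReal_integral_eq_lintegral_ofReal
    ((h.integrableOn j).const_mul _) (ae_of_all _ fun z => by positivity), integral_const_mul]
  exact ENNReal.ofReal_le_ofReal (mul_le_mul_of_nonneg_left (h.integral_le j) Real.pi_pos.le)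

end GeometricFamily

/-- The squared norm of a series is controlled by a geometrically weighted sum of squared norms. -/
lemma ofReal_norm_tsum_sq_le {g : ℕ → ℂ} {q : ℝ} (hq0 : 0 < q) (hq1 : q < 1) :
    ENNReal.ofReal (‖∑' j, g j‖ ^ 2) ≤ ENNReal.ofReal (((1 - Real.sqrt q)⁻¹) ^ 2) *
      ∑' j, ENNReal.ofReal ((q ^ j)⁻¹) * ENNReal.ofReal (‖g j‖ ^ 2) := by
  set S := ∑' j, ENNReal.ofReal ((q ^ j)⁻¹) * ENNReal.ofReal (‖g j‖ ^ 2) with hS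
  have hu0 : 0 ≤ Real.sqrt q := Real.sqrt_nonneg q
  have hu1 : Real.sqrt q < 1 := by rwa [Real.sqrt_lt' one_pos, one_pow]
  have hu : 0 < (1 - Real.sqrt q)⁻¹ := inv_pos.2 (sub_pos.2 hu1)
  by_cases hT : S = ⊤
  · rw [hT, ENNReal.mul_top (ENNReal.ofReal_pos.2 (pow_pos hu 2)).ne']
    exact le_top
  have hs0 : 0 ≤ S.toReal := ENNReal.toReal_nonneg
  have hterm : ∀ j, ‖g j‖ ≤ Real.sqrt S.toReal * Real.sqrt q ^ j := fun j => by
    have h1 : ENNReal.ofReal ((q ^ j)⁻¹ * ‖g j‖ ^ 2) ≤ S := by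
      rw [ENNReal.ofReal_mul (by positivity)]
      exact ENNReal.le_tsum j
    rw [ENNReal.ofReal_le_iff_le_toReal hT, inv_mul_le_iff₀ (by positivity)] at h1
    refine abs_le_of_sq_le_sq' ?_ (by positivity) |>.2
    rw [mul_pow, Real.sq_sqrt hs0, ← pow_mul, mul_comm j, pow_mul, Real.sq_sqrt hq0.le, mul_comm]
    exact h1
  have hgeo := (hasSum_geometric_of_lt_one hu0 hu1).mul_left (Real.sqrt S.toReal)
  have hle := tsum_of_norm_bounded hgeo hterm
  rw [← ENNReal.ofReal_toReal hT, ← ENNReal.ofReal_mul (by positivity)]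
  refine ENNReal.ofReal_le_ofReal ?_
  calc _ ≤ (Real.sqrt S.toReal * (1 - Real.sqrt q)⁻¹) ^ 2 := by gcongr
    _ = _ := by rw [mul_pow, Real.sq_sqrt hs0, mul_comm]

lemma GeometricFamily.mem_L2h {D : Set ℂ} {R : ℂ → ℝ} {F : ℕ → ℂ → ℂ} {n : ℕ} {A q : ℝ}
    (h : GeometricFamily D R F n A q) :
    (fun p : ℂ × ℂ => ∑' j, F j p.1 * p.2 ^ (j + n)) ∈ L2h (hartogsReal D R) := by
  have hGm := h.isOpen_hartogsReal.measurableSet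
  have hq := h.ratio_pos
  refine ⟨h.differentiableOn_tsum,
    (h.differentiableOn_tsum.continuousOn.norm.pow 2).aestronglyMeasurable hGm, ?_⟩
  rw [hasFiniteIntegral_iff_ofReal (ae_of_all _ fun p => by positivity)]
  have hm : ∀ j, AEMeasurable (fun p : ℂ × ℂ => ENNReal.ofReal ((q ^ j)⁻¹) *
      ENNReal.ofReal (‖F j p.1 * p.2 ^ (j + n)‖ ^ 2)) (volume.restrict (hartogsReal D R)) :=
    fun j => ((((h.differentiableOn_term j).continuousOn.norm.pow 2).aestronglyMeasurable
      hGm).aemeasurable).ennreal_ofReal.const_mul _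
  have hs : Summable fun j : ℕ => Real.pi * A ^ 2 * q ^ j :=
    (summable_geometric_of_lt_one hq.le h.ratio_lt_one).mul_left _
  calc _ ≤ ∫⁻ p in hartogsReal D R, ENNReal.ofReal (((1 - Real.sqrt q)⁻¹) ^ 2) *
        ∑' j, ENNReal.ofReal ((q ^ j)⁻¹) * ENNReal.ofReal (‖F j p.1 * p.2 ^ (j + n)‖ ^ 2) :=
        lintegral_mono fun p => ofReal_norm_tsum_sq_le hq h.ratio_lt_one
    _ = ENNReal.ofReal (((1 - Real.sqrt q)⁻¹) ^ 2) * ∑' j, ENNReal.ofReal ((q ^ j)⁻¹) *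
        ∫⁻ p in hartogsReal D R, ENNReal.ofReal (‖F j p.1 * p.2 ^ (j + n)‖ ^ 2) := by
        rw [lintegral_const_mul' _ _ ENNReal.ofReal_ne_top, lintegral_tsum hm]
        congr 2 with j
        rw [lintegral_const_mul' _ _ ENNReal.ofReal_ne_top]
    _ ≤ ENNReal.ofReal (((1 - Real.sqrt q)⁻¹) ^ 2) *
        ∑' j : ℕ, ENNReal.ofReal (Real.pi * A ^ 2 * q ^ j) := by
        gcongr with j
        refine (mul_le_mul_right (h.lintegral_term_le j) _).trans ?_
        rw [← ENNReal.ofReal_mul (by positivity)]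
        refine ENNReal.ofReal_le_ofReal (le_of_eq ?_)
        field_simp
    _ < ⊤ := ENNReal.mul_lt_top ENNReal.ofReal_lt_top hs.tsum_ofReal_lt_top

/-- At a good point there are geometric families with prescribed exponential growth below the
weight. -/
lemma SubharmonicWeight.exists_geometricFamily {D : Set ℂ} {r : ℂ → ℝ} {z₀ : ℂ}
    (h : SubharmonicWeight D r) (hz₀ : z₀ ∈ D) (hg : GoodPoint D r z₀) {M t : ℝ}
    (ht : t < r z₀ + M) : ∃ F n A q, GeometricFamily D (fun z => r z + M) F n A q ∧
      ∀ j : ℕ, F j z₀ = (Real.exp (j * t) : ℝ) := by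
  obtain ⟨C, N, hC, hN, hF⟩ := h.exists_holomorphic hz₀ hg
  choose F hd h1 hmean hi hb using hF
  obtain ⟨n, rfl⟩ : ∃ n, N = n + 1 := ⟨N - 1, by omega⟩
  set B := C * Real.exp (-(2 * (n + 1) * M)) with hB
  have hB0 : 0 ≤ B := by positivity
  have hsplit : ∀ (j : ℕ) z, ‖((Real.exp (j * t) : ℝ) : ℂ) * F j z‖ ^ 2 *
      Real.exp (-(2 * (j + n + 1) * (r z + M))) =
      Real.exp (2 * j * t - 2 * (j + n + 1) * M) *
        (‖F j z‖ ^ 2 * Real.exp (-(2 * (j + ((n + 1 : ℕ) : ℝ)) * r z))) := fun j z => by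
    rw [norm_mul, Complex.norm_real, Real.norm_of_nonneg (Real.exp_pos _).le, mul_pow,
      ← Real.exp_nat_mul, mul_left_comm (Real.exp (2 * j * t - _)), ← Real.exp_add,
      mul_comm (Real.exp _), mul_assoc, ← Real.exp_add]
    congr 2
    push_cast
    ring
  refine ⟨fun j z => (Real.exp (j * t) : ℝ) * F j z, n, B + 1, Real.exp (t - M - r z₀),
    ⟨h.isOpen, h.measurable.add_const M, fun z hz s hs => ?_, by positivity, Real.exp_pos _,
      Real.exp_zero ▸ Real.exp_lt_exp.2 (by linarith), fun j => (hd j).const_mul _, fun j z hz s hs hsD => ?_,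
      fun j => ?_, fun j => ?_⟩, fun j => by simp only [h1, mul_one]⟩
  · filter_upwards [h.eventually_lt hz (t := s - M) (by linarith)] with y hy
    linarith
  · rw [mul_left_comm, ← hmean j z hz s hs hsD, ringMean, ringMean, ← integral_const_mul]
    simp only [mul_assoc]
  · simp only [hsplit]
    exact (hi j).const_mul _
  · simp only [hsplit]
    rw [integral_const_mul]
    calc _ ≤ Real.exp (2 * j * t - 2 * (j + n + 1) * M) * (C * Real.exp (-(2 * j * r z₀))) := by
          gcongr
          exact hb j
      _ = B * Real.exp (t - M - r z₀) ^ (2 * j) := by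
          rw [hB, mul_left_comm, ← Real.exp_add, mul_assoc C, ← Real.exp_nat_mul, ← Real.exp_add]
          congr 2
          push_cast
          ring
      _ ≤ (B + 1) ^ 2 * Real.exp (t - M - r z₀) ^ (2 * j) := by
          gcongr
          nlinarith
      _ = _ := by rw [mul_pow, ← pow_mul, mul_comm j]

lemma hartogs_eq_hartogsReal {D : Set ℂ} {ρ : ℂ → EReal} {R : ℂ → ℝ}
    (h : ∀ z ∈ D, ρ z = (R z : ℝ)) : hartogs D ρ = hartogsReal D R := by
  ext p
  refine and_congr_right fun hp => ?_
  rw [h _ hp, elog, ← EReal.coe_neg]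
  split_ifs with h0
  · simpa [le_antisymm h0 (norm_nonneg _), Real.exp_pos] using EReal.bot_lt_coe (-R p.1)
  · rw [EReal.coe_lt_coe_iff, Real.log_lt_iff_lt_exp (not_le.1 h0)]

lemma GeometricFamily.exists_hartogsExpansion {D : Set ℂ} {R : ℂ → ℝ} {F : ℕ → ℂ → ℂ} {n : ℕ}
    {A q : ℝ} (h : GeometricFamily D R F n A q) {ρ : ℂ → EReal}
    (hρ : ∀ z ∈ D, ρ z = (R z : ℝ)) : ∃ f ∈ L2h (hartogs D ρ),
      HartogsExpansion D ρ f fun j => if n ≤ j then F (j - n) else 0 := by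
  refine ⟨_, hartogs_eq_hartogsReal hρ ▸ h.mem_L2h, fun j => ?_, fun p hp => ?_⟩
  · beta_reduce
    split_ifs
    · exact h.differentiableOn _
    · exact differentiableOn_const 0
  · rw [hartogs_eq_hartogsReal hρ] at hp
    rw [← (add_left_injective n).hasSum_iff]
    · simpa [Function.comp_def] using (h.summable hp).hasSum
    · intro j hj
      have : ¬ n ≤ j := fun hnj => hj ⟨j - n, Nat.sub_add_cancel hnj⟩
      simp [this]

lemma coeffGrowth_shift {F : ℕ → ℂ → ℂ} {z : ℂ} {t : ℝ} (n : ℕ)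
    (h : ∀ j : ℕ, F j z = (Real.exp (j * t) : ℝ)) :
    coeffGrowth (fun j => if n ≤ j then F (j - n) else 0) z = t := by
  have hlim : Tendsto (fun j : ℕ => (j : ℝ)⁻¹ * ((j - n) * t)) atTop (nhds t) := by
    have h1 : Tendsto (fun j : ℕ => t - (n * t) * (j : ℝ)⁻¹) atTop (nhds (t - (n * t) * 0)) :=
      tendsto_const_nhds.sub (tendsto_inv_atTop_nhds_zero_nat.const_mul _)
    rw [mul_zero, sub_zero] at h1
    refine h1.congr' ?_
    filter_upwards [eventually_gt_atTop 0] with j hj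
    have : (j : ℝ) ≠ 0 := by positivity
    field_simp
  refine Tendsto.limsup_eq (((continuous_coe_real_ereal.tendsto t).comp hlim).congr' ?_)
  filter_upwards [eventually_ge_atTop n] with j hj
  rw [if_pos hj, h, Complex.norm_real, Real.norm_of_nonneg (Real.exp_pos _).le, elog,
    if_neg (not_le.2 (Real.exp_pos _)), Real.log_exp, Nat.cast_sub hj, Function.comp_apply,
    EReal.coe_mul]

lemma HartogsExpansion.coeffGrowth_le {D : Set ℂ} {ρ : ℂ → EReal} {f : ℂ × ℂ → ℂ}
    {fj : ℕ → ℂ → ℂ} (h : HartogsExpansion D ρ f fj) {z : ℂ} (hz : z ∈ D) :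
    coeffGrowth fj z ≤ ρ z := by
  refine EReal.le_of_forall_lt_iff_le.1 fun t ht => ?_
  have hw : (z, ((Real.exp (-t) : ℝ) : ℂ)) ∈ hartogs D ρ := by
    refine ⟨hz, ?_⟩
    rw [Complex.norm_real, Real.norm_of_nonneg (Real.exp_pos _).le, elog,
      if_neg (not_le.2 (Real.exp_pos _)), Real.log_exp, EReal.coe_neg]
    exact EReal.neg_lt_neg_iff.2 ht
  have h0 := (h.2 _ hw).summable.tendsto_atTop_zero.norm
  rw [norm_zero] at h0
  refine limsup_le_of_le (h := ?_)
  filter_upwards [h0.eventually (gt_mem_nhds one_pos), eventually_gt_atTop 0] with j hj hj0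
  rw [elog]
  have hj0' : (0 : ℝ) < j := by exact_mod_cast hj0
  split_ifs with hf
  · rw [EReal.coe_mul_bot_of_pos (inv_pos.2 hj0')]
    exact bot_le
  · rw [← EReal.coe_mul, EReal.coe_le_coe_iff, inv_mul_le_iff₀ hj0',
      Real.log_le_iff_le_exp (not_le.1 hf)]
    rw [norm_mul, norm_pow, Complex.norm_real, Real.norm_of_nonneg (Real.exp_pos _).le,
      ← Real.exp_nat_mul, mul_neg, Real.exp_neg, ← div_eq_mul_inv, div_lt_one (Real.exp_pos _)] at hj
    exact hj.le

lemma le_uscReg (g : ℂ → EReal) (z : ℂ) : g z ≤ uscReg g z :=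
  le_limsup_of_le (h := fun _ hb => hb.self_of_nhds)

lemma uscReg_le {D : Set ℂ} {ρ g : ℂ → EReal} (hD : IsOpen D) (hρ : UpperSemicontinuousOn ρ D)
    (hg : ∀ z ∈ D, g z ≤ ρ z) {z : ℂ} (hz : z ∈ D) : uscReg g z ≤ ρ z := by
  refine le_of_forall_gt_imp_ge_of_dense fun t ht => limsup_le_of_le (h := ?_)
  have h1 := hρ z hz t ht
  rw [hD.nhdsWithin_eq hz] at h1
  filter_upwards [h1, hD.mem_nhds hz] with y hy hyD using (hg y hyD).trans hy.le

lemma rhoTilde_le {D : Set ℂ} {ρ : ℂ → EReal} (hD : IsOpen D) (hρ : UpperSemicontinuousOn ρ D)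
    {z : ℂ} (hz : z ∈ D) : rhoTilde D ρ z ≤ ρ z :=
  iSup₂_le fun _ ⟨_, _, hf⟩ => uscReg_le hD hρ (fun _ hy => hf.coeffGrowth_le hy) hz

/-- **Corollary 6.** If `ρ` is subharmonic on the domain `D`, bounded from
below and not constant, then `ρ = ρ̃*` on `D`. -/
theorem corollary6 (D : Set ℂ) (hDopen : IsOpen D) (hDconn : IsConnected D)
    (ρ : ℂ → EReal) (hρ : SubharmonicOn ρ D) (hbd : ∃ M : ℝ, ∀ z ∈ D, (M : EReal) ≤ ρ z)
    (hnotconst : ¬ ∃ c : EReal, ∀ z ∈ D, ρ z = c) :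
    ∀ z ∈ D, ρ z = uscReg (rhoTilde D ρ) z := by
  intro z₀ hz₀
  obtain ⟨M, hM⟩ := hbd
  have hw := hρ.subharmonicWeight hDconn hM
  obtain ⟨-, husc, htop, -, -⟩ := hρ
  set r : ℂ → ℝ := D.indicator fun z => (ρ z).toReal - M with hr
  have hcoe : ∀ z ∈ D, ρ z = ((r z + M : ℝ) : EReal) := fun z hz => by
    have hbot : ρ z ≠ ⊥ := ((EReal.bot_lt_coe M).trans_le (hM z hz)).ne'
    rw [hr, indicator_of_mem hz, sub_add_cancel, EReal.coe_toReal (htop z hz) hbot]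
  obtain ⟨p, -, hp⟩ := hw.exists_goodPoint fun ⟨c, hc⟩ =>
    hnotconst ⟨((c + M : ℝ) : EReal), fun z hz => by rw [hcoe z hz, hc z hz]⟩
  refine le_antisymm (le_trans ?_ (le_uscReg _ _))
    (uscReg_le hDopen husc (fun z hz => rhoTilde_le hDopen husc hz) hz₀)
  rw [hcoe z₀ hz₀]
  refine EReal.ge_of_forall_gt_iff_ge.1 fun t ht => ?_
  obtain ⟨F, n, A, q, hF, hFz⟩ :=
    hw.exists_geometricFamily hz₀ (hp.forall z₀) (EReal.coe_lt_coe_iff.1 ht)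
  obtain ⟨f, hf, hfe⟩ := hF.exists_hartogsExpansion hcoe
  calc (t : EReal) = coeffGrowth (fun j => if n ≤ j then F (j - n) else 0) z₀ :=
        (coeffGrowth_shift n hFz).symm
    _ ≤ uscReg (coeffGrowth fun j => if n ≤ j then F (j - n) else 0) z₀ := le_uscReg _ _
    _ ≤ rhoTilde D ρ z₀ := le_iSup₂_of_le _ ⟨f, hf, hfe⟩ le_rfl
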